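/- Let n ≥ 1 and let u, v be probability densities on ℝⁿ such that (u dx, v dx) ∈ Π_𝒮, with Schrödinger decomposition u = f·T₁g, v = g·T₁f. Then the function t ↦ 𝒜(u dx, T_t v dx) is differentiable on [0,∞), and at t = 0 its derivative equals −(1/2) · d/ds|_{s=1} H(μ_s|dx), where μ_s = T_s f · T_{1−s} g dx is the entropic interpolation between u dx and v dx. -/

import Mathlib

open MeasureTheory Filter Set
open scoped ENNReal NNReal

noncomputable section

abbrev Eucl (n : ℕ) : Type := EuclideanSpace ℝ (Fin n)

/-- Heat semigroup `T_t` on `ℝⁿ` (generator `Δ/2`), with `T_0 f = f`. -/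
noncomputable def heat (n : ℕ) (t : ℝ) (f : Eucl n → ℝ) (x : Eucl n) : ℝ :=
  if t = 0 then f x
  else ∫ y : Eucl n, f y * Real.exp (-‖x - y‖ ^ 2 / (2 * t)) / (2 * Real.pi * t) ^ ((n : ℝ) / 2)

/-- Relative entropy `H(ρ dx | dx) = ∫ ρ log ρ dx` of a density `ρ`. -/
noncomputable def entDens (n : ℕ) (ρ : Eucl n → ℝ) : ℝ :=
  ∫ x : Eucl n, ρ x * Real.log (ρ x)

/-- The measure `ρ dx`. -/
noncomputable def densMeas (n : ℕ) (ρ : Eucl n → ℝ) : Measure (Eucl n) :=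
  (volume : Measure (Eucl n)).withDensity fun x => ENNReal.ofReal (ρ x)

/-- The measure `R₀₁(dx dy) = e^{-|x-y|²/2} (2π)^{-n/2} dx dy` on `ℝⁿ × ℝⁿ`. -/
noncomputable def R01 (n : ℕ) : Measure (Eucl n × Eucl n) :=
  (volume : Measure (Eucl n × Eucl n)).withDensity fun p =>
    ENNReal.ofReal (Real.exp (-‖p.1 - p.2‖ ^ 2 / 2) / (2 * Real.pi) ^ ((n : ℝ) / 2))

open Classical in
/-- Relative entropy `H(p|r) = ∫ log (dp/dr) dp`, `+∞` if not absolutely continuous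
(or not integrable; the paper's definition requires an integrability condition as well). -/
noncomputable def relEnt {X : Type} [MeasurableSpace X] (p r : Measure X) : EReal :=
  if p ≪ r ∧ Integrable (fun x => Real.log (p.rnDeriv r x).toReal) p
  then ((∫ x, Real.log (p.rnDeriv r x).toReal ∂p : ℝ) : EReal) else ⊤

/-- `π` is a coupling of `μ0` and `μ1`. -/
def Coupling {X : Type} [MeasurableSpace X] (π : Measure (X × X)) (μ0 μ1 : Measure X) : Prop :=
  IsProbabilityMeasure π ∧ π.map Prod.fst = μ0 ∧ π.map Prod.snd = μ1

/-- Relative entropy of a measure with respect to Lebesgue, `∫ ρ log ρ` for the density `ρ`. -/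
noncomputable def entLeb (n : ℕ) (μ : Measure (Eucl n)) : ℝ :=
  ∫ x, (μ.rnDeriv volume x).toReal * Real.log ((μ.rnDeriv volume x).toReal)

/-- Entropic cost (EReal-valued):
`𝒜(μ0,μ1) = inf { H(π|R₀₁) } - (H(μ0|dx)+H(μ1|dx))/2`. -/
noncomputable def entCostE (n : ℕ) (μ0 μ1 : Measure (Eucl n)) : EReal :=
  (⨅ π : {π : Measure (Eucl n × Eucl n) // Coupling π μ0 μ1}, relEnt (π.1) (R01 n))
    - (((entLeb n μ0 + entLeb n μ1) / 2 : ℝ) : EReal)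

/-- Entropic cost, real-valued. -/
noncomputable def entCost (n : ℕ) (μ0 μ1 : Measure (Eucl n)) : ℝ :=
  (entCostE n μ0 μ1).toReal

/-- Squared quadratic Wasserstein distance. -/
noncomputable def W2sq (n : ℕ) (μ0 μ1 : Measure (Eucl n)) : ℝ :=
  (⨅ π : {π : Measure (Eucl n × Eucl n) // Coupling π μ0 μ1},
      ∫⁻ p, (‖p.1 - p.2‖₊ : ℝ≥0∞) ^ 2 ∂(π.1)).toReal

/-- `f` is (the function of) a Schwartz function. -/
def IsSchwartz (n : ℕ) (f : Eucl n → ℝ) : Prop :=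
  ∃ F : SchwartzMap (Eucl n) ℝ, ⇑F = f

/-- The pair `(μ0, μ1)` belongs to `Π_𝒮`: it admits a Schrödinger decomposition
`μ0 = f·T₁g dx`, `μ1 = g·T₁f dx` with `f, g` positive Schwartz functions bounded below
by a Gaussian. -/
def PiS (n : ℕ) (μ0 μ1 : Measure (Eucl n)) : Prop :=
  ∃ f g : Eucl n → ℝ, IsSchwartz n f ∧ IsSchwartz n g ∧
    (∀ x, 0 < f x) ∧ (∀ x, 0 < g x) ∧
    (∃ α c : ℝ, 0 < α ∧ 0 < c ∧ (∀ x, c * Real.exp (-α * ‖x‖ ^ 2) ≤ f x) ∧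
      (∀ x, c * Real.exp (-α * ‖x‖ ^ 2) ≤ g x)) ∧
    μ0 = densMeas n (fun x => f x * heat n 1 g x) ∧
    μ1 = densMeas n (fun x => g x * heat n 1 f x)

/-- Laplacian `Δφ = ∑ᵢ ∂²φ/∂xᵢ²`. -/
noncomputable def lap (n : ℕ) (φ : Eucl n → ℝ) (x : Eucl n) : ℝ :=
  ∑ i, fderiv ℝ (fun y => fderiv ℝ φ y (EuclideanSpace.single i 1)) x (EuclideanSpace.single i 1)

/-- Squared Hilbert-Schmidt norm of the Hessian, `‖Hess φ‖² = ∑ᵢⱼ (∂ᵢ∂ⱼφ)²`. -/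
noncomputable def hessHS (n : ℕ) (φ : Eucl n → ℝ) (x : Eucl n) : ℝ :=
  ∑ i, ∑ j, (fderiv ℝ (fun y => fderiv ℝ φ y (EuclideanSpace.single j 1)) x
    (EuclideanSpace.single i 1)) ^ 2

/-- Divergence `∇·F = ∑ᵢ ∂Fᵢ/∂xᵢ` of a vector field. -/
noncomputable def diverg (n : ℕ) (F : Eucl n → Eucl n) (x : Eucl n) : ℝ :=
  ∑ i, fderiv ℝ (fun y => F y i) x (EuclideanSpace.single i 1)

/-- Heat semigroup acting componentwise on vector-valued functions. -/
noncomputable def heatV (n : ℕ) (t : ℝ) (F : Eucl n → Eucl n) (x : Eucl n) : Eucl n :=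
  (EuclideanSpace.equiv (Fin n) ℝ).symm (fun i => heat n t (fun y => F y i) x)

/-- Entropic interpolation density `μ_s = T_s f · T_{1-s} g`. -/
noncomputable def entInterp (n : ℕ) (f g : Eucl n → ℝ) (s : ℝ) (x : Eucl n) : ℝ :=
  heat n s f x * heat n (1 - s) g x

/-- The potential `θ_s = (log T_{1-s} g - log T_s f)/2`, whose gradient drives the
transport equation of the entropic interpolation. -/
noncomputable def thetaPot (n : ℕ) (f g : Eucl n → ℝ) (s : ℝ) (x : Eucl n) : ℝ :=
  (Real.log (heat n (1 - s) g x) - Real.log (heat n s f x)) / 2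

end

section
open scoped SchwartzMap LineDeriv Topology

/-! ### The Gaussian kernel as a Schwartz function -/

theorem one_add_pow_mul_exp_le (m : ℕ) {s : ℝ} (hs : 0 ≤ s) :
    (1 + s) ^ m * Real.exp (-s ^ 2 / 2) ≤ m.factorial * Real.exp (3 / 2) := by
  have h1 : (1 + s) ^ m ≤ m.factorial * Real.exp (1 + s) := by
    have := Real.pow_div_factorial_le_exp (1 + s) (by positivity) m
    rwa [div_le_iff₀ (by positivity), mul_comm] at this
  calc (1 + s) ^ m * Real.exp (-s ^ 2 / 2)
      ≤ m.factorial * Real.exp (1 + s) * Real.exp (-s ^ 2 / 2) := by gcongr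
    _ = m.factorial * Real.exp (1 + s + -s ^ 2 / 2) := by rw [mul_assoc, ← Real.exp_add]
    _ ≤ m.factorial * Real.exp (3 / 2) := by
        gcongr; nlinarith [sq_nonneg (s - 1)]

theorem iteratedFDeriv_exp_neg_sq_decay (n k j : ℕ) : ∃ C : ℝ, ∀ x : Eucl n,
    ‖x‖ ^ k * ‖iteratedFDeriv ℝ j (fun x : Eucl n => Real.exp (-‖x‖ ^ 2 / 2)) x‖ ≤ C := by
  have ht : Function.HasTemperateGrowth (fun x : Eucl n => -‖x‖ ^ 2 / 2) := by
    have := (Function.hasTemperateGrowth_norm_sq (H := Eucl n)).mul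
      (Function.HasTemperateGrowth.const (-1 / 2 : ℝ))
    refine (congrArg Function.HasTemperateGrowth (funext fun x => ?_)).mp this
    simp only [Pi.mul_apply]; ring
  obtain ⟨l, C, hC, hb⟩ := ht.norm_iteratedFDeriv_le_uniform j
  refine ⟨j.factorial * (1 + C) ^ j * ((k + l * j).factorial * Real.exp (3 / 2)), fun x => ?_⟩
  have hx : 0 ≤ ‖x‖ := norm_nonneg x
  have hone : (1 : ℝ) ≤ (1 + ‖x‖) ^ l := one_le_pow₀ (by linarith)
  have hD1 : 1 ≤ (1 + C) * (1 + ‖x‖) ^ l := by nlinarith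
  have h1 := norm_iteratedFDeriv_comp_le (g := Real.exp) (f := fun x : Eucl n => -‖x‖ ^ 2 / 2)
    (n := j) (N := (j : ℕ∞)) Real.contDiff_exp (ht.1.of_le (by exact_mod_cast le_top)) le_rfl x
    (C := Real.exp (-‖x‖ ^ 2 / 2)) (D := (1 + C) * (1 + ‖x‖) ^ l)
    (fun i _ => by
      rw [norm_iteratedFDeriv_eq_norm_iteratedDeriv, iteratedDeriv_eq_iterate,
        Real.iter_deriv_exp, Real.norm_eq_abs, abs_of_pos (Real.exp_pos _)])
    (fun i hi hij => by
      refine (hb i hij x).trans ?_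
      refine le_trans ?_ (le_self_pow₀ hD1 (by omega))
      gcongr; linarith)
  have h2 := one_add_pow_mul_exp_le (k + l * j) hx
  calc ‖x‖ ^ k * ‖iteratedFDeriv ℝ j (fun x : Eucl n => Real.exp (-‖x‖ ^ 2 / 2)) x‖
      ≤ (1 + ‖x‖) ^ k *
        (j.factorial * Real.exp (-‖x‖ ^ 2 / 2) * ((1 + C) * (1 + ‖x‖) ^ l) ^ j) := by
        gcongr
        · linarith
        · exact h1
    _ = j.factorial * (1 + C) ^ j * ((1 + ‖x‖) ^ (k + l * j) * Real.exp (-‖x‖ ^ 2 / 2)) := by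
        rw [mul_pow, ← pow_mul, pow_add]; ring
    _ ≤ _ := by gcongr

/-- The standard Gaussian density as a Schwartz function. -/
noncomputable def gaussS (n : ℕ) : 𝓢(Eucl n, ℝ) :=
  ((2 * Real.pi) ^ ((n : ℝ) / 2))⁻¹ •
    { toFun := fun x : Eucl n => Real.exp (-‖x‖ ^ 2 / 2)
      smooth' := Real.contDiff_exp.comp ((contDiff_norm_sq ℝ).neg.div_const 2)
      decay' := fun k j => iteratedFDeriv_exp_neg_sq_decay n k j }

theorem gaussS_apply (n : ℕ) (x : Eucl n) :
    gaussS n x = Real.exp (-‖x‖ ^ 2 / 2) / (2 * Real.pi) ^ ((n : ℝ) / 2) := by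
  exact (div_eq_inv_mul _ _).symm

theorem gaussS_pos (n : ℕ) (x : Eucl n) : 0 < gaussS n x := by
  rw [gaussS_apply]; positivity

theorem gaussS_neg (n : ℕ) (x : Eucl n) : gaussS n (-x) = gaussS n x := by
  simp [gaussS_apply]

theorem gaussS_sub_comm (n : ℕ) (x y : Eucl n) : gaussS n (x - y) = gaussS n (y - x) := by
  rw [← neg_sub, gaussS_neg]

theorem integral_gaussS (n : ℕ) : ∫ x, gaussS n x = 1 := by
  simp_rw [gaussS_apply, integral_div]
  have := GaussianFourier.integral_rexp_neg_mul_sq_norm (V := Eucl n) (b := 1 / 2) (by norm_num)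
  have e : ∀ x : Eucl n, -‖x‖ ^ 2 / 2 = -(1 / 2) * ‖x‖ ^ 2 := fun x => by ring
  simp_rw [e, this]
  rw [finrank_euclideanSpace_fin]
  have h2 : Real.pi / (1 / 2) = 2 * Real.pi := by ring
  rw [h2, div_self]; positivity

theorem fderiv_gaussS (n : ℕ) (x m : Eucl n) :
    fderiv ℝ (gaussS n) x m = - inner ℝ x m * gaussS n x := by
  have h0 : HasFDerivAt (fun x : Eucl n => ‖x‖ ^ 2)
      ((2 : ℕ) • (innerSL ℝ x : Eucl n →L[ℝ] ℝ)) x :=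
    (hasStrictFDerivAt_norm_sq x).hasFDerivAt
  have h1 := ((h0.const_mul (-1 / 2 : ℝ)).exp).const_mul ((2 * Real.pi) ^ ((n : ℝ) / 2))⁻¹
  have h2 : (gaussS n : Eucl n → ℝ) =
      fun x => ((2 * Real.pi) ^ ((n : ℝ) / 2))⁻¹ * Real.exp (-1 / 2 * ‖x‖ ^ 2) := by
    funext y
    rw [gaussS_apply, div_eq_inv_mul]
    congr 2; ring
  rw [h2, h1.fderiv]
  simp
  ring

/-! ### Weighted bounds -/

theorem SchwartzMap.exists_weight_bound {n : ℕ} (φ : 𝓢(Eucl n, ℝ)) (k : ℕ) :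
    ∃ C : ℝ, 0 < C ∧ ∀ x, |φ x| * (1 + ‖x‖) ^ k ≤ C := by
  have h := fun x => SchwartzMap.one_add_le_sup_seminorm_apply (𝕜 := ℝ) (m := (k, 0))
    (le_refl k) (le_refl 0) φ x
  refine ⟨max 1 (2 ^ k * ((Finset.Iic (k, 0)).sup
    fun m => SchwartzMap.seminorm ℝ m.1 m.2) φ), by positivity, fun x => ?_⟩
  have h2 := (h x).trans (le_max_right 1 _)
  rwa [norm_iteratedFDeriv_zero, Real.norm_eq_abs, mul_comm] at h2

theorem integrable_of_weight_bound {n : ℕ} {f : Eucl n → ℝ}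
    (hf : AEStronglyMeasurable f) {C : ℝ}
    (h : ∀ x, |f x| * (1 + ‖x‖) ^ (n + 1) ≤ C) : Integrable f := by
  have h1 : Integrable (fun x : Eucl n => C * (1 + ‖x‖) ^ (-((n + 1 : ℕ) : ℝ))) := by
    refine (integrable_one_add_norm ?_).const_mul C
    rw [finrank_euclideanSpace_fin]; push_cast; linarith
  refine h1.mono' hf (Eventually.of_forall fun x => ?_)
  have hx : 0 < 1 + ‖x‖ := by positivity
  rw [Real.norm_eq_abs, Real.rpow_neg hx.le, Real.rpow_natCast, ← div_eq_mul_inv,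
    le_div_iff₀ (by positivity)]
  exact h x

theorem integrable_weight_mul_gaussS (n k : ℕ) :
    Integrable (fun z : Eucl n => (1 + ‖z‖) ^ k * gaussS n z) := by
  obtain ⟨C, _, hC⟩ := (gaussS n).exists_weight_bound (k + (n + 1))
  refine integrable_of_weight_bound (C := C) (by
    have := (gaussS n).continuous
    exact (by fun_prop : Continuous _).aestronglyMeasurable) fun x => ?_
  rw [abs_mul, abs_of_nonneg (by positivity : 0 ≤ (1 + ‖x‖) ^ k)]
  calc _ = |gaussS n x| * (1 + ‖x‖) ^ (k + (n + 1)) := by rw [pow_add]; ring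
    _ ≤ C := hC x

theorem one_add_norm_le_mul {n : ℕ} {t T : ℝ} (hT : t ≤ T) (x z : Eucl n) :
    1 + ‖x‖ ≤ (1 + ‖x - √t • z‖) * ((1 + √T) * (1 + ‖z‖)) := by
  have h1 : ‖x‖ ≤ ‖x - √t • z‖ + √t * ‖z‖ := by
    have := norm_add_le (x - √t • z) (√t • z)
    rwa [sub_add_cancel, norm_smul, Real.norm_of_nonneg (Real.sqrt_nonneg t)] at this
  have h2 : √t ≤ √T := Real.sqrt_le_sqrt hT
  have h3 := Real.sqrt_nonneg t
  have h4 := norm_nonneg z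
  have h5 := norm_nonneg (x - √t • z)
  have h6 : √t * ‖z‖ ≤ √T * ‖z‖ := by gcongr
  have h7 : 0 ≤ √T * ‖z‖ := by positivity
  have h8 : 0 ≤ √T := by positivity
  nlinarith [mul_nonneg h5 h4, mul_nonneg h5 h8, mul_nonneg h5 h7]

/-! ### The heat semigroup -/

theorem heat_eq {n : ℕ} {t : ℝ} (ht : 0 ≤ t) (f : Eucl n → ℝ) (x : Eucl n) :
    heat n t f x = ∫ z, f (x - √t • z) * gaussS n z := by
  unfold heat
  split_ifs with h
  · subst h
    simp [integral_const_mul, integral_gaussS]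
  · have ht' : 0 < t := lt_of_le_of_ne ht (Ne.symm h)
    have hs : 0 < √t := Real.sqrt_pos.2 ht'
    set F : Eucl n → ℝ := fun y =>
      f y * Real.exp (-‖x - y‖ ^ 2 / (2 * t)) / (2 * Real.pi * t) ^ ((n : ℝ) / 2) with hF
    have h1 : ∫ y, F y = ∫ y, F (x - y) := (integral_sub_left_eq_self F volume x).symm
    have h2 := Measure.integral_comp_smul (volume : Measure (Eucl n)) (fun y => F (x - y)) (√t)
    rw [finrank_euclideanSpace_fin, abs_of_pos (by positivity), smul_eq_mul,
      eq_inv_mul_iff_mul_eq₀ (by positivity)] at h2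
    change ∫ y, F y = _
    rw [h1, ← h2, ← integral_const_mul]
    refine integral_congr_ae (Eventually.of_forall fun z => ?_)
    have e1 : ‖x - (x - √t • z)‖ ^ 2 = t * ‖z‖ ^ 2 := by
      rw [sub_sub_cancel, norm_smul, mul_pow, Real.norm_of_nonneg hs.le, Real.sq_sqrt ht]
    have e2 : (2 * Real.pi * t) ^ ((n : ℝ) / 2) = (2 * Real.pi) ^ ((n : ℝ) / 2) * √t ^ n := by
      rw [Real.mul_rpow (by positivity) ht, Real.sqrt_eq_rpow, ← Real.rpow_natCast,
        ← Real.rpow_mul ht]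
      ring_nf
    simp only [hF, e1, e2, gaussS_apply]
    have e3 : -(t * ‖z‖ ^ 2) / (2 * t) = -‖z‖ ^ 2 / 2 := by field_simp
    rw [e3]
    field_simp

theorem integrable_comp_mul_gaussS {n : ℕ} {f : Eucl n → ℝ} (hf : Measurable f) {M : ℝ}
    (hM : ∀ y, |f y| ≤ M) (s : ℝ) (x : Eucl n) :
    Integrable (fun z => f (x - s • z) * gaussS n z) := by
  refine ((gaussS n).integrable (μ := volume)).bdd_mul
    (hf.comp (by fun_prop)).aestronglyMeasurable (c := M) ?_
  exact Eventually.of_forall fun z => hM _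

/-- The constant controlling the growth of weighted sup norms under the heat semigroup. -/
noncomputable def heatConst (n k : ℕ) (T : ℝ) : ℝ :=
  ∫ z : Eucl n, ((1 + √T) * (1 + ‖z‖)) ^ k * gaussS n z

theorem heatConst_nonneg (n k : ℕ) (T : ℝ) : 0 ≤ heatConst n k T :=
  integral_nonneg fun z => by have := (gaussS_pos n z).le; positivity

theorem heat_weight_bound {n k : ℕ} {t T : ℝ} (ht : 0 ≤ t) (hT : t ≤ T)
    {φ : Eucl n → ℝ} {M : ℝ} (hM : ∀ y, |φ y| * (1 + ‖y‖) ^ k ≤ M) (x : Eucl n) :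
    |heat n t φ x| * (1 + ‖x‖) ^ k ≤ M * heatConst n k T := by
  rw [heat_eq ht, ← abs_of_nonneg (by positivity : 0 ≤ (1 + ‖x‖) ^ k), ← abs_mul,
    ← integral_mul_const, heatConst, ← integral_const_mul, ← Real.norm_eq_abs]
  refine norm_integral_le_of_norm_le ?_ (Eventually.of_forall fun z => ?_)
  · simp_rw [mul_pow, mul_assoc]
    exact ((integrable_weight_mul_gaussS n k).const_mul _).const_mul _
  · have hg := (gaussS_pos n z).le
    rw [Real.norm_eq_abs, abs_mul, abs_mul, abs_of_nonneg hg,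
      abs_of_nonneg (by positivity : 0 ≤ (1 + ‖x‖) ^ k)]
    have h1 : (1 + ‖x‖) ^ k ≤ (1 + ‖x - √t • z‖) ^ k * ((1 + √T) * (1 + ‖z‖)) ^ k := by
      rw [← mul_pow]; gcongr; exact one_add_norm_le_mul hT x z
    calc _ ≤ |φ (x - √t • z)| * gaussS n z *
          ((1 + ‖x - √t • z‖) ^ k * ((1 + √T) * (1 + ‖z‖)) ^ k) := by gcongr
      _ = (|φ (x - √t • z)| * (1 + ‖x - √t • z‖) ^ k) *
          (((1 + √T) * (1 + ‖z‖)) ^ k * gaussS n z) := by ring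
      _ ≤ _ := by gcongr; exact hM _

theorem heat_lower_bound (n : ℕ) {α T : ℝ} (hα : 0 ≤ α) (hT : 0 ≤ T) : ∃ κ : ℝ, 0 < κ ∧
    ∀ (φ : Eucl n → ℝ) (c M : ℝ), Measurable φ → (∀ y, |φ y| ≤ M) → 0 ≤ c →
      (∀ y, c * Real.exp (-α * ‖y‖ ^ 2) ≤ φ y) → ∀ t, 0 ≤ t → t ≤ T → ∀ x,
      c * κ * Real.exp (-(2 * α) * ‖x‖ ^ 2) ≤ heat n t φ x := by
  have hint : Integrable (fun z : Eucl n => Real.exp (-(2 * α * T) * ‖z‖ ^ 2) * gaussS n z) := by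
    refine ((gaussS n).integrable (μ := volume)).bdd_mul (c := 1)
      (by fun_prop : Continuous _).aestronglyMeasurable ?_
    refine Eventually.of_forall fun z => ?_
    rw [Real.norm_eq_abs, abs_of_pos (Real.exp_pos _), Real.exp_le_one_iff]
    have : 0 ≤ 2 * α * T * ‖z‖ ^ 2 := by positivity
    linarith
  refine ⟨∫ z : Eucl n, Real.exp (-(2 * α * T) * ‖z‖ ^ 2) * gaussS n z, ?_, ?_⟩
  · rw [integral_pos_iff_support_of_nonneg
      (fun z => by have := (gaussS_pos n z).le; positivity) hint]
    have : (Function.support fun z : Eucl n =>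
        Real.exp (-(2 * α * T) * ‖z‖ ^ 2) * gaussS n z) = univ := by
      ext z
      have := gaussS_pos n z
      simp [this.ne']
    rw [this]
    exact Measure.measure_univ_pos.2 (NeZero.ne _)
  · intro φ c M hφ hM hc hlow t ht htT x
    rw [heat_eq ht, mul_right_comm, ← integral_const_mul]
    refine integral_mono (hint.const_mul _) (integrable_comp_mul_gaussS hφ hM _ x) fun z => ?_
    have hg := gaussS_pos n z
    have h1 : ‖x - √t • z‖ ^ 2 ≤ 2 * ‖x‖ ^ 2 + 2 * T * ‖z‖ ^ 2 := by
      have h2 := norm_sub_le x (√t • z)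
      rw [norm_smul, Real.norm_of_nonneg (Real.sqrt_nonneg t)] at h2
      have h3 := Real.sq_sqrt ht
      have h4 : ‖x - √t • z‖ ^ 2 ≤ (‖x‖ + √t * ‖z‖) ^ 2 := by gcongr
      have h5 : t * ‖z‖ ^ 2 ≤ T * ‖z‖ ^ 2 := by gcongr
      have h6 : (√t * ‖z‖) ^ 2 = t * ‖z‖ ^ 2 := by rw [mul_pow, h3]
      nlinarith [sq_nonneg (‖x‖ - √t * ‖z‖)]
    calc c * Real.exp (-(2 * α) * ‖x‖ ^ 2) * (Real.exp (-(2 * α * T) * ‖z‖ ^ 2) * gaussS n z)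
        = c * Real.exp (-(2 * α) * ‖x‖ ^ 2 + -(2 * α * T) * ‖z‖ ^ 2) * gaussS n z := by
          rw [Real.exp_add]; ring
      _ ≤ c * Real.exp (-α * ‖x - √t • z‖ ^ 2) * gaussS n z := by
          gcongr; nlinarith
      _ ≤ _ := by gcongr; exact hlow _

theorem exists_abs_log_le {E : Type*} [NormedAddCommGroup E] {α c M : ℝ} (hα : 0 ≤ α) (hc : 0 < c) :
    ∃ C : ℝ, 0 ≤ C ∧ ∀ (x : E) (r : ℝ), c * Real.exp (-α * ‖x‖ ^ 2) ≤ r → r ≤ M →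
      |Real.log r| ≤ C * (1 + ‖x‖) ^ 2 := by
  refine ⟨|Real.log c| + α + |Real.log M|, by positivity, fun x r h1 h2 => ?_⟩
  have hpos : 0 < c * Real.exp (-α * ‖x‖ ^ 2) := by positivity
  have hr := hpos.trans_le h1
  have h3 := Real.log_le_log hpos h1
  have h4 := Real.log_le_log hr h2
  rw [Real.log_mul hc.ne' (Real.exp_pos _).ne', Real.log_exp] at h3
  have h5 := neg_abs_le (Real.log c)
  have h6 := le_abs_self (Real.log M)
  have hx := norm_nonneg x
  have a1 := abs_nonneg (Real.log c)
  have a2 := abs_nonneg (Real.log M)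
  have h7 : 1 ≤ (1 + ‖x‖) ^ 2 := one_le_pow₀ (by linarith)
  have h8 : ‖x‖ ^ 2 ≤ (1 + ‖x‖) ^ 2 := by gcongr; linarith
  have b1 : |Real.log c| ≤ |Real.log c| * (1 + ‖x‖) ^ 2 := le_mul_of_one_le_right a1 h7
  have b2 : |Real.log M| ≤ |Real.log M| * (1 + ‖x‖) ^ 2 := le_mul_of_one_le_right a2 h7
  have b3 : α * ‖x‖ ^ 2 ≤ α * (1 + ‖x‖) ^ 2 := by gcongr
  have b4 : 0 ≤ α * ‖x‖ ^ 2 := by positivity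
  rw [abs_le]
  constructor <;> nlinarith

end

section
open scoped SchwartzMap LineDeriv Topology

/-! ### Time derivatives of the heat semigroup -/

/-- The standard basis vectors of `ℝⁿ`. -/
noncomputable abbrev stdVec {n : ℕ} (i : Fin n) : Eucl n := EuclideanSpace.single i 1

/-- The Laplacian of a Schwartz function. -/
noncomputable def lapS {n : ℕ} (φ : 𝓢(Eucl n, ℝ)) : 𝓢(Eucl n, ℝ) :=
  ∑ i : Fin n, ∂_{stdVec i} (∂_{stdVec i} φ)

theorem lapS_apply {n : ℕ} (φ : 𝓢(Eucl n, ℝ)) (x : Eucl n) :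
    lapS φ x = ∑ i : Fin n, (∂_{stdVec i} (∂_{stdVec i} φ)) x := by
  rw [lapS, sum_apply]

theorem SchwartzMap.exists_abs_le {n : ℕ} (φ : 𝓢(Eucl n, ℝ)) : ∃ C : ℝ, 0 < C ∧ ∀ x, |φ x| ≤ C := by
  simpa using φ.exists_weight_bound 0

theorem hasFDerivAt_comp_sub_smul {n : ℕ} (φ : 𝓢(Eucl n, ℝ)) (x : Eucl n) (s : ℝ) (z : Eucl n) :
    HasFDerivAt (fun z => φ (x - s • z))
      ((fderiv ℝ φ (x - s • z)).comp (-(s • ContinuousLinearMap.id ℝ (Eucl n)))) z := by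
  have h : HasFDerivAt (fun z : Eucl n => x - s • z) (-(s • ContinuousLinearMap.id ℝ (Eucl n))) z :=
    ((hasFDerivAt_id z).const_smul s).const_sub x
  exact (φ.hasFDerivAt (x - s • z)).comp z h

theorem integral_comp_mul_inner_gaussS {n : ℕ} (φ : 𝓢(Eucl n, ℝ)) (x e : Eucl n) (s : ℝ) :
    ∫ z, φ (x - s • z) * (inner ℝ z e * gaussS n z) =
      -(s * ∫ z, (∂_{e} φ) (x - s • z) * gaussS n z) := by
  have hfd : ∀ z, fderiv ℝ (fun z => φ (x - s • z)) z e = -s * (∂_{e} φ) (x - s • z) := by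
    intro z
    rw [(hasFDerivAt_comp_sub_smul φ x s z).fderiv, SchwartzMap.lineDerivOp_apply_eq_fderiv]
    simp
  obtain ⟨C, _, hC⟩ := φ.exists_abs_le
  obtain ⟨C', _, hC'⟩ := (∂_{e} φ).exists_abs_le
  have hc := φ.continuous
  have h1 : Integrable (fun z => φ (x - s • z) * fderiv ℝ (gaussS n) z e) := by
    simp_rw [← SchwartzMap.lineDerivOp_apply_eq_fderiv]
    refine ((∂_{e} (gaussS n)).integrable (μ := volume)).bdd_mul (c := C)
      (by fun_prop : Continuous _).aestronglyMeasurable ?_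
    exact Eventually.of_forall fun z => hC _
  have h2 := integral_mul_fderiv_eq_neg_fderiv_mul_of_integrable (μ := volume) (v := e)
    (f := fun z => φ (x - s • z)) (g := gaussS n)
    (by
      simp_rw [hfd, mul_assoc]
      exact (integrable_comp_mul_gaussS (∂_{e} φ).continuous.measurable hC' s x).const_mul _)
    h1 (integrable_comp_mul_gaussS φ.continuous.measurable hC s x)
    (fun z _ => (hasFDerivAt_comp_sub_smul φ x s z).differentiableAt)
    (fun z _ => (gaussS n).differentiableAt)
  simp_rw [hfd, fderiv_gaussS, mul_assoc, integral_const_mul, neg_mul, mul_neg] at h2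
  rw [integral_neg] at h2
  linarith

theorem fderiv_eq_sum_stdVec {n : ℕ} (φ : 𝓢(Eucl n, ℝ)) (y z : Eucl n) :
    fderiv ℝ φ y z = ∑ i : Fin n, (∂_{stdVec i} φ) y *
      inner ℝ z (stdVec i) := by
  have h : z = ∑ i : Fin n, (inner ℝ z (stdVec i)) •
      (stdVec i) := by
    ext j
    simp [EuclideanSpace.inner_single_right, Finset.sum_apply, Pi.single_apply]
  conv_lhs => rw [h]
  rw [map_sum]
  refine Finset.sum_congr rfl fun i _ => ?_
  rw [map_smul, SchwartzMap.lineDerivOp_apply_eq_fderiv, smul_eq_mul, mul_comm]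

theorem SchwartzMap.exists_norm_fderiv_le {n : ℕ} (φ : 𝓢(Eucl n, ℝ)) :
    ∃ C : ℝ, 0 < C ∧ ∀ x, ‖fderiv ℝ φ x‖ ≤ C := by
  obtain ⟨C, hC, h⟩ := φ.decay 0 1
  refine ⟨C, hC, fun x => ?_⟩
  have := h x
  rwa [pow_zero, one_mul, norm_iteratedFDeriv_one] at this

theorem integrable_norm_mul_gaussS (n : ℕ) : Integrable (fun z : Eucl n => ‖z‖ * gaussS n z) := by
  refine (integrable_weight_mul_gaussS n 1).mono' ?_ (Eventually.of_forall fun z => ?_)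
  · have := (gaussS n).continuous
    exact (by fun_prop : Continuous _).aestronglyMeasurable
  · have := (gaussS_pos n z).le
    rw [Real.norm_of_nonneg (by positivity), pow_one]
    gcongr; linarith

theorem hasDerivAt_heat {n : ℕ} (φ : 𝓢(Eucl n, ℝ)) (x : Eucl n) {t : ℝ} (ht : 0 < t) :
    HasDerivAt (fun s => heat n s φ x) (1 / 2 * heat n t (lapS φ) x) t := by
  obtain ⟨C, hC0, hC⟩ := φ.exists_abs_le
  obtain ⟨C', hC0', hC'⟩ := φ.exists_norm_fderiv_le
  have hpc := (gaussS n).continuous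
  have hφc := φ.continuous
  have hφd : Continuous (fderiv ℝ φ) := (φ.smooth 1).continuous_fderiv one_ne_zero
  have hderiv : ∀ z : Eucl n, ∀ s ∈ Ioi (t / 4), HasDerivAt (fun s => φ (x - √s • z) * gaussS n z)
      (-(1 / (2 * √s)) * (fderiv ℝ φ (x - √s • z) z * gaussS n z)) s := by
    intro z s hs
    have hs0 : 0 < s := lt_trans (by positivity) hs
    have h1 : HasDerivAt (fun s : ℝ => x - √s • z) (-((1 / (2 * √s)) • z)) s :=
      ((Real.hasDerivAt_sqrt hs0.ne').smul_const z).const_sub x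
    have h2 := (φ.hasFDerivAt (x - √s • z)).comp_hasDerivAt s h1
    refine (h2.mul_const (gaussS n z)).congr_deriv ?_
    rw [map_neg, map_smul, smul_eq_mul]; ring
  have key := hasDerivAt_integral_of_dominated_loc_of_deriv_le (μ := (volume : Measure (Eucl n)))
    (F := fun s z => φ (x - √s • z) * gaussS n z) (x₀ := t) (s := Ioi (t / 4))
    (F' := fun s z => -(1 / (2 * √s)) * (fderiv ℝ φ (x - √s • z) z * gaussS n z))
    (bound := fun z => (1 / (2 * √(t / 4)) * C') * (‖z‖ * gaussS n z))
    (Ioi_mem_nhds (by linarith))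
    (Eventually.of_forall fun s => (by fun_prop : Continuous _).aestronglyMeasurable)
    (integrable_comp_mul_gaussS hφc.measurable hC _ x)
    (by fun_prop : Continuous _).aestronglyMeasurable
    (Eventually.of_forall fun z s hs => by
      have hg := (gaussS_pos n z).le
      have hs0 : 0 < s := lt_trans (by positivity) hs
      have h4 : 0 < √(t / 4) := Real.sqrt_pos.2 (by positivity)
      rw [norm_mul, norm_mul, norm_neg, Real.norm_of_nonneg hg,
        Real.norm_of_nonneg (by positivity), mul_assoc, ]
      gcongr ?_ * ?_
      · gcongr 1 / (2 * ?_)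
        exact Real.sqrt_le_sqrt (le_of_lt hs)
      · rw [← mul_assoc]
        gcongr
        exact (ContinuousLinearMap.le_opNorm _ _).trans (by gcongr; exact hC' _))
    ((integrable_norm_mul_gaussS n).const_mul _)
    (Eventually.of_forall fun z s hs => hderiv z s hs)
  have hval : ∫ z, -(1 / (2 * √t)) * (fderiv ℝ φ (x - √t • z) z * gaussS n z) =
      1 / 2 * heat n t (lapS φ) x := by
    have hs : 0 < √t := Real.sqrt_pos.2 ht
    rw [heat_eq ht.le, integral_const_mul]
    simp_rw [fderiv_eq_sum_stdVec, lapS_apply, Finset.sum_mul, mul_assoc]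
    rw [integral_finsetSum, integral_finsetSum]
    · simp_rw [integral_comp_mul_inner_gaussS]
      rw [Finset.sum_neg_distrib, ← Finset.mul_sum]
      field_simp
    · intro i _
      obtain ⟨D, _, hD⟩ := (∂_{stdVec i}
        (∂_{stdVec i} φ)).exists_abs_le
      exact integrable_comp_mul_gaussS (SchwartzMap.continuous _).measurable hD _ x
    · intro i _
      have hc := (∂_{stdVec i} φ).continuous
      obtain ⟨D, _, hD⟩ := (∂_{stdVec i} φ).exists_abs_le
      refine ((∂_{stdVec i} (gaussS n)).integrable
        (μ := volume)).neg.bdd_mul (c := D) (by fun_prop : Continuous fun z : Eucl n =>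
          (∂_{stdVec i} φ) (x - √t • z)).aestronglyMeasurable
          (Eventually.of_forall fun z => hD _) |>.congr (Eventually.of_forall fun z => ?_)
      simp only [Pi.neg_apply, SchwartzMap.lineDerivOp_apply_eq_fderiv (f := gaussS n),
        fderiv_gaussS]
      ring
  rw [← hval]
  refine key.2.congr_of_eventuallyEq ?_
  filter_upwards [Ioi_mem_nhds ht] with s hs
  rw [heat_eq (le_of_lt hs)]

theorem continuousOn_heat {n : ℕ} (φ : 𝓢(Eucl n, ℝ)) :
    ContinuousOn (fun p : ℝ × Eucl n => heat n p.1 φ p.2) (Ici 0 ×ˢ univ) := by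
  obtain ⟨C, hC0, hC⟩ := φ.exists_abs_le
  have hpc := (gaussS n).continuous
  have hφc := φ.continuous
  have h : Continuous (fun p : ℝ × Eucl n => ∫ z, φ (p.2 - √p.1 • z) * gaussS n z) := by
    refine continuous_of_dominated (bound := fun z => C * gaussS n z)
      (fun p => (by fun_prop : Continuous _).aestronglyMeasurable)
      (fun p => Eventually.of_forall fun z => ?_)
      ((gaussS n).integrable.const_mul C) (Eventually.of_forall fun z => by fun_prop)
    have hg := (gaussS_pos n z).le
    rw [norm_mul, Real.norm_of_nonneg hg]
    gcongr
    exact hC _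
  exact h.continuousOn.congr fun p hp => heat_eq hp.1 _ _

theorem continuous_heat {n : ℕ} (φ : 𝓢(Eucl n, ℝ)) {t : ℝ} (ht : 0 ≤ t) :
    Continuous (heat n t φ) := by
  rw [← continuousOn_univ]
  exact (continuousOn_heat φ).comp (f := fun x => (t, x)) (by fun_prop) fun x _ => ⟨ht, mem_univ _⟩

theorem continuousOn_heat_time {n : ℕ} (φ : 𝓢(Eucl n, ℝ)) (x : Eucl n) :
    ContinuousOn (fun s => heat n s φ x) (Ici 0) :=
  (continuousOn_heat φ).comp (f := fun s => (s, x)) (by fun_prop) fun s hs => ⟨hs, mem_univ _⟩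

theorem hasDerivWithinAt_heat {n : ℕ} (φ : 𝓢(Eucl n, ℝ)) (x : Eucl n) {t : ℝ} (ht : 0 ≤ t) :
    HasDerivWithinAt (fun s => heat n s φ x) (1 / 2 * heat n t (lapS φ) x) (Ici 0) t := by
  rcases ht.eq_or_lt with rfl | ht
  · refine hasDerivWithinAt_Ici_of_tendsto_deriv (s := Ioi 0)
      (fun s hs => (hasDerivAt_heat φ x hs).differentiableAt.differentiableWithinAt)
      ((continuousOn_heat_time φ x 0 self_mem_Ici).mono Ioi_subset_Ici_self)
      self_mem_nhdsWithin ?_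
    have h1 : Tendsto (fun s => 1 / 2 * heat n s (lapS φ) x) (𝓝[>] 0)
        (𝓝 (1 / 2 * heat n 0 (lapS φ) x)) :=
      ((continuousOn_heat_time (lapS φ) x 0 self_mem_Ici).mono Ioi_subset_Ici_self).const_mul _
    refine h1.congr' ?_
    filter_upwards [self_mem_nhdsWithin] with s hs
    exact (hasDerivAt_heat φ x hs).deriv.symm
  · exact (hasDerivAt_heat φ x ht).hasDerivWithinAt

theorem heat_sub_weight_bound {n k : ℕ} (φ : 𝓢(Eucl n, ℝ)) {M T : ℝ}
    (hM : ∀ y, |(lapS φ) y| * (1 + ‖y‖) ^ k ≤ M) {s t : ℝ} (hs : s ∈ Icc 0 T) (ht : t ∈ Icc 0 T)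
    (x : Eucl n) :
    |heat n s φ x - heat n t φ x| * (1 + ‖x‖) ^ k ≤ M * heatConst n k T * |s - t| := by
  have hw : 0 < (1 + ‖x‖) ^ k := by positivity
  have h := (convex_Icc 0 T).norm_image_sub_le_of_norm_hasDerivWithin_le
    (f := fun s => heat n s φ x) (f' := fun r => 1 / 2 * heat n r (lapS φ) x)
    (C := M * heatConst n k T / (1 + ‖x‖) ^ k)
    (fun r hr => (hasDerivWithinAt_heat φ x hr.1).mono Icc_subset_Ici_self)
    (fun r hr => by
      have h1 := heat_weight_bound hr.1 hr.2 hM x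
      rw [le_div_iff₀ hw, Real.norm_eq_abs, abs_mul, abs_of_pos (by norm_num : (0 : ℝ) < 1 / 2)]
      have := mul_nonneg (abs_nonneg (heat n r (lapS φ) x)) hw.le
      linarith) ht hs
  rw [Real.norm_eq_abs, Real.norm_eq_abs] at h
  calc _ ≤ M * heatConst n k T / (1 + ‖x‖) ^ k * |s - t| * (1 + ‖x‖) ^ k := by gcongr
    _ = _ := by field_simp

end

section
open scoped SchwartzMap LineDeriv Topology

/-! ### The heat semigroup and products on Schwartz functions -/

/-- The heat semigroup at time one, acting on Schwartz functions. -/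
noncomputable def heatS {n : ℕ} (φ : 𝓢(Eucl n, ℝ)) : 𝓢(Eucl n, ℝ) :=
  SchwartzMap.postcompCLM (𝕜 := ℝ) Complex.reCLM
    (SchwartzMap.convolution (ContinuousLinearMap.mul ℂ ℂ)
      (SchwartzMap.postcompCLM (𝕜 := ℝ) Complex.ofRealCLM (gaussS n))
      (SchwartzMap.postcompCLM (𝕜 := ℝ) Complex.ofRealCLM φ))

theorem heatS_apply {n : ℕ} (φ : 𝓢(Eucl n, ℝ)) (x : Eucl n) : heatS φ x = heat n 1 φ x := by
  rw [heat_eq zero_le_one, heatS, SchwartzMap.postcompCLM_apply, SchwartzMap.convolution_apply,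
    MeasureTheory.convolution]
  simp only [ContinuousLinearMap.mul_apply', SchwartzMap.postcompCLM_apply,
    Complex.ofRealCLM_apply, Complex.reCLM_apply, ← Complex.ofReal_mul]
  rw [integral_complex_ofReal, Complex.ofReal_re]
  simp [mul_comm]

theorem coe_heatS {n : ℕ} (φ : 𝓢(Eucl n, ℝ)) : ⇑(heatS φ) = heat n 1 φ :=
  funext (heatS_apply φ)

theorem SchwartzMap.hasDerivAt_line {n : ℕ} (φ : 𝓢(Eucl n, ℝ)) (x e : Eucl n) (s : ℝ) :
    HasDerivAt (fun s : ℝ => φ (x + s • e)) ((∂_{e} φ) (x + s • e)) s := by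
  rw [SchwartzMap.lineDerivOp_apply_eq_fderiv]
  have h : HasDerivAt (fun s : ℝ => x + s • e) ((1 : ℝ) • e) s :=
    ((hasDerivAt_id s).smul_const e).const_add x
  rw [one_smul] at h
  exact (φ.hasFDerivAt (x + s • e)).comp_hasDerivAt s h

theorem lineDerivOp_heatS {n : ℕ} (φ : 𝓢(Eucl n, ℝ)) (e : Eucl n) :
    ∂_{e} (heatS φ) = heatS (∂_{e} φ) := by
  ext x
  obtain ⟨C, hC0, hC⟩ := φ.exists_abs_le
  obtain ⟨C', hC0', hC'⟩ := (∂_{e} φ).exists_abs_le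
  have hpc := (gaussS n).continuous
  have hφc := φ.continuous
  have hφc' := (∂_{e} φ).continuous
  have key := hasDerivAt_integral_of_dominated_loc_of_deriv_le (μ := (volume : Measure (Eucl n)))
    (F := fun s z => φ (x - z + s • e) * gaussS n z) (x₀ := (0 : ℝ)) (s := univ)
    (F' := fun s z => (∂_{e} φ) (x - z + s • e) * gaussS n z)
    (bound := fun z => C' * gaussS n z) univ_mem
    (Eventually.of_forall fun s => (by fun_prop : Continuous _).aestronglyMeasurable)
    (by simpa using integrable_comp_mul_gaussS hφc.measurable hC 1 x)
    (by fun_prop : Continuous _).aestronglyMeasurable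
    (Eventually.of_forall fun z s _ => by
      rw [norm_mul, Real.norm_of_nonneg (gaussS_pos n z).le]
      have := (gaussS_pos n z).le
      gcongr
      exact hC' _)
    ((gaussS n).integrable.const_mul _)
    (Eventually.of_forall fun z s _ => (φ.hasDerivAt_line (x - z) e s).mul_const _)
  have h1 := (heatS φ).hasDerivAt_line x e 0
  have h2 : (fun s : ℝ => heatS φ (x + s • e)) =
      fun s => ∫ z, φ (x - z + s • e) * gaussS n z := by
    funext s
    rw [heatS_apply, heat_eq zero_le_one]
    simp [add_sub_right_comm]
  rw [h2] at h1
  have h3 := h1.unique key.2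
  rw [heatS_apply, heat_eq zero_le_one]
  simpa using h3

theorem integrable_schwartz_comp_mul_gaussS {n : ℕ} (φ : 𝓢(Eucl n, ℝ)) (s : ℝ) (x : Eucl n) :
    Integrable (fun z => φ (x - s • z) * gaussS n z) := by
  obtain ⟨C, -, hC⟩ := φ.exists_abs_le
  exact integrable_comp_mul_gaussS φ.continuous.measurable hC s x

theorem lapS_heatS {n : ℕ} (φ : 𝓢(Eucl n, ℝ)) : lapS (heatS φ) = heatS (lapS φ) := by
  ext x
  rw [lapS_apply]
  simp_rw [lineDerivOp_heatS, heatS_apply, heat_eq zero_le_one, lapS_apply, Finset.sum_mul]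
  rw [integral_finsetSum]
  exact fun i _ => integrable_schwartz_comp_mul_gaussS _ _ _

/-- The pointwise product of Schwartz functions. -/
noncomputable def mulS {n : ℕ} (a b : 𝓢(Eucl n, ℝ)) : 𝓢(Eucl n, ℝ) :=
  SchwartzMap.pairing (ContinuousLinearMap.mul ℝ ℝ) a b

@[simp]
theorem mulS_apply {n : ℕ} (a b : 𝓢(Eucl n, ℝ)) (x : Eucl n) : mulS a b x = a x * b x := rfl

theorem lineDerivOp_mulS {n : ℕ} (a b : 𝓢(Eucl n, ℝ)) (e : Eucl n) :
    ∂_{e} (mulS a b) = mulS (∂_{e} a) b + mulS a (∂_{e} b) := by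
  ext x
  have h1 := (mulS a b).hasDerivAt_line x e 0
  have h2 := (a.hasDerivAt_line x e 0).mul (b.hasDerivAt_line x e 0)
  have h3 := h1.unique h2
  simpa using h3

theorem lapS_mulS_apply {n : ℕ} (a b : 𝓢(Eucl n, ℝ)) (x : Eucl n) :
    lapS (mulS a b) x = lapS a x * b x + a x * lapS b x +
      2 * ∑ i : Fin n, (∂_{stdVec i} a) x * (∂_{stdVec i} b) x := by
  simp only [lapS_apply, Finset.sum_mul, Finset.mul_sum]
  rw [← Finset.sum_add_distrib, ← Finset.sum_add_distrib]
  refine Finset.sum_congr rfl fun i _ => ?_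
  simp only [lineDerivOp_mulS, LineDeriv.lineDerivOp_add, add_apply, mulS_apply]
  ring

end

section
open scoped Topology

/-! ### Differentiation of integrals along a curve of densities -/

theorem hasDerivWithinAt_integral_of_abs_sub_le {X : Type*} [MeasurableSpace X] {μ : Measure X}
    {b : ℝ → X → ℝ} {b' D : X → ℝ} {S : Set ℝ} {t₀ : ℝ} (ht₀ : t₀ ∈ S)
    (hint : ∀ᶠ t in 𝓝[S] t₀, Integrable (b t) μ)
    (hlip : ∀ᶠ t in 𝓝[S] t₀, ∀ x, |b t x - b t₀ x| ≤ |t - t₀| * D x) (hD : Integrable D μ)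
    (hb : ∀ x, HasDerivWithinAt (fun t => b t x) (b' x) S t₀) :
    HasDerivWithinAt (fun t => ∫ x, b t x ∂μ) (∫ x, b' x ∂μ) S t₀ := by
  have hint₀ : Integrable (b t₀) μ := hint.self_of_nhdsWithin ht₀
  rw [hasDerivWithinAt_iff_tendsto_slope]
  have hle : 𝓝[S \ {t₀}] t₀ ≤ 𝓝[S] t₀ := nhdsWithin_mono _ sdiff_subset
  have h1 : Tendsto (fun t => ∫ x, slope (fun t => b t x) t₀ t ∂μ) (𝓝[S \ {t₀}] t₀)
      (𝓝 (∫ x, b' x ∂μ)) := by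
    refine tendsto_integral_filter_of_dominated_convergence D ?_ ?_ hD ?_
    · filter_upwards [hle hint] with t ht
      simp only [slope_def_field]
      exact ((ht.sub hint₀).div_const _).aestronglyMeasurable
    · filter_upwards [hle hlip, self_mem_nhdsWithin] with t ht htS
      refine Eventually.of_forall fun x => ?_
      have hne : 0 < |t - t₀| := abs_pos.2 (sub_ne_zero.2 htS.2)
      rw [slope_def_field, norm_div, Real.norm_eq_abs, Real.norm_eq_abs, div_le_iff₀ hne, mul_comm]
      exact ht x
    · exact Eventually.of_forall fun x => hasDerivWithinAt_iff_tendsto_slope.1 (hb x)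
  refine h1.congr' ?_
  filter_upwards [hle hint] with t ht
  simp only [slope_def_field]
  rw [integral_div, integral_sub ht hint₀]

theorem sub_mul_log_sub_log_nonneg {a b : ℝ} (ha : 0 < a) (hb : 0 < b) :
    0 ≤ b * (Real.log b - Real.log a) - b + a ∧
      b * (Real.log b - Real.log a) - b + a ≤ (b - a) * (Real.log b - Real.log a) := by
  have h1 := Real.log_le_sub_one_of_pos (div_pos ha hb)
  have h2 := Real.log_le_sub_one_of_pos (div_pos hb ha)
  rw [Real.log_div ha.ne' hb.ne'] at h1
  rw [Real.log_div hb.ne' ha.ne'] at h2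
  have h3 : b * (Real.log a - Real.log b) ≤ a - b := by
    calc _ ≤ b * (a / b - 1) := by gcongr
      _ = a - b := by field_simp
  have h4 : a * (Real.log b - Real.log a) ≤ b - a := by
    calc _ ≤ a * (b / a - 1) := by gcongr
      _ = b - a := by field_simp
  constructor <;> linarith

theorem abs_mul_log_sub_mul_log_le {a b L : ℝ} (ha : 0 < a) (hb : 0 < b)
    (hLa : |Real.log a| ≤ L) (hLb : |Real.log b| ≤ L) :
    |b * Real.log b - a * Real.log a| ≤ |b - a| * (1 + L) := by
  wlog h : a ≤ b generalizing a b
  · rw [abs_sub_comm, abs_sub_comm b]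
    exact this hb ha hLb hLa (le_of_not_ge h)
  have h1 := (sub_mul_log_sub_log_nonneg hb ha).1
  have h2 : a * Real.log a ≤ a * Real.log b := by gcongr
  have h3 : |b * Real.log b - a * Real.log a| ≤
      |(b - a) * Real.log b| + |a * (Real.log b - Real.log a)| := by
    refine le_trans (le_of_eq ?_) (abs_add_le _ _)
    congr 1; ring
  rw [abs_mul, abs_of_nonneg (by linarith : 0 ≤ a * (Real.log b - Real.log a))] at h3
  have h4 : |b - a| * |Real.log b| ≤ |b - a| * L := by gcongr
  have h5 : b - a = |b - a| := (abs_of_nonneg (by linarith)).symm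
  linarith

section
variable {X : Type*} [MeasurableSpace X] {μ : Measure X} {a : ℝ → X → ℝ} {a' D L : X → ℝ}
  {S : Set ℝ} {t₀ : ℝ}

theorem hasDerivWithinAt_integral_mul_log (ht₀ : t₀ ∈ S)
    (hpos : ∀ᶠ t in 𝓝[S] t₀, ∀ x, 0 < a t x)
    (hlog : ∀ᶠ t in 𝓝[S] t₀, ∀ x, |Real.log (a t x)| ≤ L x)
    (hint : ∀ᶠ t in 𝓝[S] t₀, Integrable (fun x => a t x * Real.log (a t x)) μ)
    (hlip : ∀ᶠ t in 𝓝[S] t₀, ∀ x, |a t x - a t₀ x| ≤ |t - t₀| * D x)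
    (hD : Integrable (fun x => D x * (1 + L x)) μ)
    (ha : ∀ x, HasDerivWithinAt (fun t => a t x) (a' x) S t₀) :
    HasDerivWithinAt (fun t => ∫ x, a t x * Real.log (a t x) ∂μ)
      (∫ x, a' x * (Real.log (a t₀ x) + 1) ∂μ) S t₀ := by
  have hp₀ := hpos.self_of_nhdsWithin ht₀
  have hl₀ := hlog.self_of_nhdsWithin ht₀
  refine hasDerivWithinAt_integral_of_abs_sub_le ht₀ hint ?_ hD fun x => ?_
  · filter_upwards [hpos, hlog, hlip] with t hp hl hd x
    refine (abs_mul_log_sub_mul_log_le (hp₀ x) (hp x) (hl₀ x) (hl x)).trans ?_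
    rw [← mul_assoc]
    gcongr
    · have := (abs_nonneg _).trans (hl x)
      linarith
    · exact hd x
  · refine ((ha x).mul ((ha x).log (hp₀ x).ne')).congr_deriv ?_
    have := (hp₀ x).ne'
    field_simp

theorem hasDerivWithinAt_integral_remainder (ht₀ : t₀ ∈ S)
    (hpos : ∀ᶠ t in 𝓝[S] t₀, ∀ x, 0 < a t x)
    (hlog : ∀ᶠ t in 𝓝[S] t₀, ∀ x, |Real.log (a t x)| ≤ L x)
    (hmeas : ∀ᶠ t in 𝓝[S] t₀, Measurable (a t))
    (hlip : ∀ᶠ t in 𝓝[S] t₀, ∀ x, |a t x - a t₀ x| ≤ |t - t₀| * D x)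
    (hD : Integrable (fun x => D x * L x) μ)
    (ha : ∀ x, HasDerivWithinAt (fun t => a t x) (a' x) S t₀) :
    (∀ᶠ t in 𝓝[S] t₀, Integrable (fun x => a t x * (Real.log (a t x) - Real.log (a t₀ x))
      - a t x + a t₀ x) μ) ∧
    HasDerivWithinAt (fun t => ∫ x, (a t x * (Real.log (a t x) - Real.log (a t₀ x))
      - a t x + a t₀ x) ∂μ) 0 S t₀ := by
  have hp₀ := hpos.self_of_nhdsWithin ht₀
  have hl₀ := hlog.self_of_nhdsWithin ht₀
  have hm₀ := hmeas.self_of_nhdsWithin ht₀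
  have hbd : ∀ᶠ t in 𝓝[S] t₀, ∀ x, |a t x * (Real.log (a t x) - Real.log (a t₀ x))
      - a t x + a t₀ x| ≤ |t - t₀| * (2 * (D x * L x)) := by
    filter_upwards [hpos, hlog, hlip] with t hp hl hd x
    have h1 := sub_mul_log_sub_log_nonneg (hp₀ x) (hp x)
    rw [abs_of_nonneg h1.1]
    refine h1.2.trans ((le_abs_self _).trans ?_)
    rw [abs_mul]
    calc _ ≤ (|t - t₀| * D x) * (|Real.log (a t x)| + |Real.log (a t₀ x)|) := by
          gcongr
          · exact (abs_nonneg _).trans (hd x)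
          · exact hd x
          · exact abs_sub _ _
      _ ≤ (|t - t₀| * D x) * (L x + L x) := by
          gcongr
          · exact (abs_nonneg _).trans (hd x)
          · exact hl x
          · exact hl₀ x
      _ = _ := by ring
  have hint : ∀ᶠ t in 𝓝[S] t₀, Integrable (fun x => a t x *
      (Real.log (a t x) - Real.log (a t₀ x)) - a t x + a t₀ x) μ := by
    filter_upwards [hmeas, hbd] with t hm hb
    exact ((hD.const_mul 2).const_mul |t - t₀|).mono'
      (((hm.mul (hm.log.sub hm₀.log)).sub hm).add hm₀).aestronglyMeasurable
      (Eventually.of_forall hb)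
  refine ⟨hint, ?_⟩
  have h0 : HasDerivWithinAt (fun t => ∫ x, (a t x * (Real.log (a t x) - Real.log (a t₀ x))
      - a t x + a t₀ x) ∂μ) (∫ _, (0 : ℝ) ∂μ) S t₀ := by
    refine hasDerivWithinAt_integral_of_abs_sub_le ht₀ hint ?_ (hD.const_mul 2) fun x => ?_
    · filter_upwards [hbd] with t ht x
      simpa using ht x
    · have h := (((ha x).mul (((ha x).log (hp₀ x).ne').sub_const (Real.log (a t₀ x)))).sub
        (ha x)).add_const (a t₀ x)
      refine h.congr_deriv ?_
      have := (hp₀ x).ne'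
      field_simp
      ring
  simpa using h0

end

end

section
open scoped SchwartzMap LineDeriv Topology

/-! ### Gaussian lower bounds -/

/-- The function `φ` is bounded below by a positive Gaussian. -/
def HasGaussianLowerBound {n : ℕ} (φ : Eucl n → ℝ) : Prop :=
  ∃ α c : ℝ, 0 < α ∧ 0 < c ∧ ∀ x, c * Real.exp (-α * ‖x‖ ^ 2) ≤ φ x

theorem HasGaussianLowerBound.pos {n : ℕ} {φ : Eucl n → ℝ} (h : HasGaussianLowerBound φ)
    (x : Eucl n) : 0 < φ x := by
  obtain ⟨α, c, -, hc, h⟩ := h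
  exact lt_of_lt_of_le (by positivity) (h x)

theorem HasGaussianLowerBound.mul {n : ℕ} {φ ψ : Eucl n → ℝ} (h : HasGaussianLowerBound φ)
    (h' : HasGaussianLowerBound ψ) : HasGaussianLowerBound (fun x => φ x * ψ x) := by
  obtain ⟨α, c, hα, hc, h1⟩ := h
  obtain ⟨β, d, hβ, hd, h2⟩ := h'
  refine ⟨α + β, c * d, by positivity, by positivity, fun x => ?_⟩
  calc c * d * Real.exp (-(α + β) * ‖x‖ ^ 2)
      = (c * Real.exp (-α * ‖x‖ ^ 2)) * (d * Real.exp (-β * ‖x‖ ^ 2)) := by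
        rw [mul_mul_mul_comm, ← Real.exp_add]; congr 2; ring
    _ ≤ φ x * ψ x := mul_le_mul (h1 x) (h2 x) (by positivity)
        (lt_of_lt_of_le (by positivity) (h1 x)).le

theorem exists_heat_lower_bound {n : ℕ} {φ : 𝓢(Eucl n, ℝ)} (h : HasGaussianLowerBound φ) {T : ℝ}
    (hT : 0 ≤ T) : ∃ α c : ℝ, 0 < α ∧ 0 < c ∧ ∀ t ∈ Icc 0 T, ∀ x,
      c * Real.exp (-α * ‖x‖ ^ 2) ≤ heat n t φ x := by
  obtain ⟨α, c, hα, hc, h⟩ := h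
  obtain ⟨κ, hκ, hlow⟩ := heat_lower_bound n hα.le hT
  obtain ⟨M, _, hM⟩ := φ.exists_abs_le
  exact ⟨2 * α, c * κ, by positivity, by positivity, fun t ht x =>
    hlow φ c M φ.continuous.measurable hM hc.le h t ht.1 ht.2 x⟩

theorem HasGaussianLowerBound.heat {n : ℕ} {φ : 𝓢(Eucl n, ℝ)} (h : HasGaussianLowerBound φ)
    {t : ℝ} (ht : 0 ≤ t) : HasGaussianLowerBound (heat n t φ) := by
  obtain ⟨α, c, hα, hc, h⟩ := exists_heat_lower_bound h ht
  exact ⟨α, c, hα, hc, h t ⟨ht, le_rfl⟩⟩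

theorem HasGaussianLowerBound.heatS {n : ℕ} {φ : 𝓢(Eucl n, ℝ)} (h : HasGaussianLowerBound φ) :
    HasGaussianLowerBound (heatS φ) := by
  rw [coe_heatS]; exact h.heat zero_le_one

theorem HasGaussianLowerBound.mulS {n : ℕ} {φ ψ : 𝓢(Eucl n, ℝ)} (h : HasGaussianLowerBound φ)
    (h' : HasGaussianLowerBound ψ) : HasGaussianLowerBound (mulS φ ψ) := h.mul h'

theorem exists_heat_weight_bound {n : ℕ} (φ : 𝓢(Eucl n, ℝ)) (k : ℕ) (T : ℝ) :
    ∃ C : ℝ, 0 ≤ C ∧ ∀ t ∈ Icc 0 T, ∀ x, |heat n t φ x| * (1 + ‖x‖) ^ k ≤ C := by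
  obtain ⟨M, hM0, hM⟩ := φ.exists_weight_bound k
  exact ⟨M * heatConst n k T, mul_nonneg hM0.le (heatConst_nonneg n k T), fun t ht x =>
    heat_weight_bound ht.1 ht.2 hM x⟩

theorem exists_heat_sub_weight_bound {n : ℕ} (φ : 𝓢(Eucl n, ℝ)) (k : ℕ) (T : ℝ) :
    ∃ C : ℝ, 0 ≤ C ∧ ∀ s ∈ Icc 0 T, ∀ t ∈ Icc 0 T, ∀ x,
      |heat n s φ x - heat n t φ x| * (1 + ‖x‖) ^ k ≤ C * |s - t| := by
  obtain ⟨M, hM0, hM⟩ := (lapS φ).exists_weight_bound k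
  exact ⟨M * heatConst n k T, mul_nonneg hM0.le (heatConst_nonneg n k T), fun s hs t ht x =>
    heat_sub_weight_bound φ hM hs ht x⟩

theorem exists_abs_log_heat_le {n : ℕ} {φ : 𝓢(Eucl n, ℝ)} (h : HasGaussianLowerBound φ) {T : ℝ}
    (hT : 0 ≤ T) : ∃ C : ℝ, 0 ≤ C ∧ ∀ t ∈ Icc 0 T, ∀ x,
      |Real.log (heat n t φ x)| ≤ C * (1 + ‖x‖) ^ 2 := by
  obtain ⟨α, c, hα, hc, h⟩ := exists_heat_lower_bound h hT
  obtain ⟨M, hM0, hM⟩ := exists_heat_weight_bound φ 0 T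
  obtain ⟨C, hC0, hC⟩ := exists_abs_log_le (E := Eucl n) (M := M) hα.le hc
  refine ⟨C, hC0, fun t ht x => hC x _ (h t ht x) ?_⟩
  have := hM t ht x
  rw [pow_zero, mul_one] at this
  exact (le_abs_self _).trans this

theorem exists_abs_log_le_of_hasGaussianLowerBound {n : ℕ} {φ : 𝓢(Eucl n, ℝ)}
    (h : HasGaussianLowerBound φ) :
    ∃ C : ℝ, 0 ≤ C ∧ ∀ x, |Real.log (φ x)| ≤ C * (1 + ‖x‖) ^ 2 := by
  obtain ⟨C, hC0, hC⟩ := exists_abs_log_heat_le h (le_refl 0)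
  exact ⟨C, hC0, fun x => by simpa [heat] using hC 0 (by simp) x⟩

theorem abs_le_mul_inv_of_mul_le {a w C : ℝ} (hw : 0 < w) (h : |a| * w ≤ C) : |a| ≤ C * w⁻¹ := by
  rwa [← div_eq_mul_inv, le_div_iff₀ hw]

theorem integrable_inv_weight_mul {n : ℕ} {j : ℕ} {w : Eucl n → ℝ} (hw : Measurable w) {C : ℝ}
    (h : ∀ x, |w x| ≤ C * (1 + ‖x‖) ^ j) (A : ℝ) :
    Integrable (fun x => A * ((1 + ‖x‖) ^ (n + 1 + j))⁻¹ * w x) := by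
  refine integrable_of_weight_bound (C := |A| * C)
    (by fun_prop : Measurable _).aestronglyMeasurable fun x => ?_
  have hx : (0 : ℝ) < 1 + ‖x‖ := by positivity
  rw [abs_mul, abs_mul, abs_of_pos (by positivity : 0 < ((1 + ‖x‖) ^ (n + 1 + j))⁻¹)]
  calc _ ≤ |A| * ((1 + ‖x‖) ^ (n + 1 + j))⁻¹ * (C * (1 + ‖x‖) ^ j) * (1 + ‖x‖) ^ (n + 1) := by
        gcongr; exact h x
    _ = |A| * C := by rw [pow_add _ (n + 1) j]; field_simp

theorem integrable_mul_of_bounds {n j : ℕ} {a w : Eucl n → ℝ} (ha : Measurable a)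
    (hw : Measurable w) {A C : ℝ} (h : ∀ x, |a x| * (1 + ‖x‖) ^ (n + 1 + j) ≤ A)
    (h' : ∀ x, |w x| ≤ C * (1 + ‖x‖) ^ j) :
    Integrable (fun x => a x * w x) := by
  refine integrable_of_weight_bound (C := A * C)
    (by fun_prop : Measurable _).aestronglyMeasurable fun x => ?_
  have hx : (0 : ℝ) < 1 + ‖x‖ := by positivity
  rw [abs_mul]
  have hC : 0 ≤ C := nonneg_of_mul_nonneg_left ((abs_nonneg _).trans (h' x)) (by positivity)
  calc _ ≤ |a x| * (C * (1 + ‖x‖) ^ j) * (1 + ‖x‖) ^ (n + 1) := by gcongr; exact h' x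
    _ = |a x| * (1 + ‖x‖) ^ (n + 1 + j) * C := by rw [pow_add _ (n + 1) j]; ring
    _ ≤ A * C := by gcongr; exact h x

theorem abs_one_add_mul_weight_le {n : ℕ} {C : ℝ} (hC : 0 ≤ C) (x : Eucl n) :
    |1 + C * (1 + ‖x‖) ^ 2| ≤ (1 + C) * (1 + ‖x‖) ^ 2 := by
  have h : 1 ≤ (1 + ‖x‖) ^ 2 := one_le_pow₀ (by have := norm_nonneg x; linarith)
  rw [abs_of_nonneg (by positivity)]
  linarith

theorem mem_nhdsWithin_Icc_add_one (t : ℝ) : Icc 0 (t + 1) ∈ 𝓝[Ici 0] t := by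
  have : Icc 0 (t + 1) = Ici 0 ∩ Iic (t + 1) := rfl
  rw [this]
  exact inter_mem self_mem_nhdsWithin (mem_nhdsWithin_of_mem_nhds (Iic_mem_nhds (by linarith)))

theorem hasDerivWithinAt_entDens_heat {n : ℕ} {φ : 𝓢(Eucl n, ℝ)} (h : HasGaussianLowerBound φ)
    {t : ℝ} (ht : 0 ≤ t) :
    HasDerivWithinAt (fun t => entDens n (heat n t φ))
      (∫ x, 1 / 2 * heat n t (lapS φ) x * (Real.log (heat n t φ x) + 1)) (Ici 0) t := by
  have hT : 0 ≤ t + 1 := by linarith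
  obtain ⟨C, hC0, hC⟩ := exists_abs_log_heat_le h hT
  obtain ⟨A, hA0, hA⟩ := exists_heat_weight_bound φ (n + 1 + 2) (t + 1)
  obtain ⟨B, hB0, hB⟩ := exists_heat_sub_weight_bound φ (n + 1 + 2) (t + 1)
  have hnhd := mem_nhdsWithin_Icc_add_one t
  refine hasDerivWithinAt_integral_mul_log (a := fun t => heat n t φ)
    (D := fun x => B * ((1 + ‖x‖) ^ (n + 1 + 2))⁻¹) (L := fun x => C * (1 + ‖x‖) ^ 2)
    ht ?_ ?_ ?_ ?_ ?_ (fun x => hasDerivWithinAt_heat φ x ht)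
  · filter_upwards [hnhd] with s hs x using (h.heat hs.1).pos x
  · filter_upwards [hnhd] with s hs x using hC s hs x
  · filter_upwards [hnhd] with s hs
    have hm := (continuous_heat φ hs.1).measurable
    exact integrable_mul_of_bounds hm hm.log (hA s hs) (hC s hs)
  · filter_upwards [hnhd] with s hs x
    refine (abs_le_mul_inv_of_mul_le (by positivity) (hB s hs t ⟨ht, by linarith⟩ x)).trans
      (le_of_eq ?_)
    ring
  · exact integrable_inv_weight_mul (by fun_prop) (abs_one_add_mul_weight_le hC0) B

theorem hasDerivWithinAt_entDens_entInterp {n : ℕ} {f g : 𝓢(Eucl n, ℝ)}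
    (hf : HasGaussianLowerBound f) (hg : HasGaussianLowerBound g) :
    HasDerivWithinAt (fun s => entDens n (entInterp n f g s))
      (∫ x, 1 / 2 * (lapS (heatS f) x * g x - heatS f x * lapS g x) *
        (Real.log (g x * heatS f x) + 1)) (Icc 0 1) 1 := by
  obtain ⟨C, hC0, hC⟩ := exists_abs_log_heat_le hf zero_le_one
  obtain ⟨C', hC0', hC'⟩ := exists_abs_log_heat_le hg zero_le_one
  obtain ⟨A, hA0, hA⟩ := exists_heat_weight_bound f (n + 1 + 2) 1
  obtain ⟨A', hA0', hA'⟩ := exists_heat_weight_bound g 0 1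
  obtain ⟨A₂, hA0₂, hA₂⟩ := exists_heat_weight_bound f 0 1
  obtain ⟨B, hB0, hB⟩ := exists_heat_sub_weight_bound f (n + 1 + 2) 1
  obtain ⟨B', hB0', hB'⟩ := exists_heat_sub_weight_bound g (n + 1 + 2) 1
  have hmem : ∀ s : ℝ, s ∈ Icc (0 : ℝ) 1 → 1 - s ∈ Icc (0 : ℝ) 1 := fun s hs =>
    ⟨by linarith [hs.2], by linarith [hs.1]⟩
  have hlog : ∀ s ∈ Icc (0 : ℝ) 1, ∀ x, |Real.log (entInterp n f g s x)| ≤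
      (C + C') * (1 + ‖x‖) ^ 2 := by
    intro s hs x
    rw [entInterp, Real.log_mul ((hf.heat hs.1).pos x).ne' ((hg.heat (hmem s hs).1).pos x).ne',
      add_mul]
    exact (abs_add_le _ _).trans (add_le_add (hC s hs x) (hC' _ (hmem s hs) x))
  have h0 : ∀ (φ : 𝓢(Eucl n, ℝ)), heat n 0 φ = φ := fun φ => by ext x; simp [heat]
  have hderiv : ∀ x, HasDerivWithinAt (fun s => entInterp n f g s x)
      (1 / 2 * (lapS (heatS f) x * g x - heatS f x * lapS g x)) (Icc 0 1) 1 := by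
    intro x
    have h1 := (hasDerivWithinAt_heat f x zero_le_one).mono
      fun s (hs : s ∈ Icc (0 : ℝ) 1) => hs.1
    have h2 : HasDerivWithinAt (fun s : ℝ => heat n (1 - s) g x)
        (1 / 2 * heat n (1 - 1) (lapS g) x * -1) (Icc 0 1) 1 := by
      have h3 := hasDerivWithinAt_heat g x (t := 1 - 1) (by norm_num)
      exact h3.comp (1 : ℝ) ((hasDerivAt_id (1 : ℝ)).const_sub 1).hasDerivWithinAt
        fun s hs => (hmem s hs).1
    refine (h1.mul h2).congr_deriv ?_
    rw [sub_self, h0, h0, lapS_heatS, heatS_apply, heatS_apply]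
    ring
  have h1 : ∀ x, entInterp n f g 1 x = g x * heatS f x := fun x => by
    rw [entInterp, sub_self, h0, heatS_apply, mul_comm]
  simp_rw [← h1]
  refine hasDerivWithinAt_integral_mul_log (a := entInterp n f g)
    (D := fun x => (B * A' + A₂ * B') * ((1 + ‖x‖) ^ (n + 1 + 2))⁻¹)
    (L := fun x => (C + C') * (1 + ‖x‖) ^ 2)
    (right_mem_Icc.2 zero_le_one) ?_ ?_ ?_ ?_ ?_ hderiv
  · filter_upwards [self_mem_nhdsWithin] with s hs x
    exact mul_pos ((hf.heat hs.1).pos x) ((hg.heat (hmem s hs).1).pos x)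
  · filter_upwards [self_mem_nhdsWithin] with s hs x using hlog s hs x
  · filter_upwards [self_mem_nhdsWithin] with s hs
    have hm : Measurable (entInterp n f g s) := (continuous_heat f hs.1).measurable.mul
      (continuous_heat g (hmem s hs).1).measurable
    refine integrable_mul_of_bounds (A := A * A') hm hm.log (fun x => ?_) (hlog s hs)
    rw [entInterp, abs_mul, mul_right_comm]
    have := hA' _ (hmem s hs) x
    rw [pow_zero, mul_one] at this
    gcongr
    exact hA s hs x
  · filter_upwards [self_mem_nhdsWithin] with s hs x
    have hw : 0 < (1 + ‖x‖) ^ (n + 1 + 2) := by positivity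
    have e1 := abs_le_mul_inv_of_mul_le hw (hB s hs 1 (right_mem_Icc.2 zero_le_one) x)
    have e2 := abs_le_mul_inv_of_mul_le hw
      (hB' _ (hmem s hs) _ (hmem 1 (right_mem_Icc.2 zero_le_one)) x)
    have e3 := hA' _ (hmem s hs) x
    have e4 := hA₂ _ (right_mem_Icc.2 zero_le_one) x
    rw [pow_zero, mul_one] at e3 e4
    have e5 : |1 - s - (1 - 1)| = |s - 1| := by rw [← abs_neg]; congr 1; ring
    rw [e5] at e2
    simp only [entInterp]
    calc _ = |(heat n s f x - heat n 1 f x) * heat n (1 - s) g x +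
          heat n 1 f x * (heat n (1 - s) g x - heat n (1 - 1) g x)| := by congr 1; ring
      _ ≤ |heat n s f x - heat n 1 f x| * |heat n (1 - s) g x| +
          |heat n 1 f x| * |heat n (1 - s) g x - heat n (1 - 1) g x| := by
          rw [← abs_mul, ← abs_mul]; exact abs_add_le _ _
      _ ≤ (B * |s - 1| * ((1 + ‖x‖) ^ (n + 1 + 2))⁻¹) * A' +
          A₂ * (B' * |s - 1| * ((1 + ‖x‖) ^ (n + 1 + 2))⁻¹) := by gcongr
      _ = _ := by ring
  · exact integrable_inv_weight_mul (by fun_prop)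
      (abs_one_add_mul_weight_le (add_nonneg hC0 hC0')) _

end

section
open scoped Topology

/-! ### Infima of affine functions with clustering slopes -/

section
variable {ι : Type*} {A B : ι → ℝ} {A₀ M K : ℝ}

theorem bddBelow_range_add_mul (hA : ∀ i, A₀ ≤ A i) (hB : ∀ i, |B i| ≤ M) (τ : ℝ) :
    BddBelow (range fun i => A i + τ * B i) := by
  refine ⟨A₀ - |τ| * M, ?_⟩
  rintro _ ⟨i, rfl⟩
  have h1 : |τ * B i| ≤ |τ| * M := by rw [abs_mul]; gcongr; exact hB i
  have h2 := neg_abs_le (τ * B i)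
  have h3 := hA i
  simp only
  linarith

theorem iInf_add_mul_le (hA : ∀ i, A₀ ≤ A i) (hB : ∀ i, |B i| ≤ M) (τ : ℝ) (i : ι) :
    (⨅ i, (A i + τ * B i)) ≤ A i + τ * B i :=
  ciInf_le (bddBelow_range_add_mul hA hB τ) i

theorem exists_add_mul_le_iInf_add [Nonempty ι] (τ : ℝ) {ε : ℝ} (hε : 0 < ε) :
    ∃ i, A i + τ * B i ≤ (⨅ i, (A i + τ * B i)) + ε := by
  have h : (⨅ i, (A i + τ * B i)) < (⨅ i, (A i + τ * B i)) + ε := by linarith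
  obtain ⟨i, hi⟩ := exists_lt_of_ciInf_lt h
  exact ⟨i, hi.le⟩

/-- Almost minimizers have slopes close to a common value. -/
theorem exists_slope_of_almost_minimizers [Nonempty ι] (τ : ℝ)
    (hclose : ∀ ε : ℝ, 0 < ε → ∀ i j, A i + τ * B i ≤ (⨅ i, (A i + τ * B i)) + ε →
      A j + τ * B j ≤ (⨅ i, (A i + τ * B i)) + ε → |B i - B j| ≤ K * √ε) :
    ∃ β : ℝ, ∀ ε : ℝ, 0 < ε → ∀ i, A i + τ * B i ≤ (⨅ i, (A i + τ * B i)) + ε →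
      |B i - β| ≤ K * √ε := by
  choose i hi using fun k : ℕ => exists_add_mul_le_iInf_add (A := A) (B := B) τ
    (ε := 1 / ((k : ℝ) + 1)) (by positivity)
  have hlim : Tendsto (fun k : ℕ => K * √(1 / ((k : ℝ) + 1))) atTop (𝓝 0) := by
    simpa using (tendsto_one_div_add_atTop_nhds_zero_nat (𝕜 := ℝ)).sqrt.const_mul K
  have hc : CauchySeq fun k => B (i k) := by
    refine cauchySeq_of_le_tendsto_0 _ (fun k l N hk hl => ?_) hlim
    rw [Real.dist_eq]
    exact hclose _ (by positivity) _ _ ((hi k).trans (by gcongr))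
      ((hi l).trans (by gcongr))
  obtain ⟨β, hβ⟩ := cauchySeq_tendsto_of_complete hc
  refine ⟨β, fun ε hε j hj => ?_⟩
  refine le_of_tendsto ((tendsto_const_nhds.sub hβ).abs) ?_
  filter_upwards [(tendsto_one_div_add_atTop_nhds_zero_nat (𝕜 := ℝ)).eventually_le_const hε]
    with k hk
  exact hclose ε hε j (i k) hj ((hi k).trans (by gcongr))

theorem differentiableAt_iInf_add_mul [Nonempty ι] (hA : ∀ i, A₀ ≤ A i) (hB : ∀ i, |B i| ≤ M)
    (hK : 0 ≤ K) (τ : ℝ)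
    (hclose : ∀ ε : ℝ, 0 < ε → ∀ i j, A i + τ * B i ≤ (⨅ i, (A i + τ * B i)) + ε →
      A j + τ * B j ≤ (⨅ i, (A i + τ * B i)) + ε → |B i - B j| ≤ K * √ε) :
    DifferentiableAt ℝ (fun τ => ⨅ i, (A i + τ * B i)) τ := by
  obtain ⟨β, hβ⟩ := exists_slope_of_almost_minimizers τ hclose
  have hM : 0 ≤ M := (abs_nonneg _).trans (hB (Classical.arbitrary ι))
  set J : ℝ → ℝ := fun τ => ⨅ i, (A i + τ * B i) with hJ
  have hle : ∀ τ i, J τ ≤ A i + τ * B i := fun τ i => iInf_add_mul_le hA hB τ i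
  have hex : ∀ τ (ε : ℝ), 0 < ε → ∃ i, A i + τ * B i ≤ J τ + ε := fun τ ε hε =>
    exists_add_mul_le_iInf_add τ hε
  have hmain : ∀ h : ℝ, |J (τ + h) - J τ - h * β| ≤
      |h| * ((1 + K) * |h| + K * √(h ^ 2 + 2 * M * |h|)) := by
    intro h
    rcases eq_or_ne h 0 with rfl | hne
    · simp
    have hpos : 0 < h ^ 2 := by positivity
    have habs : 0 < |h| := abs_pos.2 hne
    have hsq : √(h ^ 2) = |h| := Real.sqrt_sq_eq_abs h
    have hh : |h| * |h| = h ^ 2 := by rw [← sq, sq_abs]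
    obtain ⟨j, hj⟩ := hex τ (h ^ 2) hpos
    obtain ⟨i, hi⟩ := hex (τ + h) (h ^ 2) hpos
    have hBh : ∀ i, |h * B i| ≤ |h| * M := fun i => by rw [abs_mul]; gcongr; exact hB i
    have e1 := (abs_le.1 (hBh i)).1
    have e2 := (abs_le.1 (hBh j)).2
    have e3 := hle (τ + h) j
    have e4 := hle τ i
    have hi' : A i + τ * B i ≤ J τ + (2 * h ^ 2 + 2 * M * |h|) := by linarith
    have hβj := hβ _ hpos j hj
    rw [hsq] at hβj
    have hLip : J (τ + h) ≤ J τ + M * |h| := by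
      refine le_of_forall_pos_le_add fun δ hδ => ?_
      obtain ⟨k, hk⟩ := hex τ δ hδ
      have e5 := (abs_le.1 (hBh k)).2
      have e6 := hle (τ + h) k
      linarith
    have hi'' : A i + τ * B i ≤ J τ + (h ^ 2 + 2 * M * |h|) := by linarith
    have hβi := hβ _ (by positivity) i hi''
    have f1 : |h * (B i - β)| ≤ |h| * (K * √(h ^ 2 + 2 * M * |h|)) := by
      rw [abs_mul]; gcongr
    have f2 : |h * (B j - β)| ≤ |h| * (K * |h|) := by
      rw [abs_mul]; gcongr
    have f3 := (abs_le.1 f1).1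
    have f4 := (abs_le.1 f2).2
    have f5 : 0 ≤ |h| * (K * √(h ^ 2 + 2 * M * |h|)) := by positivity
    have f6 : 0 ≤ K * h ^ 2 := by positivity
    rw [abs_le]
    constructor <;> nlinarith
  refine HasDerivAt.differentiableAt (f' := β) ?_
  rw [hasDerivAt_iff_isLittleO_nhds_zero]
  have h1 : Tendsto (fun h : ℝ => (1 + K) * |h| + K * √(h ^ 2 + 2 * M * |h|)) (𝓝 0) (𝓝 0) := by
    have : Continuous (fun h : ℝ => (1 + K) * |h| + K * √(h ^ 2 + 2 * M * |h|)) := by fun_prop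
    simpa using this.tendsto 0
  have h2 := (Asymptotics.isBigO_refl (fun h : ℝ => h) (𝓝 0)).mul_isLittleO
    ((Asymptotics.isLittleO_one_iff ℝ).2 h1)
  simp only [mul_one] at h2
  refine Asymptotics.IsBigO.trans_isLittleO (Asymptotics.IsBigO.of_bound 1 ?_) h2
  refine Eventually.of_forall fun h => ?_
  rw [one_mul, norm_mul, Real.norm_eq_abs, Real.norm_eq_abs, smul_eq_mul]
  refine (hmain h).trans ?_
  gcongr
  exact le_abs_self _

end

/-! ### Strong convexity of the relative entropy -/

open InformationTheory in
theorem klFun_add_div_two_le {a b : ℝ} (ha : 0 ≤ a) (hb : 0 ≤ b) :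
    klFun ((a + b) / 2) ≤ 1 / 2 * klFun a + 1 / 2 * klFun b - 1 / 4 * (√a - √b) ^ 2 := by
  have key : ∀ c m : ℝ, 0 ≤ c → 0 < m →
      2 * c - 2 * (√c * √m) ≤ c * Real.log c - c * Real.log m := by
    intro c m hc hm
    rcases hc.eq_or_lt with rfl | hc
    · simp
    have hsc : 0 < √c := Real.sqrt_pos.2 hc
    have hsm : 0 < √m := Real.sqrt_pos.2 hm
    have h1 := Real.log_le_sub_one_of_pos (div_pos hsm hsc)
    rw [Real.log_div hsm.ne' hsc.ne', Real.log_sqrt hm.le, Real.log_sqrt hc.le] at h1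
    have h2 : c * (√m / √c) = √c * √m := by
      nth_rewrite 1 [← Real.mul_self_sqrt hc.le]
      field_simp
    have h3 : c * (Real.log m / 2 - Real.log c / 2) ≤ c * (√m / √c - 1) := by gcongr
    linarith
  rcases (add_nonneg ha hb).eq_or_lt with h | h
  · have ha0 : a = 0 := by linarith
    have hb0 : b = 0 := by linarith
    subst ha0 hb0
    simp [klFun]
    norm_num
  set m := (a + b) / 2 with hm
  have hm0 : 0 < m := by positivity
  have k1 := key a m ha hm0
  have k2 := key b m hb hm0
  have s1 := Real.sq_sqrt ha
  have s2 := Real.sq_sqrt hb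
  have s3 := Real.sq_sqrt hm0.le
  have hab : a + b = 2 * m := by rw [hm]; ring
  have hlog : a * Real.log m + b * Real.log m = 2 * (m * Real.log m) := by
    rw [← add_mul, hab]; ring
  simp only [klFun]
  nlinarith [sq_nonneg (2 * √m - (√a + √b))]

end

section
open InformationTheory in
theorem differentiableAt_iInf_integral_klFun_add {Z : Type*} [MeasurableSpace Z] {P : Measure Z}
    {S : Set (Z → ℝ)} (hne : S.Nonempty) {c q : Z → ℝ} (hc : ∀ z, 0 ≤ c z) {Q : ℝ}
    (hq : AEStronglyMeasurable q P)
    (hS : ∀ a ∈ S, (∀ z, 0 ≤ a z) ∧ Integrable a P ∧ ∫ z, a z ∂P = 1 ∧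
      Integrable (fun z => klFun (a z)) P ∧ Integrable (fun z => c z * a z) P ∧
      Integrable (fun z => q z ^ 2 * a z) P ∧ ∫ z, q z ^ 2 * a z ∂P ≤ Q)
    (hmid : ∀ a ∈ S, ∀ b ∈ S, (fun z => (a z + b z) / 2) ∈ S) (τ : ℝ) :
    DifferentiableAt ℝ (fun τ => ⨅ a : S, (((∫ z, klFun (a.1 z) ∂P) + ∫ z, c z * a.1 z ∂P)
      + τ * ∫ z, q z * a.1 z ∂P)) τ := by
  have : Nonempty S := hne.to_subtype
  have hQ : 0 ≤ Q := by
    obtain ⟨a, ha⟩ := hne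
    obtain ⟨h0, -, -, -, -, -, h⟩ := hS a ha
    exact (integral_nonneg fun z => mul_nonneg (sq_nonneg _) (h0 z)).trans h
  have hqa : ∀ a ∈ S, Integrable (fun z => q z * a z) P := by
    intro a ha
    obtain ⟨h0, h1, -, -, -, h2, -⟩ := hS a ha
    refine (h2.add h1).mono' (hq.mul h1.aestronglyMeasurable) (Eventually.of_forall fun z => ?_)
    rw [Real.norm_eq_abs, abs_mul, abs_of_nonneg (h0 z), Pi.add_apply]
    have : |q z| ≤ q z ^ 2 + 1 := by
      rw [← sq_abs]; nlinarith [sq_nonneg (|q z| - 1), abs_nonneg (q z)]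
    nlinarith [mul_le_mul_of_nonneg_right this (h0 z)]
  have hA : ∀ a : S, 0 ≤ (∫ z, klFun (a.1 z) ∂P) + ∫ z, c z * a.1 z ∂P := by
    rintro ⟨a, ha⟩
    obtain ⟨h0, -⟩ := hS a ha
    exact add_nonneg (integral_nonneg fun z => klFun_nonneg (h0 z))
      (integral_nonneg fun z => mul_nonneg (hc z) (h0 z))
  have hB : ∀ a : S, |∫ z, q z * a.1 z ∂P| ≤ Q + 1 := by
    rintro ⟨a, ha⟩
    obtain ⟨h0, h1, h1', -, -, h2, h3⟩ := hS a ha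
    calc |∫ z, q z * a z ∂P| ≤ ∫ z, |q z * a z| ∂P := abs_integral_le_integral_abs
      _ ≤ ∫ z, (q z ^ 2 * a z + a z) ∂P := by
        refine integral_mono (hqa a ha).abs (h2.add h1) fun z => ?_
        simp only [abs_mul, abs_of_nonneg (h0 z)]
        have : |q z| ≤ q z ^ 2 + 1 := by
          rw [← sq_abs]; nlinarith [sq_nonneg (|q z| - 1), abs_nonneg (q z)]
        nlinarith [mul_le_mul_of_nonneg_right this (h0 z)]
      _ ≤ Q + 1 := by rw [integral_add h2 h1, h1']; gcongr
  refine differentiableAt_iInf_add_mul hA hB (K := 2 + 2 * Q) (by positivity) τ ?_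
  rintro ε hε ⟨a, ha⟩ ⟨b, hb⟩ hai hbi
  simp only at hai hbi ⊢
  obtain ⟨a0, a1, a1', ak, ac, a2, a3⟩ := hS a ha
  obtain ⟨b0, b1, b1', bk, bc, b2, b3⟩ := hS b hb
  have hm := hmid a ha b hb
  obtain ⟨m0, m1, m1', mk, mc, m2, m3⟩ := hS _ hm
  have hX : Integrable (fun z => (√(a z) - √(b z)) ^ 2) P := by
    refine ((a1.add b1).const_mul 2).mono' ?_ (Eventually.of_forall fun z => ?_)
    · exact ((Real.continuous_sqrt.comp_aestronglyMeasurable a1.aestronglyMeasurable).sub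
        (Real.continuous_sqrt.comp_aestronglyMeasurable b1.aestronglyMeasurable)).pow 2
    · rw [Real.norm_eq_abs, abs_of_nonneg (sq_nonneg _), Pi.add_apply]
      nlinarith [Real.sq_sqrt (a0 z), Real.sq_sqrt (b0 z), sq_nonneg (√(a z) + √(b z))]
  have hXle : ∫ z, (√(a z) - √(b z)) ^ 2 ∂P ≤ 4 * ε := by
    have h1 : (∫ z, klFun ((a z + b z) / 2) ∂P) ≤ 1 / 2 * (∫ z, klFun (a z) ∂P)
        + 1 / 2 * (∫ z, klFun (b z) ∂P) - 1 / 4 * ∫ z, (√(a z) - √(b z)) ^ 2 ∂P := by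
      have hab : Integrable (fun z => 1 / 2 * klFun (a z) + 1 / 2 * klFun (b z)) P :=
        (ak.const_mul _).add (bk.const_mul _)
      have hX' := hX.const_mul (1 / 4)
      rw [← integral_const_mul, ← integral_const_mul, ← integral_const_mul,
        ← integral_add (ak.const_mul _) (bk.const_mul _), ← integral_sub hab hX']
      exact integral_mono mk (hab.sub hX') fun z => klFun_add_div_two_le (a0 z) (b0 z)
    have h2 : (∫ z, c z * ((a z + b z) / 2) ∂P) = 1 / 2 * (∫ z, c z * a z ∂P)
        + 1 / 2 * (∫ z, c z * b z ∂P) := by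
      rw [← integral_const_mul, ← integral_const_mul,
        ← integral_add (ac.const_mul _) (bc.const_mul _)]
      congr with z; ring
    have h3 : (∫ z, q z * ((a z + b z) / 2) ∂P) = 1 / 2 * (∫ z, q z * a z ∂P)
        + 1 / 2 * (∫ z, q z * b z ∂P) := by
      rw [← integral_const_mul, ← integral_const_mul,
        ← integral_add ((hqa a ha).const_mul _) ((hqa b hb).const_mul _)]
      congr with z; ring
    have h4 : (⨅ a : S, (((∫ z, klFun (a.1 z) ∂P) + ∫ z, c z * a.1 z ∂P)
        + τ * ∫ z, q z * a.1 z ∂P)) ≤ ((∫ z, klFun ((a z + b z) / 2) ∂P)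
          + ∫ z, c z * ((a z + b z) / 2) ∂P) + τ * ∫ z, q z * ((a z + b z) / 2) ∂P :=
      iInf_add_mul_le hA hB τ ⟨_, hm⟩
    rw [h2, h3] at h4
    linarith
  have hsq : 0 < √ε := Real.sqrt_pos.2 hε
  have hss : √ε * √ε = ε := Real.mul_self_sqrt hε.le
  rw [← integral_sub (hqa a ha) (hqa b hb)]
  have hab : Integrable (fun z => √ε * (q z ^ 2 * a z + q z ^ 2 * b z)) P :=
    (a2.add b2).const_mul _
  calc |∫ z, (q z * a z - q z * b z) ∂P| ≤ ∫ z, |q z * a z - q z * b z| ∂P :=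
        abs_integral_le_integral_abs
    _ ≤ ∫ z, ((1 / (2 * √ε)) * (√(a z) - √(b z)) ^ 2 + √ε * (q z ^ 2 * a z + q z ^ 2 * b z)) ∂P := by
      refine integral_mono ((hqa a ha).sub (hqa b hb)).abs
        ((hX.const_mul _).add hab) fun z => ?_
      have e1 : q z * a z - q z * b z = (√(a z) - √(b z)) * (q z * (√(a z) + √(b z))) := by
        nth_rewrite 1 [← Real.mul_self_sqrt (a0 z), ← Real.mul_self_sqrt (b0 z)]
        ring
      simp only [e1]
      have e2 : q z ^ 2 * (√(a z) + √(b z)) ^ 2 ≤ 2 * (q z ^ 2 * a z + q z ^ 2 * b z) := by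
        have : (√(a z) + √(b z)) ^ 2 ≤ 2 * (a z + b z) := by
          nlinarith [Real.sq_sqrt (a0 z), Real.sq_sqrt (b0 z), sq_nonneg (√(a z) - √(b z))]
        nlinarith [mul_le_mul_of_nonneg_left this (sq_nonneg (q z))]
      have e3 : ∀ x y : ℝ, |x * y| ≤ 1 / (2 * √ε) * x ^ 2 + √ε / 2 * y ^ 2 := by
        intro x y
        have e4 : 1 / (2 * √ε) * x ^ 2 + √ε / 2 * y ^ 2 - |x| * |y|
            = (|x| - √ε * |y|) ^ 2 / (2 * √ε) := by
          rw [← sq_abs x, ← sq_abs y]; field_simp; ring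
        have e5 : 0 ≤ (|x| - √ε * |y|) ^ 2 / (2 * √ε) := by positivity
        rw [abs_mul]; linarith
      refine (e3 _ _).trans ?_
      rw [mul_pow (q z)]
      nlinarith [mul_le_mul_of_nonneg_left e2 hsq.le]
    _ ≤ 1 / (2 * √ε) * (4 * ε) + √ε * (Q + Q) := by
      rw [integral_add (hX.const_mul _) hab, integral_const_mul,
        integral_const_mul, integral_add a2 b2]
      gcongr
    _ = (2 + 2 * Q) * √ε := by
      have : 1 / (2 * √ε) * (4 * ε) = 2 * √ε := by
        nth_rewrite 2 [← hss]; field_simp; norm_num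
      rw [this]; ring

end

section
/-! ### Relative entropies -/

theorem log_rnDeriv_withDensity_ofReal_ae_eq {X : Type*} [MeasurableSpace X]
    {π R : Measure X} [IsFiniteMeasure π] [SigmaFinite R] {k : X → ℝ} (hk : Measurable k)
    (hkpos : ∀ x, 0 < k x) [IsFiniteMeasure (R.withDensity fun x => ENNReal.ofReal (k x))]
    (hπ : π ≪ R.withDensity fun x => ENNReal.ofReal (k x)) :
    (fun x => Real.log (π.rnDeriv R x).toReal) =ᵐ[π]
      fun x => llr π (R.withDensity fun x => ENNReal.ofReal (k x)) x + Real.log (k x) := by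
  have hπR : π ≪ R := hπ.trans (withDensity_absolutelyContinuous _ _)
  have h1 := Measure.rnDeriv_mul_rnDeriv (κ := R) hπ
  have h2 := Measure.rnDeriv_withDensity R (f := fun x => ENNReal.ofReal (k x)) (by fun_prop)
  filter_upwards [hπR.ae_le h1, hπR.ae_le h2, Measure.rnDeriv_pos hπ,
    hπ.ae_le (Measure.rnDeriv_lt_top π (R.withDensity fun x => ENNReal.ofReal (k x)))]
    with x e1 e2 e3 e4
  rw [← e1, Pi.mul_apply, e2, ENNReal.toReal_mul, ENNReal.toReal_ofReal (hkpos x).le,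
    Real.log_mul (ENNReal.toReal_pos e3.ne' e4.ne).ne' (hkpos x).ne', llr]

open InformationTheory in
theorem relEnt_eq {X : Type} [MeasurableSpace X] {π R κ : Measure X} [IsProbabilityMeasure π]
    [SigmaFinite R] [IsProbabilityMeasure κ] {k : X → ℝ} (hk : Measurable k)
    (hkpos : ∀ x, 0 < k x) (hκ : κ = R.withDensity fun x => ENNReal.ofReal (k x))
    (hint : Integrable (fun x => Real.log (k x)) π) :
    (klDiv π κ = ⊤ → relEnt π R = ⊤) ∧ (klDiv π κ ≠ ⊤ → relEnt π R =
      (((klDiv π κ).toReal + ∫ x, Real.log (k x) ∂π : ℝ) : EReal)) := by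
  subst hκ
  set κ := R.withDensity fun x => ENNReal.ofReal (k x) with hκ
  constructor
  · intro h
    rw [relEnt, if_neg]
    rintro ⟨h1, h2⟩
    have hRκ : R ≪ κ := withDensity_absolutelyContinuous' (by fun_prop)
      (Eventually.of_forall fun x => (ENNReal.ofReal_pos.2 (hkpos x)).ne')
    refine klDiv_ne_top_iff.2 ⟨h1.trans hRκ, ?_⟩ h
    refine (h2.sub hint).congr ?_
    filter_upwards [log_rnDeriv_withDensity_ofReal_ae_eq hk hkpos (h1.trans hRκ)] with x hx
    simp only [Pi.sub_apply, hx, add_sub_cancel_right, hκ]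
  · intro h
    obtain ⟨h1, h2⟩ := klDiv_ne_top_iff.1 h
    have h3 := log_rnDeriv_withDensity_ofReal_ae_eq hk hkpos h1
    rw [relEnt, if_pos ⟨h1.trans (withDensity_absolutelyContinuous _ _),
      (h2.add hint).congr h3.symm⟩, integral_congr_ae h3, integral_add h2 hint,
      toReal_klDiv_of_measure_eq h1 (by simp)]

theorem densMeas_rnDeriv_toReal {n : ℕ} {ρ : Eucl n → ℝ} (hρ : Measurable ρ)
    (h0 : ∀ x, 0 ≤ ρ x) :
    (fun x => ((densMeas n ρ).rnDeriv volume x).toReal) =ᵐ[volume] ρ := by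
  filter_upwards [Measure.rnDeriv_withDensity (volume : Measure (Eucl n))
    (f := fun x => ENNReal.ofReal (ρ x)) (by fun_prop)] with x hx
  rw [densMeas, hx, ENNReal.toReal_ofReal (h0 x)]

theorem entLeb_densMeas {n : ℕ} {ρ : Eucl n → ℝ} (hρ : Measurable ρ) (h0 : ∀ x, 0 ≤ ρ x) :
    entLeb n (densMeas n ρ) = entDens n ρ := by
  refine integral_congr_ae ?_
  filter_upwards [densMeas_rnDeriv_toReal hρ h0] with x hx
  rw [hx]

theorem integrable_densMeas_iff {n : ℕ} {ρ φ : Eucl n → ℝ} (hρ : Measurable ρ)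
    (h0 : ∀ x, 0 ≤ ρ x) :
    Integrable φ (densMeas n ρ) ↔ Integrable (fun x => φ x * ρ x) volume := by
  rw [densMeas, integrable_withDensity_iff (by fun_prop)
    (Eventually.of_forall fun x => ENNReal.ofReal_lt_top)]
  simp only [ENNReal.toReal_ofReal (h0 _)]

theorem integral_densMeas {n : ℕ} {ρ φ : Eucl n → ℝ} (hρ : Measurable ρ)
    (h0 : ∀ x, 0 ≤ ρ x) :
    ∫ x, φ x ∂(densMeas n ρ) = ∫ x, ρ x * φ x := by
  rw [densMeas, integral_withDensity_eq_integral_toReal_smul (by fun_prop)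
    (Eventually.of_forall fun x => ENNReal.ofReal_lt_top)]
  simp only [ENNReal.toReal_ofReal (h0 _), smul_eq_mul]

theorem isProbabilityMeasure_densMeas_iff {n : ℕ} {ρ : Eucl n → ℝ} (hρ : Integrable ρ)
    (h0 : ∀ x, 0 ≤ ρ x) : IsProbabilityMeasure (densMeas n ρ) ↔ ∫ x, ρ x = 1 := by
  rw [isProbabilityMeasure_iff, densMeas, withDensity_apply _ MeasurableSet.univ,
    Measure.restrict_univ, ← ofReal_integral_eq_lintegral_ofReal hρ (Eventually.of_forall h0),
    ENNReal.ofReal_eq_one]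

end

section
/-! ### Lifting couplings along a map of the second factor -/

section
variable {X Y W : Type*} [MeasurableSpace X] [MeasurableSpace Y] [MeasurableSpace W]

theorem map_withDensity_comp {P : Measure X} {Φ : X → Y} (hΦ : Measurable Φ) {ρ : Y → ℝ≥0∞}
    (hρ : Measurable ρ) :
    (P.withDensity (ρ ∘ Φ)).map Φ = (P.map Φ).withDensity ρ := by
  ext s hs
  rw [Measure.map_apply hΦ hs, withDensity_apply _ (hΦ hs), withDensity_apply _ hs,
    setLIntegral_map hs hρ hΦ]
  rfl

theorem map_snd_withDensity_prod {μ : Measure X} {ν : Measure Y} [SFinite μ] [SFinite ν]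
    {h : X × Y → ℝ≥0∞} (hh : Measurable h) :
    ((μ.prod ν).withDensity h).map Prod.snd = ν.withDensity fun y => ∫⁻ x, h (x, y) ∂μ := by
  ext s hs
  rw [Measure.map_apply measurable_snd hs, withDensity_apply _ (measurable_snd hs),
    withDensity_apply _ hs, ← univ_prod, ← Measure.prod_restrict, lintegral_prod_symm _ (by fun_prop),
    Measure.restrict_univ]

theorem map_fst_withDensity_prod {μ : Measure X} {ν : Measure Y} [SFinite μ] [SFinite ν]
    {h : X × Y → ℝ≥0∞} (hh : Measurable h) :
    ((μ.prod ν).withDensity h).map Prod.fst = μ.withDensity fun x => ∫⁻ y, h (x, y) ∂ν := by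
  ext s hs
  rw [Measure.map_apply measurable_fst hs, withDensity_apply _ (measurable_fst hs),
    withDensity_apply _ hs, ← prod_univ, ← Measure.prod_restrict, lintegral_prod _ (by fun_prop),
    Measure.restrict_univ]

variable {μ : Measure X} {m : Measure W} [IsProbabilityMeasure μ] [IsProbabilityMeasure m]
  {T : W → Y}

open InformationTheory in
/-- A coupling of `μ` and `m.map T` lifts to a coupling of `μ` and `m` with the same relative
entropy with respect to the product measure. -/
theorem exists_lift_density (hT : Measurable T) {π : Measure (X × Y)} [IsProbabilityMeasure π]
    (hfst : π.map Prod.fst = μ) (hsnd : π.map Prod.snd = m.map T)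
    (hkl : klDiv π (μ.prod (m.map T)) ≠ ⊤) :
    ∃ a : X × W → ℝ, Measurable a ∧ (∀ z, 0 ≤ a z) ∧
      Integrable (fun z => klFun (a z)) (μ.prod m) ∧
      ((μ.prod m).withDensity fun z => ENNReal.ofReal (a z)).map Prod.fst = μ ∧
      ((μ.prod m).withDensity fun z => ENNReal.ofReal (a z)).map Prod.snd = m ∧
      ((μ.prod m).withDensity fun z => ENNReal.ofReal (a z)).map (Prod.map id T) = π ∧
      (klDiv π (μ.prod (m.map T))).toReal = ∫ z, klFun (a z) ∂(μ.prod m) := by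
  have : IsProbabilityMeasure (m.map T) := Measure.isProbabilityMeasure_map hT.aemeasurable
  have hΦ : Measurable (Prod.map id T : X × W → X × Y) := measurable_id.prodMap hT
  have hP : (μ.prod m).map (Prod.map id T) = μ.prod (m.map T) := by
    rw [← Measure.map_prod_map _ _ measurable_id hT, Measure.map_id]
  have hac : π ≪ μ.prod (m.map T) := (klDiv_ne_top_iff.1 hkl).1
  have hklint : Integrable (fun z => klFun (π.rnDeriv (μ.prod (m.map T)) z).toReal)
      (μ.prod (m.map T)) := (integrable_klFun_rnDeriv_iff hac).2 (klDiv_ne_top_iff.1 hkl).2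
  set κ := μ.prod (m.map T) with hκ
  set ρ := π.rnDeriv κ with hρ
  have hρm : Measurable ρ := Measure.measurable_rnDeriv _ _
  have hπ : κ.withDensity ρ = π := Measure.withDensity_rnDeriv_eq _ _ hac
  have hdens : ((μ.prod m).withDensity fun z => ENNReal.ofReal (ρ (Prod.map id T z)).toReal)
      = (μ.prod m).withDensity (ρ ∘ Prod.map id T) := by
    refine withDensity_congr_ae ?_
    have h1 : ∀ᵐ z ∂(μ.prod m).map (Prod.map id T), ρ z < ⊤ := by
      rw [hP]; exact Measure.rnDeriv_lt_top _ _
    filter_upwards [ae_of_ae_map hΦ.aemeasurable h1] with z hz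
    rw [ENNReal.ofReal_toReal hz.ne, Function.comp]
  have hmap : ((μ.prod m).withDensity (ρ ∘ Prod.map id T)).map (Prod.map id T) = π := by
    rw [map_withDensity_comp hΦ hρm, hP, hπ]
  refine ⟨fun z => (ρ (Prod.map id T z)).toReal, by fun_prop, fun z => ENNReal.toReal_nonneg,
    ?_, ?_, ?_, ?_, ?_⟩
  · rw [← hP] at hklint
    exact hklint.comp_measurable hΦ
  · rw [hdens]
    refine Eq.trans ?_ hfst
    rw [← hmap, Measure.map_map measurable_fst hΦ]
    rfl
  · rw [hdens, map_snd_withDensity_prod (by fun_prop)]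
    have h1 : (m.map T).withDensity (fun y => ∫⁻ x, ρ (x, y) ∂μ) = (m.map T).withDensity 1 := by
      rw [← map_snd_withDensity_prod hρm, ← hκ, hπ, hsnd, withDensity_one]
    have h2 := (withDensity_eq_iff_of_sigmaFinite (by fun_prop) (by fun_prop)).1 h1
    exact (withDensity_congr_ae (ae_of_ae_map hT.aemeasurable h2)).trans withDensity_one
  · rw [hdens, hmap]
  · rw [toReal_klDiv_eq_integral_klFun hac, ← hP, integral_map hΦ.aemeasurable]
    · rw [hP]
    · exact (measurable_klFun.comp (Measure.measurable_rnDeriv _ _).ennreal_toReal).aestronglyMeasurable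

end

end

section
instance isProbabilityMeasure_densMeas_gaussS (n : ℕ) :
    IsProbabilityMeasure (densMeas n (gaussS n)) :=
  (isProbabilityMeasure_densMeas_iff (gaussS n).integrable fun x => (gaussS_pos n x).le).2
    (integral_gaussS n)

theorem lintegral_densMeas {n : ℕ} {ρ : Eucl n → ℝ} (hρ : Measurable ρ) {φ : Eucl n → ℝ≥0∞}
    (hφ : Measurable φ) :
    ∫⁻ x, φ x ∂(densMeas n ρ) = ∫⁻ x, ENNReal.ofReal (ρ x) * φ x := by
  rw [densMeas, lintegral_withDensity_eq_lintegral_mul _ (by fun_prop) hφ]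
  rfl

instance sigmaFinite_densMeas {n : ℕ} {ρ : Eucl n → ℝ} : SigmaFinite (densMeas n ρ) := by
  unfold densMeas; infer_instance

/-- Adding an independent Gaussian of variance `t` realizes the heat flow. -/
theorem map_add_smul_gaussS {n : ℕ} {v : Eucl n → ℝ} (hv : Measurable v) (h0 : ∀ x, 0 ≤ v x)
    {M : ℝ} (hM : ∀ x, v x ≤ M) {t : ℝ} (ht : 0 ≤ t) :
    ((densMeas n v).prod (densMeas n (gaussS n))).map (fun w => w.1 + √t • w.2)
      = densMeas n (heat n t v) := by
  have hT : Measurable fun w : Eucl n × Eucl n => w.1 + √t • w.2 := by fun_prop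
  have hγ : Measurable (gaussS n) := (gaussS n).continuous.measurable
  ext s hs
  have hind : Measurable (s.indicator fun _ : Eucl n => (1 : ℝ≥0∞)) :=
    measurable_const.indicator hs
  rw [Measure.map_apply hT hs, ← lintegral_indicator_one (hT hs),
    lintegral_prod_symm _ ((measurable_one.indicator (hT hs)).aemeasurable),
    show densMeas n (heat n t v) = volume.withDensity (fun x => ENNReal.ofReal (heat n t v x)) from
      rfl, withDensity_apply _ hs, ← lintegral_indicator hs]
  have e1 : ∀ z : Eucl n, ∫⁻ y, ((fun w : Eucl n × Eucl n => w.1 + √t • w.2) ⁻¹' s).indicator 1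
      (y, z) ∂(densMeas n v) = ∫⁻ y, ENNReal.ofReal (v (y - √t • z)) * s.indicator (fun _ => 1) y := by
    intro z
    have hm : Measurable fun y => ((fun w : Eucl n × Eucl n => w.1 + √t • w.2) ⁻¹' s).indicator
        (1 : Eucl n × Eucl n → ℝ≥0∞) (y, z) :=
      (measurable_one.indicator (hT hs)).comp measurable_prodMk_right
    rw [lintegral_densMeas hv hm, ← lintegral_add_right_eq_self
      (fun y => ENNReal.ofReal (v (y - √t • z)) * s.indicator (fun _ => 1) y) (√t • z)]
    refine lintegral_congr fun y => ?_
    simp only [add_sub_cancel_right]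
    rfl
  simp_rw [e1]
  rw [lintegral_densMeas hγ (by fun_prop)]
  simp_rw [← lintegral_const_mul' _ _ ENNReal.ofReal_ne_top]
  rw [lintegral_lintegral_swap (by fun_prop)]
  refine lintegral_congr fun y => ?_
  by_cases hy : y ∈ s
  · simp only [hy, indicator_of_mem, mul_one, heat_eq ht]
    rw [ofReal_integral_eq_lintegral_ofReal
      (integrable_comp_mul_gaussS hv (fun y => by rw [abs_of_nonneg (h0 y)]; exact hM y) _ _)
      (Eventually.of_forall fun z => mul_nonneg (h0 _) (gaussS_pos n z).le)]
    refine lintegral_congr fun z => ?_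
    rw [ENNReal.ofReal_mul (h0 _), mul_comm]
  · simp [hy]

end

section
open scoped SchwartzMap

/-! ### Couplings of densities with Schwartz-type decay -/

/-- Positive densities with polynomially weighted bounds of all orders whose logarithm grows at
most quadratically. -/
structure TameDensity {n : ℕ} (ρ : Eucl n → ℝ) : Prop where
  measurable : Measurable ρ
  pos : ∀ x, 0 < ρ x
  weight : ∀ k : ℕ, ∃ C : ℝ, ∀ x, |ρ x| * (1 + ‖x‖) ^ k ≤ C
  log_le : ∃ C : ℝ, ∀ x, |Real.log (ρ x)| ≤ C * (1 + ‖x‖) ^ 2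

theorem HasGaussianLowerBound.tameDensity_heat {n : ℕ} {φ : 𝓢(Eucl n, ℝ)}
    (h : HasGaussianLowerBound φ) {t : ℝ} (ht : 0 ≤ t) : TameDensity (_root_.heat n t φ) where
  measurable := (continuous_heat φ ht).measurable
  pos := (h.heat ht).pos
  weight k := by
    obtain ⟨C, -, hC⟩ := exists_heat_weight_bound φ k t
    exact ⟨C, hC t ⟨ht, le_rfl⟩⟩
  log_le := by
    obtain ⟨C, -, hC⟩ := exists_abs_log_heat_le h ht
    exact ⟨C, hC t ⟨ht, le_rfl⟩⟩

theorem HasGaussianLowerBound.tameDensity {n : ℕ} {φ : 𝓢(Eucl n, ℝ)}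
    (h : HasGaussianLowerBound φ) : TameDensity φ := by
  have := h.tameDensity_heat le_rfl
  rwa [show _root_.heat n 0 φ = φ from funext fun x => by simp [_root_.heat]] at this

theorem hasGaussianLowerBound_gaussS (n : ℕ) : HasGaussianLowerBound (gaussS n) :=
  ⟨1 / 2, ((2 * Real.pi) ^ ((n : ℝ) / 2))⁻¹, by norm_num, by positivity, fun x => by
    rw [gaussS_apply, show -‖x‖ ^ 2 / 2 = -(1 / 2) * ‖x‖ ^ 2 by ring, div_eq_mul_inv (Real.exp _),
      mul_comm]⟩

namespace TameDensity
variable {n : ℕ} {ρ : Eucl n → ℝ}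

theorem integrable_mul (h : TameDensity ρ) {φ : Eucl n → ℝ} (hφ : Measurable φ) {C : ℝ} {j : ℕ}
    (hC : ∀ x, |φ x| ≤ C * (1 + ‖x‖) ^ j) : Integrable (fun x => φ x * ρ x) := by
  obtain ⟨A, hA⟩ := h.weight (n + 1 + j)
  simp_rw [mul_comm (φ _)]
  exact integrable_mul_of_bounds h.measurable hφ hA hC

theorem integrable_densMeas (h : TameDensity ρ) {φ : Eucl n → ℝ} (hφ : Measurable φ) {C : ℝ}
    {j : ℕ} (hC : ∀ x, |φ x| ≤ C * (1 + ‖x‖) ^ j) : Integrable φ (densMeas n ρ) :=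
  (integrable_densMeas_iff h.measurable fun x => (h.pos x).le).2 (h.integrable_mul hφ hC)

theorem integrable_norm_pow (h : TameDensity ρ) (j : ℕ) :
    Integrable (fun x => ‖x‖ ^ j) (densMeas n ρ) :=
  h.integrable_densMeas (by fun_prop) (C := 1) (j := j) fun x => by
    rw [abs_of_nonneg (by positivity), one_mul]
    gcongr
    linarith

theorem integrable_log (h : TameDensity ρ) :
    Integrable (fun x => Real.log (ρ x)) (densMeas n ρ) := by
  obtain ⟨C, hC⟩ := h.log_le
  exact h.integrable_densMeas h.measurable.log hC

theorem integral_log (h : TameDensity ρ) :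
    ∫ x, Real.log (ρ x) ∂(densMeas n ρ) = entDens n ρ :=
  integral_densMeas h.measurable fun x => (h.pos x).le

theorem integrable (h : TameDensity ρ) : Integrable ρ := by
  simpa using h.integrable_mul (φ := fun _ => 1) measurable_const (C := 1) (j := 0) (by simp)

end TameDensity

section
variable {X Y : Type*} [MeasurableSpace X] [MeasurableSpace Y] {π : Measure (X × Y)}
  {μ : Measure X} {ν : Measure Y}

theorem integrable_comp_fst (h : π.map Prod.fst = μ) {φ : X → ℝ} (hφ : Integrable φ μ) :
    Integrable (fun p => φ p.1) π := by
  subst h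
  exact hφ.comp_measurable measurable_fst

theorem integrable_comp_snd (h : π.map Prod.snd = ν) {φ : Y → ℝ} (hφ : Integrable φ ν) :
    Integrable (fun p => φ p.2) π := by
  subst h
  exact hφ.comp_measurable measurable_snd

theorem integral_comp_fst (h : π.map Prod.fst = μ) {φ : X → ℝ} (hφ : Integrable φ μ) :
    ∫ p, φ p.1 ∂π = ∫ x, φ x ∂μ := by
  subst h
  rw [integral_map measurable_fst.aemeasurable hφ.aestronglyMeasurable]

theorem integral_comp_snd (h : π.map Prod.snd = ν) {φ : Y → ℝ} (hφ : Integrable φ ν) :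
    ∫ p, φ p.2 ∂π = ∫ x, φ x ∂ν := by
  subst h
  rw [integral_map measurable_snd.aemeasurable hφ.aestronglyMeasurable]

end

theorem R01_eq (n : ℕ) :
    R01 n = volume.withDensity fun p => ENNReal.ofReal (gaussS n (p.1 - p.2)) := by
  simp only [R01, gaussS_apply]

instance sigmaFinite_R01 (n : ℕ) : SigmaFinite (R01 n) := by
  unfold R01; infer_instance

theorem densMeas_prod_densMeas {n : ℕ} {u w : Eucl n → ℝ} (hu : Measurable u) (hw : Measurable w)
    (hu0 : ∀ x, 0 ≤ u x) :
    (densMeas n u).prod (densMeas n w) = (R01 n).withDensity fun p =>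
      ENNReal.ofReal (u p.1 * w p.2 / gaussS n (p.1 - p.2)) := by
  have hγ : Measurable (gaussS n) := (gaussS n).continuous.measurable
  rw [R01_eq, ← withDensity_mul _ (by fun_prop) (by fun_prop), densMeas, densMeas,
    prod_withDensity (by fun_prop) (by fun_prop)]
  congr 1
  ext p
  have hp := gaussS_pos n (p.1 - p.2)
  rw [Pi.mul_apply, ← ENNReal.ofReal_mul hp.le, ← ENNReal.ofReal_mul (hu0 _),
    mul_div_cancel₀ _ hp.ne']

theorem log_gaussS (n : ℕ) (x : Eucl n) :
    Real.log (gaussS n x) = -(1 / 2 * ‖x‖ ^ 2) - n / 2 * Real.log (2 * Real.pi) := by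
  rw [gaussS_apply, Real.log_div (Real.exp_pos _).ne' (by positivity), Real.log_exp,
    Real.log_rpow (by positivity)]
  ring

theorem integrable_norm_sub_sq {n : ℕ} {π : Measure (Eucl n × Eucl n)} {u w : Eucl n → ℝ}
    (hu : TameDensity u) (hw : TameDensity w)
    (hfst : π.map Prod.fst = densMeas n u) (hsnd : π.map Prod.snd = densMeas n w) :
    Integrable (fun p => ‖p.1 - p.2‖ ^ 2) π := by
  have h1 := integrable_comp_fst hfst (hu.integrable_norm_pow 2)
  have h2 := integrable_comp_snd hsnd (hw.integrable_norm_pow 2)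
  refine ((h1.const_mul 2).add (h2.const_mul 2)).mono'
    (by fun_prop : Measurable _).aestronglyMeasurable (Eventually.of_forall fun p => ?_)
  rw [Real.norm_eq_abs, abs_of_nonneg (by positivity), Pi.add_apply]
  have h3 := norm_sub_le p.1 p.2
  nlinarith [sq_nonneg (‖p.1‖ - ‖p.2‖), norm_nonneg (p.1 - p.2)]

open InformationTheory in
theorem relEnt_R01_eq {n : ℕ} {u w : Eucl n → ℝ} (hu : TameDensity u) (hw : TameDensity w)
    [IsProbabilityMeasure (densMeas n u)] [IsProbabilityMeasure (densMeas n w)]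
    {π : Measure (Eucl n × Eucl n)} (hπ : Coupling π (densMeas n u) (densMeas n w)) :
    (klDiv π ((densMeas n u).prod (densMeas n w)) = ⊤ → relEnt π (R01 n) = ⊤) ∧
    (klDiv π ((densMeas n u).prod (densMeas n w)) ≠ ⊤ → relEnt π (R01 n) =
      (((klDiv π ((densMeas n u).prod (densMeas n w))).toReal + (entDens n u + entDens n w +
        n / 2 * Real.log (2 * Real.pi) + 1 / 2 * ∫ p, ‖p.1 - p.2‖ ^ 2 ∂π) : ℝ) : EReal)) := by
  obtain ⟨hprob, hfst, hsnd⟩ := hπ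
  have hγ : Measurable (gaussS n) := (gaussS n).continuous.measurable
  have hum := hu.measurable
  have hwm := hw.measurable
  have e : ∀ p : Eucl n × Eucl n, Real.log (u p.1 * w p.2 / gaussS n (p.1 - p.2)) =
      Real.log (u p.1) + Real.log (w p.2) + (1 / 2 * ‖p.1 - p.2‖ ^ 2
        + n / 2 * Real.log (2 * Real.pi)) := by
    intro p
    rw [Real.log_div (mul_pos (hu.pos _) (hw.pos _)).ne' (gaussS_pos n _).ne',
      Real.log_mul (hu.pos _).ne' (hw.pos _).ne', log_gaussS]
    ring
  have i1 := integrable_comp_fst hfst hu.integrable_log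
  have i2 := integrable_comp_snd hsnd hw.integrable_log
  have i12 : Integrable (fun p : Eucl n × Eucl n => Real.log (u p.1) + Real.log (w p.2)) π :=
    i1.add i2
  have i3 := (integrable_norm_sub_sq hu hw hfst hsnd).const_mul (1 / 2)
  have i4 : Integrable (fun p : Eucl n × Eucl n => 1 / 2 * ‖p.1 - p.2‖ ^ 2
      + n / 2 * Real.log (2 * Real.pi)) π := i3.add (integrable_const _)
  have key := relEnt_eq (π := π) (R := R01 n)
    (κ := (densMeas n u).prod (densMeas n w))
    (k := fun p => u p.1 * w p.2 / gaussS n (p.1 - p.2)) (by fun_prop)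
    (fun p => div_pos (mul_pos (hu.pos _) (hw.pos _)) (gaussS_pos n _))
    (densMeas_prod_densMeas hum hwm fun x => (hu.pos x).le) (by simp_rw [e]; exact i12.add i4)
  refine ⟨key.1, fun h => (key.2 h).trans ?_⟩
  simp_rw [e]
  rw [integral_add i12 i4, integral_add i1 i2, integral_add i3 (integrable_const _),
    integral_const_mul, integral_comp_fst hfst hu.integrable_log,
    integral_comp_snd hsnd hw.integrable_log, hu.integral_log, hw.integral_log]
  congr 2
  simp
  ring

end

section
open InformationTheory
variable {X W : Type*} [MeasurableSpace X] [MeasurableSpace W] {μ : Measure X} {m : Measure W}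

/-- Densities with respect to `μ.prod m` of couplings of `μ` and `m` with finite entropy. -/
def couplingDensities (μ : Measure X) (m : Measure W) : Set (X × W → ℝ) :=
  {a | Measurable a ∧ (∀ z, 0 ≤ a z) ∧ Integrable (fun z => klFun (a z)) (μ.prod m) ∧
    ((μ.prod m).withDensity fun z => ENNReal.ofReal (a z)).map Prod.fst = μ ∧
    ((μ.prod m).withDensity fun z => ENNReal.ofReal (a z)).map Prod.snd = m}

theorem one_mem_couplingDensities [IsProbabilityMeasure μ] [IsProbabilityMeasure m] :
    (fun _ => 1) ∈ couplingDensities μ m := by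
  have e : ((μ.prod m).withDensity fun _ => ENNReal.ofReal 1) = μ.prod m := by simp
  refine ⟨measurable_const, by simp, by simp, ?_, ?_⟩
  · rw [e, Measure.map_fst_prod]; simp
  · rw [e, Measure.map_snd_prod]; simp

theorem inv_two_smul_add_self (ν : Measure X) : (2⁻¹ : ℝ≥0∞) • (ν + ν) = ν := by
  rw [← two_smul ℝ≥0∞ ν, smul_smul, ENNReal.inv_mul_cancel (by simp) (by simp), one_smul]

theorem add_div_two_mem_couplingDensities {a b : X × W → ℝ} (ha : a ∈ couplingDensities μ m)
    (hb : b ∈ couplingDensities μ m) :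
    (fun z => (a z + b z) / 2) ∈ couplingDensities μ m := by
  obtain ⟨am, a0, ak, af, as⟩ := ha
  obtain ⟨bm, b0, bk, bf, bs⟩ := hb
  have e : ((μ.prod m).withDensity fun z => ENNReal.ofReal ((a z + b z) / 2)) =
      (2⁻¹ : ℝ≥0∞) • ((μ.prod m).withDensity (fun z => ENNReal.ofReal (a z)) +
        (μ.prod m).withDensity fun z => ENNReal.ofReal (b z)) := by
    rw [← withDensity_add_left (by fun_prop), ← withDensity_smul _ (by fun_prop)]
    congr 1
    ext z
    rw [Pi.smul_apply, Pi.add_apply, ← ENNReal.ofReal_add (a0 z) (b0 z), div_eq_inv_mul,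
      ENNReal.ofReal_mul (by norm_num), ENNReal.ofReal_inv_of_pos (by norm_num)]
    simp
  refine ⟨by fun_prop, fun z => div_nonneg (add_nonneg (a0 z) (b0 z)) zero_le_two, ?_, ?_, ?_⟩
  · refine ((ak.const_mul (1 / 2)).add (bk.const_mul (1 / 2))).mono'
      (by fun_prop : Measurable _).aestronglyMeasurable (Eventually.of_forall fun z => ?_)
    rw [Real.norm_eq_abs, abs_of_nonneg
      (klFun_nonneg (div_nonneg (add_nonneg (a0 z) (b0 z)) zero_le_two)), Pi.add_apply]
    linarith [klFun_add_div_two_le (a0 z) (b0 z), sq_nonneg (√(a z) - √(b z))]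
  · rw [e, Measure.map_smul, Measure.map_add _ _ measurable_fst, af, bf, inv_two_smul_add_self]
  · rw [e, Measure.map_smul, Measure.map_add _ _ measurable_snd, as, bs, inv_two_smul_add_self]

theorem integrable_withDensity_ofReal_iff {P : Measure X} {a φ : X → ℝ} (ha : Measurable a)
    (h0 : ∀ z, 0 ≤ a z) :
    Integrable φ (P.withDensity fun z => ENNReal.ofReal (a z)) ↔
      Integrable (fun z => φ z * a z) P := by
  rw [integrable_withDensity_iff (by fun_prop)
    (Eventually.of_forall fun x => ENNReal.ofReal_lt_top)]
  simp only [ENNReal.toReal_ofReal (h0 _)]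

theorem integral_withDensity_ofReal {P : Measure X} {a φ : X → ℝ} (ha : Measurable a)
    (h0 : ∀ z, 0 ≤ a z) :
    ∫ z, φ z ∂(P.withDensity fun z => ENNReal.ofReal (a z)) = ∫ z, φ z * a z ∂P := by
  rw [integral_withDensity_eq_integral_toReal_smul (by fun_prop)
    (Eventually.of_forall fun x => ENNReal.ofReal_lt_top)]
  simp only [ENNReal.toReal_ofReal (h0 _), smul_eq_mul, mul_comm]

theorem klDiv_withDensity_ofReal {P : Measure X} [IsFiniteMeasure P] {a : X → ℝ}
    (ha : Measurable a) (h0 : ∀ z, 0 ≤ a z) [IsFiniteMeasure (P.withDensity fun z => ENNReal.ofReal (a z))]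
    (hk : Integrable (fun z => klFun (a z)) P) :
    klDiv (P.withDensity fun z => ENNReal.ofReal (a z)) P
      = ENNReal.ofReal (∫ z, klFun (a z) ∂P) := by
  rw [klDiv_eq_lintegral_klFun_of_ac (withDensity_absolutelyContinuous _ _),
    ofReal_integral_eq_lintegral_ofReal hk (Eventually.of_forall fun z => klFun_nonneg (h0 z))]
  refine lintegral_congr_ae ?_
  filter_upwards [Measure.rnDeriv_withDensity P (f := fun z => ENNReal.ofReal (a z))
    (by fun_prop)] with z hz
  rw [hz, ENNReal.toReal_ofReal (h0 z)]

theorem isProbabilityMeasure_of_map {π : Measure X} {f : X → W} (hf : Measurable f)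
    [IsProbabilityMeasure m] (h : π.map f = m) : IsProbabilityMeasure π := by
  constructor
  have : π.map f univ = 1 := by rw [h]; exact measure_univ
  rwa [Measure.map_apply hf MeasurableSet.univ, preimage_univ] at this

end

section
open scoped SchwartzMap

/-! ### The entropic problem along the heat flow as an infimum of affine functions of `√t` -/

section
open InformationTheory
variable {n : ℕ}

/-- The joint law of a point with density `v` and of an independent standard Gaussian. -/
noncomputable def gaussExt (n : ℕ) (v : Eucl n → ℝ) : Measure (Eucl n × Eucl n) :=
  (densMeas n v).prod (densMeas n (gaussS n))

instance {v : Eucl n → ℝ} [IsProbabilityMeasure (densMeas n v)] :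
    IsProbabilityMeasure (gaussExt n v) := by unfold gaussExt; infer_instance

/-- The constant part of the entropic problem. -/
noncomputable def kineticConst {n : ℕ} (z : Eucl n × Eucl n × Eucl n) : ℝ := 1 / 2 * ‖z.1 - z.2.1‖ ^ 2

/-- The slope of the entropic problem with respect to the noise amplitude. -/
noncomputable def kineticSlope {n : ℕ} (z : Eucl n × Eucl n × Eucl n) : ℝ := -inner ℝ (z.1 - z.2.1) z.2.2

theorem measurable_kineticConst : Measurable (kineticConst (n := n)) := by
  unfold kineticConst; fun_prop

theorem measurable_kineticSlope : Measurable (kineticSlope (n := n)) := by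
  unfold kineticSlope; fun_prop

theorem kineticSlope_sq_le (z : Eucl n × Eucl n × Eucl n) :
    kineticSlope z ^ 2 ≤ 2 * ‖z.1‖ ^ 4 + 2 * ‖z.2.1‖ ^ 4 + ‖z.2.2‖ ^ 4 := by
  have h1 : |kineticSlope z| ≤ ‖z.1 - z.2.1‖ * ‖z.2.2‖ := by
    rw [kineticSlope, abs_neg]
    exact abs_real_inner_le_norm _ _
  have h2 : kineticSlope z ^ 2 ≤ ‖z.1 - z.2.1‖ ^ 2 * ‖z.2.2‖ ^ 2 := by
    rw [← sq_abs, ← mul_pow]; gcongr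
  have h3 : ‖z.1 - z.2.1‖ ^ 2 ≤ 2 * (‖z.1‖ ^ 2 + ‖z.2.1‖ ^ 2) := by
    have := norm_sub_le z.1 z.2.1
    nlinarith [sq_nonneg (‖z.1‖ - ‖z.2.1‖), norm_nonneg (z.1 - z.2.1)]
  have h4 := mul_le_mul_of_nonneg_right h3 (sq_nonneg ‖z.2.2‖)
  nlinarith [sq_nonneg (‖z.1‖ ^ 2 + ‖z.2.1‖ ^ 2 - ‖z.2.2‖ ^ 2),
    sq_nonneg (‖z.1‖ ^ 2 - ‖z.2.1‖ ^ 2)]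

section moments
variable {u v : Eucl n → ℝ} {π : Measure (Eucl n × Eucl n × Eucl n)}

theorem map_fst_snd [IsProbabilityMeasure (densMeas n v)] (hs : π.map Prod.snd = gaussExt n v) :
    π.map (fun z => z.2.1) = densMeas n v := by
  have := congrArg (Measure.map Prod.fst) hs
  rw [Measure.map_map measurable_fst measurable_snd, gaussExt, Measure.map_fst_prod] at this
  rw [measure_univ, one_smul] at this
  exact this

theorem map_snd_snd [IsProbabilityMeasure (densMeas n v)] (hs : π.map Prod.snd = gaussExt n v) :
    π.map (fun z => z.2.2) = densMeas n (gaussS n) := by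
  have := congrArg (Measure.map Prod.snd) hs
  rw [Measure.map_map measurable_snd measurable_snd, gaussExt, Measure.map_snd_prod] at this
  rw [measure_univ, one_smul] at this
  exact this

variable (hu : TameDensity u) (hv : TameDensity v) [IsProbabilityMeasure (densMeas n v)]
  (hf : π.map Prod.fst = densMeas n u) (hs : π.map Prod.snd = gaussExt n v)
include hu hv hf hs

theorem integrable_moments (j : ℕ) : Integrable (fun z => ‖z.1‖ ^ j) π ∧
    Integrable (fun z => ‖z.2.1‖ ^ j) π ∧ Integrable (fun z => ‖z.2.2‖ ^ j) π := by
  refine ⟨integrable_comp_fst hf (hu.integrable_norm_pow j), ?_, ?_⟩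
  · have h := hv.integrable_norm_pow j
    rw [← map_fst_snd hs] at h
    exact h.comp_measurable (by fun_prop)
  · have h := (hasGaussianLowerBound_gaussS n).tameDensity.integrable_norm_pow j
    rw [← map_snd_snd hs] at h
    exact h.comp_measurable (by fun_prop)

omit hv in
theorem integral_moments (j : ℕ) : ∫ z, ‖z.1‖ ^ j ∂π = ∫ x, ‖x‖ ^ j ∂(densMeas n u) ∧
    ∫ z, ‖z.2.1‖ ^ j ∂π = ∫ x, ‖x‖ ^ j ∂(densMeas n v) ∧
    ∫ z, ‖z.2.2‖ ^ j ∂π = ∫ x, ‖x‖ ^ j ∂(densMeas n (gaussS n)) := by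
  refine ⟨integral_comp_fst hf (hu.integrable_norm_pow j), ?_, ?_⟩
  · rw [← map_fst_snd hs, integral_map (by fun_prop) (by fun_prop)]
  · rw [← map_snd_snd hs, integral_map (by fun_prop) (by fun_prop)]

theorem integrable_kineticConst : Integrable kineticConst π := by
  obtain ⟨h1, h2, -⟩ := integrable_moments hu hv hf hs 2
  refine (h1.add h2).mono' measurable_kineticConst.aestronglyMeasurable
    (Eventually.of_forall fun z => ?_)
  rw [kineticConst, Real.norm_eq_abs, abs_of_nonneg (by positivity), Pi.add_apply]
  have := norm_sub_le z.1 z.2.1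
  nlinarith [sq_nonneg (‖z.1‖ - ‖z.2.1‖), norm_nonneg (z.1 - z.2.1)]

theorem integrable_kineticSlope_sq : Integrable (fun z => kineticSlope z ^ 2) π := by
  obtain ⟨h1, h2, h3⟩ := integrable_moments hu hv hf hs 4
  refine (((h1.const_mul 2).add (h2.const_mul 2)).add h3).mono'
    (measurable_kineticSlope.pow_const 2).aestronglyMeasurable (Eventually.of_forall fun z => ?_)
  rw [Real.norm_eq_abs, abs_of_nonneg (sq_nonneg _)]
  exact kineticSlope_sq_le z

theorem integral_kineticSlope_sq_le : ∫ z, kineticSlope z ^ 2 ∂π ≤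
    2 * ∫ x, ‖x‖ ^ 4 ∂(densMeas n u) + 2 * ∫ x, ‖x‖ ^ 4 ∂(densMeas n v)
      + ∫ x, ‖x‖ ^ 4 ∂(densMeas n (gaussS n)) := by
  obtain ⟨h1, h2, h3⟩ := integrable_moments hu hv hf hs 4
  obtain ⟨e1, e2, e3⟩ := integral_moments hu hf hs 4
  have h12 : Integrable (fun z => 2 * ‖z.1‖ ^ 4 + 2 * ‖z.2.1‖ ^ 4) π :=
    (h1.const_mul 2).add (h2.const_mul 2)
  rw [← e1, ← e2, ← e3, ← integral_const_mul, ← integral_const_mul,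
    ← integral_add (h1.const_mul 2) (h2.const_mul 2), ← integral_add h12 h3]
  exact integral_mono (integrable_kineticSlope_sq hu hv hf hs) (h12.add h3) kineticSlope_sq_le

theorem integrable_kineticSlope [IsFiniteMeasure π] : Integrable kineticSlope π := by
  refine ((integrable_kineticSlope_sq hu hv hf hs).add (integrable_const 1)).mono'
    measurable_kineticSlope.aestronglyMeasurable (Eventually.of_forall fun z => ?_)
  rw [Real.norm_eq_abs, Pi.add_apply, ← sq_abs]
  nlinarith [sq_nonneg (|kineticSlope z| - 1), abs_nonneg (kineticSlope z)]

theorem half_integral_norm_sub_add_smul_sq [IsFiniteMeasure π] (τ : ℝ) :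
    1 / 2 * ∫ z, ‖z.1 - (z.2.1 + τ • z.2.2)‖ ^ 2 ∂π = (∫ z, kineticConst z ∂π)
      + τ * (∫ z, kineticSlope z ∂π) + τ ^ 2 / 2 * ∫ x, ‖x‖ ^ 2 ∂(densMeas n (gaussS n)) := by
  have h1 := integrable_kineticConst hu hv hf hs
  have h2 := (integrable_kineticSlope hu hv hf hs).const_mul τ
  have h3 := (integrable_moments hu hv hf hs 2).2.2.const_mul (τ ^ 2 / 2)
  have h12 : Integrable (fun z => kineticConst z + τ * kineticSlope z) π := h1.add h2
  rw [← (integral_moments hu hf hs 2).2.2, ← integral_const_mul, ← integral_const_mul,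
    ← integral_const_mul, ← integral_add h1 h2, ← integral_add h12 h3]
  congr with z
  rw [kineticConst, kineticSlope, ← sub_sub, norm_sub_sq_real, inner_smul_right, norm_smul,
    mul_pow, Real.norm_eq_abs, sq_abs]
  ring

end moments

end

end

section
open InformationTheory
variable {n : ℕ} {u v : Eucl n → ℝ}

/-- Lebesgue-free form of the value of the entropic problem between `u` and the law of `Y + τ Z`,
with `Y` of density `v` and `Z` an independent standard Gaussian, as a function of `τ`. -/
noncomputable def entropicProfile (u v : Eucl n → ℝ) (τ : ℝ) : ℝ :=
  ⨅ a : couplingDensities (densMeas n u) (gaussExt n v),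
    (((∫ z, klFun (a.1 z) ∂((densMeas n u).prod (gaussExt n v)))
      + ∫ z, kineticConst z * a.1 z ∂((densMeas n u).prod (gaussExt n v)))
      + τ * ∫ z, kineticSlope z * a.1 z ∂((densMeas n u).prod (gaussExt n v)))

variable (hu : TameDensity u) (hv : TameDensity v) [IsProbabilityMeasure (densMeas n u)]
  [IsProbabilityMeasure (densMeas n v)]
include hu hv

theorem differentiableAt_entropicProfile (τ : ℝ) :
    DifferentiableAt ℝ (entropicProfile u v) τ := by
  refine differentiableAt_iInf_integral_klFun_add ⟨_, one_mem_couplingDensities⟩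
    (fun z => by unfold kineticConst; positivity)
    (Q := 2 * ∫ x, ‖x‖ ^ 4 ∂(densMeas n u) + 2 * ∫ x, ‖x‖ ^ 4 ∂(densMeas n v)
      + ∫ x, ‖x‖ ^ 4 ∂(densMeas n (gaussS n)))
    measurable_kineticSlope.aestronglyMeasurable ?_
    (fun a ha b hb => add_div_two_mem_couplingDensities ha hb) τ
  rintro a ⟨am, a0, ak, af, as⟩
  have := isProbabilityMeasure_of_map measurable_fst af
  have h1 := integrable_kineticSlope_sq hu hv af as
  rw [integrable_withDensity_ofReal_iff am a0] at h1
  have h2 := integrable_kineticConst hu hv af as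
  rw [integrable_withDensity_ofReal_iff am a0] at h2
  have h3 := integral_kineticSlope_sq_le hu hv af as
  rw [integral_withDensity_ofReal am a0] at h3
  have h4 := integrable_const (μ := ((densMeas n u).prod (gaussExt n v)).withDensity
    fun z => ENNReal.ofReal (a z)) (1 : ℝ)
  rw [integrable_withDensity_ofReal_iff am a0] at h4
  have h5 := integral_withDensity_ofReal (P := (densMeas n u).prod (gaussExt n v))
    (φ := fun _ => 1) am a0
  simp only [integral_const, probReal_univ, smul_eq_mul, one_mul] at h4 h5
  exact ⟨a0, h4, h5.symm, ak, h2, h1, h3⟩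

theorem klFun_add_half_integral_norm_sub_sq {a : Eucl n × Eucl n × Eucl n → ℝ}
    (ha : a ∈ couplingDensities (densMeas n u) (gaussExt n v)) (τ : ℝ) :
    (∫ z, klFun (a z) ∂((densMeas n u).prod (gaussExt n v))) + 1 / 2 *
      ∫ p, ‖p.1 - p.2‖ ^ 2 ∂(((densMeas n u).prod (gaussExt n v)).withDensity
        fun z => ENNReal.ofReal (a z)).map (Prod.map id fun w => w.1 + τ • w.2)
      = ((∫ z, klFun (a z) ∂((densMeas n u).prod (gaussExt n v)))
      + ∫ z, kineticConst z * a z ∂((densMeas n u).prod (gaussExt n v)))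
      + τ * (∫ z, kineticSlope z * a z ∂((densMeas n u).prod (gaussExt n v)))
      + τ ^ 2 / 2 * ∫ x, ‖x‖ ^ 2 ∂(densMeas n (gaussS n)) := by
  obtain ⟨am, a0, ak, af, as⟩ := ha
  have := isProbabilityMeasure_of_map measurable_fst af
  have h := half_integral_norm_sub_add_smul_sq hu hv af as τ
  rw [integral_withDensity_ofReal (φ := kineticConst) am a0,
    integral_withDensity_ofReal (φ := kineticSlope) am a0] at h
  rw [integral_map (by fun_prop) (by fun_prop)]
  simp only [Prod.map_fst, Prod.map_snd, id]
  rw [h]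
  ring

theorem bddBelow_range_entropicProfile (τ : ℝ) :
    BddBelow (range fun a : couplingDensities (densMeas n u) (gaussExt n v) =>
      (((∫ z, klFun (a.1 z) ∂((densMeas n u).prod (gaussExt n v)))
      + ∫ z, kineticConst z * a.1 z ∂((densMeas n u).prod (gaussExt n v)))
      + τ * ∫ z, kineticSlope z * a.1 z ∂((densMeas n u).prod (gaussExt n v)))) := by
  refine ⟨-(τ ^ 2 / 2 * ∫ x, ‖x‖ ^ 2 ∂(densMeas n (gaussS n))), ?_⟩
  rintro _ ⟨⟨a, ha⟩, rfl⟩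
  have h := klFun_add_half_integral_norm_sub_sq hu hv ha τ
  have h1 : 0 ≤ ∫ z, klFun (a z) ∂((densMeas n u).prod (gaussExt n v)) :=
    integral_nonneg fun z => klFun_nonneg (ha.2.1 z)
  have h2 : 0 ≤ ∫ p, ‖p.1 - p.2‖ ^ 2 ∂(((densMeas n u).prod (gaussExt n v)).withDensity
      fun z => ENNReal.ofReal (a z)).map (Prod.map id fun w => w.1 + τ • w.2) :=
    integral_nonneg fun p => by positivity
  simp only
  linarith

theorem iInf_relEnt_heat {t : ℝ} (ht : 0 ≤ t) (hw : TameDensity (heat n t v)) :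
    (⨅ π : {π : Measure (Eucl n × Eucl n) // Coupling π (densMeas n u) (densMeas n (heat n t v))},
      relEnt π.1 (R01 n)) =
    ((entDens n u + entDens n (heat n t v) + n / 2 * Real.log (2 * Real.pi)
      + t / 2 * (∫ x, ‖x‖ ^ 2 ∂(densMeas n (gaussS n))) + entropicProfile u v (√t) : ℝ) : EReal) := by
  obtain ⟨M, hM⟩ := hv.weight 0
  have hT : Measurable fun w : Eucl n × Eucl n => w.1 + √t • w.2 := by fun_prop
  have hmap : (gaussExt n v).map (fun w => w.1 + √t • w.2) = densMeas n (heat n t v) :=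
    map_add_smul_gaussS hv.measurable (fun x => (hv.pos x).le)
      (fun x => (le_abs_self _).trans (by simpa using hM x)) ht
  have : IsProbabilityMeasure (densMeas n (heat n t v)) := by
    rw [← hmap]; exact Measure.isProbabilityMeasure_map hT.aemeasurable
  have hP : ((densMeas n u).prod (gaussExt n v)).map (Prod.map id fun w => w.1 + √t • w.2) =
      (densMeas n u).prod (densMeas n (heat n t v)) := by
    rw [← hmap, ← Measure.map_prod_map _ _ measurable_id hT, Measure.map_id]
  have hbdd := bddBelow_range_entropicProfile hu hv (√t)
  have hsq := Real.sq_sqrt ht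
  have : Nonempty (couplingDensities (densMeas n u) (gaussExt n v)) :=
    ⟨⟨_, one_mem_couplingDensities⟩⟩
  refine le_antisymm ?_ (le_iInf ?_)
  · set V := ⨅ π : {π : Measure (Eucl n × Eucl n) //
      Coupling π (densMeas n u) (densMeas n (heat n t v))}, relEnt π.1 (R01 n) with hV
    have key : ∀ a : couplingDensities (densMeas n u) (gaussExt n v),
        V ≤ ((entDens n u + entDens n (heat n t v) + n / 2 * Real.log (2 * Real.pi)
          + t / 2 * (∫ x, ‖x‖ ^ 2 ∂(densMeas n (gaussS n))) +
          (((∫ z, klFun (a.1 z) ∂((densMeas n u).prod (gaussExt n v)))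
          + ∫ z, kineticConst z * a.1 z ∂((densMeas n u).prod (gaussExt n v)))
          + √t * ∫ z, kineticSlope z * a.1 z ∂((densMeas n u).prod (gaussExt n v))) : ℝ) :
          EReal) := by
      rintro ⟨a, ha⟩
      have h := klFun_add_half_integral_norm_sub_sq hu hv ha (√t)
      obtain ⟨am, a0, ak, af, as⟩ := ha
      have := isProbabilityMeasure_of_map measurable_fst af
      set ξ := ((densMeas n u).prod (gaussExt n v)).withDensity fun z => ENNReal.ofReal (a z)
      set π := ξ.map (Prod.map id fun w => w.1 + √t • w.2) with hπ
      have hc : Coupling π (densMeas n u) (densMeas n (heat n t v)) := by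
        refine ⟨Measure.isProbabilityMeasure_map (by fun_prop), ?_, ?_⟩
        · rw [hπ, Measure.map_map measurable_fst (by fun_prop)]
          exact af
        · rw [← hmap, ← as, hπ, Measure.map_map measurable_snd (by fun_prop),
            Measure.map_map hT measurable_snd]
          rfl
      have hkl : klDiv π ((densMeas n u).prod (densMeas n (heat n t v))) ≤
          ENNReal.ofReal (∫ z, klFun (a z) ∂((densMeas n u).prod (gaussExt n v))) := by
        rw [← hP, ← klDiv_withDensity_ofReal am a0 ak]
        exact klDiv_map_le _ _ (by fun_prop)
      have hne := ne_top_of_le_ne_top ENNReal.ofReal_ne_top hkl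
      have hle := ENNReal.toReal_le_of_le_ofReal
        (integral_nonneg fun z => klFun_nonneg (a0 z)) hkl
      refine (iInf_le _ ⟨π, hc⟩).trans ?_
      rw [(relEnt_R01_eq hu hw hc).2 hne, EReal.coe_le_coe_iff]
      rw [hsq] at h
      linarith
    have hbot : V ≠ ⊥ := by
      intro h
      have h0 : (((entDens n u + entDens n (heat n t v) + n / 2 * Real.log (2 * Real.pi) : ℝ)) :
          EReal) ≤ V := by
        refine le_iInf fun ⟨π, hc⟩ => ?_
        by_cases hk : klDiv π ((densMeas n u).prod (densMeas n (heat n t v))) = ⊤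
        · rw [(relEnt_R01_eq hu hw hc).1 hk]; exact le_top
        · rw [(relEnt_R01_eq hu hw hc).2 hk, EReal.coe_le_coe_iff]
          have : 0 ≤ ∫ p, ‖p.1 - p.2‖ ^ 2 ∂π := integral_nonneg fun p => by positivity
          have := ENNReal.toReal_nonneg
            (a := klDiv π ((densMeas n u).prod (densMeas n (heat n t v))))
          linarith
      rw [h] at h0
      exact EReal.coe_ne_bot _ (le_bot_iff.1 h0)
    have htop : V ≠ ⊤ := by
      intro h
      have h0 := key (Classical.arbitrary _)
      rw [h] at h0
      exact EReal.coe_ne_top _ (top_le_iff.1 h0)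
    lift V to ℝ using ⟨htop, hbot⟩ with r
    rw [EReal.coe_le_coe_iff]
    simp only [EReal.coe_le_coe_iff] at key
    rw [← sub_le_iff_le_add']
    exact le_ciInf fun a => sub_le_iff_le_add'.2 (key a)
  · rintro ⟨π, hc⟩
    by_cases hk : klDiv π ((densMeas n u).prod (densMeas n (heat n t v))) = ⊤
    · rw [(relEnt_R01_eq hu hw hc).1 hk]; exact le_top
    rw [(relEnt_R01_eq hu hw hc).2 hk, EReal.coe_le_coe_iff]
    have := hc.1
    rw [← hmap] at hk
    obtain ⟨a, am, a0, ak, af, as, aπ, akl⟩ := exists_lift_density hT hc.2.1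
      (by rw [hmap]; exact hc.2.2) hk
    rw [hmap] at akl
    have ha : a ∈ couplingDensities (densMeas n u) (gaussExt n v) := ⟨am, a0, ak, af, as⟩
    have h := klFun_add_half_integral_norm_sub_sq hu hv ha (√t)
    have hJ := ciInf_le hbdd ⟨a, ha⟩
    rw [aπ, hsq] at h
    rw [akl]
    unfold entropicProfile
    simp only at hJ
    linarith

end

section
open scoped SchwartzMap
variable {n : ℕ} {u : Eucl n → ℝ}

theorem entCost_densMeas {w : Eucl n → ℝ} (hu : TameDensity u) (hw : TameDensity w) {I : ℝ}
    (h : (⨅ π : {π : Measure (Eucl n × Eucl n) // Coupling π (densMeas n u) (densMeas n w)},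
      relEnt π.1 (R01 n)) = (I : EReal)) :
    entCost n (densMeas n u) (densMeas n w) = I - (entDens n u + entDens n w) / 2 := by
  rw [entCost, entCostE, h, entLeb_densMeas hu.measurable fun x => (hu.pos x).le,
    entLeb_densMeas hw.measurable fun x => (hw.pos x).le, ← EReal.coe_sub, EReal.toReal_coe]

/-- Along the heat flow, the infimum of the entropies of couplings is finite. -/
theorem exists_iInf_relEnt_heat (hu : TameDensity u) [IsProbabilityMeasure (densMeas n u)]
    {φ : 𝓢(Eucl n, ℝ)} (hφ : HasGaussianLowerBound φ) [IsProbabilityMeasure (densMeas n φ)]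
    {t : ℝ} (ht : 0 ≤ t) :
    ∃ I : ℝ, (⨅ π : {π : Measure (Eucl n × Eucl n) //
      Coupling π (densMeas n u) (densMeas n (heat n t φ))}, relEnt π.1 (R01 n)) = (I : EReal) :=
  ⟨_, iInf_relEnt_heat hu hφ.tameDensity ht (hφ.tameDensity_heat ht)⟩

theorem differentiableWithinAt_entCost_heat (hu : TameDensity u)
    [IsProbabilityMeasure (densMeas n u)] {φ : 𝓢(Eucl n, ℝ)} (hφ : HasGaussianLowerBound φ)
    [IsProbabilityMeasure (densMeas n φ)] {t : ℝ} (ht : 0 < t) :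
    DifferentiableWithinAt ℝ (fun t => entCost n (densMeas n u) (densMeas n (heat n t φ)))
      (Ici 0) t := by
  have hE := (hasDerivWithinAt_entDens_heat hφ ht.le).differentiableWithinAt
  have hJ : DifferentiableWithinAt ℝ (fun t => entropicProfile u φ (√t)) (Ici 0) t :=
    ((differentiableAt_entropicProfile hu hφ.tameDensity (√t)).comp t
      (Real.hasDerivAt_sqrt ht.ne').differentiableAt).differentiableWithinAt
  have e : ∀ s ∈ Ici (0 : ℝ), entCost n (densMeas n u) (densMeas n (heat n s φ)) =
      1 / 2 * entDens n (heat n s φ) + (s * (1 / 2 * ∫ x, ‖x‖ ^ 2 ∂(densMeas n (gaussS n)))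
        + entropicProfile u φ (√s)) + (entDens n u / 2 + n / 2 * Real.log (2 * Real.pi)) := by
    intro s hs
    rw [entCost_densMeas hu (hφ.tameDensity_heat hs)
      (iInf_relEnt_heat hu hφ.tameDensity hs (hφ.tameDensity_heat hs))]
    ring
  refine DifferentiableWithinAt.congr ?_ e (e t ht.le)
  exact ((hE.const_mul _).add ((differentiableWithinAt_id.mul_const _).add hJ)).add_const _

end

section
/-! ### A competitor: heat flow of the second variable of the optimal coupling -/

section
open scoped SchwartzMap LineDeriv Topology
variable {n : ℕ}

theorem lineDerivOp_compSubConstCLM (φ : 𝓢(Eucl n, ℝ)) (e x : Eucl n) :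
    ∂_{e} (φ.compSubConstCLM ℝ x) = (∂_{e} φ).compSubConstCLM ℝ x := by
  ext y
  have h1 := (φ.compSubConstCLM ℝ x).hasDerivAt_line y e 0
  have h2 := φ.hasDerivAt_line (y - x) e 0
  simp only [SchwartzMap.compSubConstCLM_apply, zero_smul, add_zero, add_sub_right_comm] at h1 h2 ⊢
  exact h1.unique h2

theorem lapS_compSubConstCLM (φ : 𝓢(Eucl n, ℝ)) (x : Eucl n) :
    lapS (φ.compSubConstCLM ℝ x) = (lapS φ).compSubConstCLM ℝ x := by
  ext y
  simp only [lapS_apply, lineDerivOp_compSubConstCLM, SchwartzMap.compSubConstCLM_apply]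

/-- The function `y ↦ r(x, y) g(y)` with `r` the heat kernel at time `1`. -/
noncomputable def kernelMulS (g : 𝓢(Eucl n, ℝ)) (x : Eucl n) : 𝓢(Eucl n, ℝ) :=
  mulS ((gaussS n).compSubConstCLM ℝ x) g

theorem kernelMulS_apply (g : 𝓢(Eucl n, ℝ)) (x y : Eucl n) :
    kernelMulS g x y = gaussS n (x - y) * g y := by
  rw [kernelMulS, mulS_apply, SchwartzMap.compSubConstCLM_apply, gaussS_sub_comm]

theorem exists_kernelMulS_weight_bound (g : 𝓢(Eucl n, ℝ)) (k : ℕ) :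
    ∃ C : ℝ, ∀ x y, |kernelMulS g x y| * (1 + ‖y‖) ^ k ≤ C := by
  obtain ⟨A, hA0, hA⟩ := (gaussS n).exists_abs_le
  obtain ⟨B, hB0, hB⟩ := g.exists_weight_bound k
  refine ⟨A * B, fun x y => ?_⟩
  rw [kernelMulS_apply, abs_mul, mul_assoc]
  exact mul_le_mul (hA _) (hB y) (by positivity) hA0.le

theorem exists_lapS_kernelMulS_weight_bound (g : 𝓢(Eucl n, ℝ)) (k : ℕ) :
    ∃ C : ℝ, ∀ x y, |lapS (kernelMulS g x) y| * (1 + ‖y‖) ^ k ≤ C := by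
  obtain ⟨A, hA0, hA⟩ := (gaussS n).exists_abs_le
  obtain ⟨A', hA0', hA'⟩ := (lapS (gaussS n)).exists_abs_le
  obtain ⟨B, hB0, hB⟩ := g.exists_weight_bound k
  obtain ⟨B', hB0', hB'⟩ := (lapS g).exists_weight_bound k
  choose P hP0 hP using fun i : Fin n => (∂_{stdVec i} (gaussS n)).exists_abs_le
  choose Q hQ0 hQ using fun i : Fin n => (∂_{stdVec i} g).exists_weight_bound k
  refine ⟨A' * B + A * B' + 2 * ∑ i, P i * Q i, fun x y => ?_⟩
  rw [kernelMulS, lapS_mulS_apply, lapS_compSubConstCLM]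
  simp only [lineDerivOp_compSubConstCLM, SchwartzMap.compSubConstCLM_apply]
  have hw : 0 ≤ (1 + ‖y‖) ^ k := by positivity
  have h : ∀ {a b a' b' : ℝ}, |a| ≤ a' → |b| * (1 + ‖y‖) ^ k ≤ b' →
      |a * b| * (1 + ‖y‖) ^ k ≤ a' * b' := fun {a b a' b'} h1 h2 => by
    rw [abs_mul, mul_assoc]
    exact mul_le_mul h1 h2 (by positivity) ((abs_nonneg a).trans h1)
  calc _ ≤ (|lapS (gaussS n) (y - x) * g y| + |gaussS n (y - x) * lapS g y|
        + 2 * ∑ i, |(∂_{stdVec i} (gaussS n) : 𝓢(Eucl n, ℝ)) (y - x) *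
          (∂_{stdVec i} g : 𝓢(Eucl n, ℝ)) y|) * (1 + ‖y‖) ^ k := by
        gcongr
        refine (abs_add_le _ _).trans (add_le_add (abs_add_le _ _) ?_)
        rw [abs_mul, abs_two]
        gcongr
        exact Finset.abs_sum_le_sum_abs _ _
    _ = |lapS (gaussS n) (y - x) * g y| * (1 + ‖y‖) ^ k
        + |gaussS n (y - x) * lapS g y| * (1 + ‖y‖) ^ k
        + 2 * ∑ i, |(∂_{stdVec i} (gaussS n) : 𝓢(Eucl n, ℝ)) (y - x) *
          (∂_{stdVec i} g : 𝓢(Eucl n, ℝ)) y| * (1 + ‖y‖) ^ k := by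
        rw [Finset.mul_sum, Finset.mul_sum, add_mul, add_mul, Finset.sum_mul]
        simp only [mul_assoc]
        rfl
    _ ≤ _ := by
        refine add_le_add (add_le_add (h (hA' _) (hB y)) (h (hA _) (hB' y)))
          (mul_le_mul_of_nonneg_left (Finset.sum_le_sum fun i _ => h (hP i _) (hQ i y)) zero_le_two)

/-- The density at time `t` of the coupling obtained from the density `f(x) r(x, y) g(y)` by
running the heat flow in `y`. -/
noncomputable def flowDensity (f g : 𝓢(Eucl n, ℝ)) (t : ℝ) (p : Eucl n × Eucl n) : ℝ :=
  f p.1 * heat n t (kernelMulS g p.1) p.2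

theorem measurable_heat_kernelMulS (g : 𝓢(Eucl n, ℝ)) {t : ℝ} (ht : 0 ≤ t) :
    Measurable fun p : Eucl n × Eucl n => heat n t (kernelMulS g p.1) p.2 := by
  have h1 := (gaussS n).continuous
  have h2 := g.continuous
  simp only [heat_eq ht, kernelMulS_apply]
  have : StronglyMeasurable fun q : (Eucl n × Eucl n) × Eucl n =>
      gaussS n (q.1.1 - (q.1.2 - √t • q.2)) * g (q.1.2 - √t • q.2) * gaussS n q.2 :=
    (by fun_prop : Continuous _).stronglyMeasurable
  exact this.integral_prod_right'.measurable

theorem measurable_flowDensity (f g : 𝓢(Eucl n, ℝ)) {t : ℝ} (ht : 0 ≤ t) :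
    Measurable (flowDensity f g t) :=
  (f.continuous.measurable.comp measurable_fst).mul (measurable_heat_kernelMulS g ht)

theorem flowDensity_zero (f g : 𝓢(Eucl n, ℝ)) (p : Eucl n × Eucl n) :
    flowDensity f g 0 p = f p.1 * (gaussS n (p.1 - p.2) * g p.2) := by
  simp [flowDensity, heat, kernelMulS_apply]

theorem exists_flowDensity_lower_bound {f g : 𝓢(Eucl n, ℝ)} (hf : HasGaussianLowerBound f)
    (hg : HasGaussianLowerBound g) : ∃ α c : ℝ, 0 < α ∧ 0 < c ∧ ∀ t ∈ Icc (0 : ℝ) 1, ∀ p,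
      c * Real.exp (-α * (‖p.1‖ ^ 2 + ‖p.2‖ ^ 2)) ≤ flowDensity f g t p := by
  obtain ⟨α, c, hα, hc, h1⟩ := hf
  obtain ⟨β, d, hβ, hd, h2⟩ := hg
  obtain ⟨κ, hκ, hlow⟩ := heat_lower_bound n (α := β + 1) (by positivity) zero_le_one
  obtain ⟨M, hM⟩ := exists_kernelMulS_weight_bound g 0
  have hC : 0 < (2 * Real.pi) ^ ((n : ℝ) / 2) := by positivity
  set C := ((2 * Real.pi) ^ ((n : ℝ) / 2))⁻¹ with hCdef
  have hC0 : 0 < C := by positivity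
  refine ⟨α + 1 + 2 * (β + 1), c * (C * d * κ), by positivity, by positivity, fun t ht p => ?_⟩
  have h3 : ∀ y, C * d * Real.exp (-‖p.1‖ ^ 2) * Real.exp (-(β + 1) * ‖y‖ ^ 2)
      ≤ kernelMulS g p.1 y := by
    intro y
    rw [kernelMulS_apply, gaussS_apply, div_eq_mul_inv, ← hCdef]
    have h4 : ‖p.1 - y‖ ^ 2 ≤ 2 * (‖p.1‖ ^ 2 + ‖y‖ ^ 2) := by
      have := norm_sub_le p.1 y
      nlinarith [sq_nonneg (‖p.1‖ - ‖y‖), norm_nonneg (p.1 - y)]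
    calc _ = Real.exp (-‖p.1‖ ^ 2 - ‖y‖ ^ 2) * C * (d * Real.exp (-β * ‖y‖ ^ 2)) := by
          rw [show C * d * Real.exp (-‖p.1‖ ^ 2) * Real.exp (-(β + 1) * ‖y‖ ^ 2) =
            C * d * (Real.exp (-‖p.1‖ ^ 2) * Real.exp (-(β + 1) * ‖y‖ ^ 2)) by ring,
            show Real.exp (-‖p.1‖ ^ 2 - ‖y‖ ^ 2) * C * (d * Real.exp (-β * ‖y‖ ^ 2)) =
            C * d * (Real.exp (-‖p.1‖ ^ 2 - ‖y‖ ^ 2) * Real.exp (-β * ‖y‖ ^ 2)) by ring,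
            ← Real.exp_add, ← Real.exp_add]
          ring_nf
      _ ≤ _ := by
          refine mul_le_mul (mul_le_mul_of_nonneg_right (Real.exp_le_exp.2 (by linarith)) hC0.le)
            (h2 y) (by positivity) (by positivity)
  have h5 := hlow (kernelMulS g p.1) _ M (kernelMulS g p.1).continuous.measurable
    (fun y => by simpa using hM p.1 y) (by positivity) h3 t ht.1 ht.2 p.2
  calc _ ≤ (c * Real.exp (-α * ‖p.1‖ ^ 2)) * (C * d * Real.exp (-‖p.1‖ ^ 2) * κ *
        Real.exp (-(2 * (β + 1)) * ‖p.2‖ ^ 2)) := by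
        rw [show (c * Real.exp (-α * ‖p.1‖ ^ 2)) * (C * d * Real.exp (-‖p.1‖ ^ 2) * κ *
          Real.exp (-(2 * (β + 1)) * ‖p.2‖ ^ 2)) = c * (C * d * κ) *
          (Real.exp (-α * ‖p.1‖ ^ 2) * Real.exp (-‖p.1‖ ^ 2) *
            Real.exp (-(2 * (β + 1)) * ‖p.2‖ ^ 2)) by ring, ← Real.exp_add, ← Real.exp_add]
        gcongr
        nlinarith [mul_nonneg (by positivity : 0 ≤ 2 * (β + 1)) (sq_nonneg ‖p.1‖),
          mul_nonneg (by positivity : 0 ≤ α + 1) (sq_nonneg ‖p.2‖)]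
    _ ≤ _ := mul_le_mul (h1 _) h5 (by positivity) ((by positivity : (0:ℝ) ≤ _).trans (h1 p.1))

theorem exists_abs_log_flowDensity_le {f g : 𝓢(Eucl n, ℝ)} (hf : HasGaussianLowerBound f)
    (hg : HasGaussianLowerBound g) : ∃ C : ℝ, 0 ≤ C ∧ ∀ t ∈ Icc (0 : ℝ) 1, ∀ p,
      |Real.log (flowDensity f g t p)| ≤ C * ((1 + ‖p.1‖) ^ 2 * (1 + ‖p.2‖) ^ 2) := by
  obtain ⟨α, c, hα, hc, h⟩ := exists_flowDensity_lower_bound hf hg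
  obtain ⟨A, hA0, hA⟩ := f.exists_abs_le
  obtain ⟨M, hM⟩ := exists_kernelMulS_weight_bound g 0
  obtain ⟨C, hC0, hC⟩ := exists_abs_log_le (E := ℝ) (M := A * (M * heatConst n 0 1)) hα.le hc
  refine ⟨C, hC0, fun t ht p => ?_⟩
  have hp1 := norm_nonneg p.1
  have hp2 := norm_nonneg p.2
  refine (hC (‖p.1‖ + ‖p.2‖) _ (le_trans ?_ (h t ht p)) ?_).trans ?_
  · rw [Real.norm_of_nonneg (by positivity)]
    refine mul_le_mul_of_nonneg_left (Real.exp_le_exp.2 ?_) hc.le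
    nlinarith [mul_nonneg hα.le (mul_nonneg hp1 hp2)]
  · have := heat_weight_bound ht.1 ht.2 (hM p.1) p.2
    rw [pow_zero, mul_one] at this
    exact (le_abs_self _).trans (by
      rw [flowDensity, abs_mul]; exact mul_le_mul (hA _) this (abs_nonneg _) hA0.le)
  · rw [Real.norm_of_nonneg (by positivity), ← mul_pow]
    gcongr
    nlinarith [mul_nonneg hp1 hp2]

theorem exists_flowDensity_sub_le (f g : 𝓢(Eucl n, ℝ)) (k : ℕ) : ∃ C : ℝ, ∀ t ∈ Icc (0 : ℝ) 1,
    ∀ p, |flowDensity f g t p - flowDensity f g 0 p|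
      ≤ |t - 0| * (|f p.1| * (C * ((1 + ‖p.2‖) ^ k)⁻¹)) := by
  obtain ⟨M, hM⟩ := exists_lapS_kernelMulS_weight_bound g k
  refine ⟨M * heatConst n k 1, fun t ht p => ?_⟩
  have h := abs_le_mul_inv_of_mul_le (by positivity)
    (heat_sub_weight_bound (kernelMulS g p.1) (hM p.1) ht ⟨le_rfl, zero_le_one⟩ p.2)
  rw [flowDensity, flowDensity, ← mul_sub, abs_mul]
  calc _ ≤ |f p.1| * (M * heatConst n k 1 * |t - 0| * ((1 + ‖p.2‖) ^ k)⁻¹) := by gcongr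
    _ = _ := by ring

/-- The entropy of the competitor relative to the optimal coupling is integrable for small times
and has vanishing derivative at time `0`. -/
theorem hasDerivWithinAt_integral_flowDensity {f g : 𝓢(Eucl n, ℝ)}
    (hf : HasGaussianLowerBound f) (hg : HasGaussianLowerBound g) :
    (∀ᶠ t in 𝓝[Ici 0] (0 : ℝ), Integrable fun p => flowDensity f g t p *
      (Real.log (flowDensity f g t p) - Real.log (flowDensity f g 0 p))
        - flowDensity f g t p + flowDensity f g 0 p) ∧
    HasDerivWithinAt (fun t => ∫ p, (flowDensity f g t p *
      (Real.log (flowDensity f g t p) - Real.log (flowDensity f g 0 p))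
        - flowDensity f g t p + flowDensity f g 0 p)) 0 (Ici 0) 0 := by
  obtain ⟨C, hC0, hC⟩ := exists_abs_log_flowDensity_le hf hg
  obtain ⟨B, hB⟩ := exists_flowDensity_sub_le f g (n + 1 + 2)
  obtain ⟨A, hA0, hA⟩ := f.exists_weight_bound (n + 1 + 2)
  obtain ⟨α, c, hα, hc, hlow⟩ := exists_flowDensity_lower_bound hf hg
  have hnhd : Icc (0 : ℝ) 1 ∈ 𝓝[Ici 0] (0 : ℝ) := by simpa using mem_nhdsWithin_Icc_add_one 0
  refine hasDerivWithinAt_integral_remainder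
    (L := fun p => C * ((1 + ‖p.1‖) ^ 2 * (1 + ‖p.2‖) ^ 2))
    (D := fun p => |f p.1| * (B * ((1 + ‖p.2‖) ^ (n + 1 + 2))⁻¹))
    (a' := fun p => f p.1 * (1 / 2 * heat n 0 (lapS (kernelMulS g p.1)) p.2)) self_mem_Ici
    ?_ ?_ ?_ ?_ ?_ fun p => (hasDerivWithinAt_heat _ _ le_rfl).const_mul _
  · filter_upwards [hnhd] with t ht p
    exact (by positivity : 0 < c * _).trans_le (hlow t ht p)
  · filter_upwards [hnhd] with t ht using hC t ht
  · filter_upwards [hnhd] with t ht using measurable_flowDensity f g ht.1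
  · filter_upwards [hnhd] with t ht using hB t ht
  · have h1 : Integrable fun x : Eucl n => |f x| * (C * (1 + ‖x‖) ^ 2) :=
      integrable_mul_of_bounds (a := fun x => |f x|) (j := 2) f.continuous.measurable.abs
        (by fun_prop) (by simpa using hA) (C := C) fun x => by rw [abs_of_nonneg (by positivity)]
    have h2 : Integrable fun y : Eucl n => B * ((1 + ‖y‖) ^ (n + 1 + 2))⁻¹ * (1 + ‖y‖) ^ 2 :=
      integrable_inv_weight_mul (by fun_prop) (C := 1)
        (fun x => by rw [abs_of_nonneg (by positivity), one_mul]) B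
    refine (h1.mul_prod h2).congr (Eventually.of_forall fun p => ?_)
    simp only
    ring

end

end

section
open scoped SchwartzMap Topology
open InformationTheory

theorem klDiv_withDensity_withDensity {X : Type*} [MeasurableSpace X] {μ : Measure X}
    {a b : X → ℝ} (ha : Measurable a) (hb : Measurable b) (ha0 : ∀ x, 0 < a x) (hb0 : ∀ x, 0 < b x)
    [IsProbabilityMeasure (μ.withDensity fun x => ENNReal.ofReal (a x))]
    [IsProbabilityMeasure (μ.withDensity fun x => ENNReal.ofReal (b x))]
    (hint : Integrable (fun x => a x * (Real.log (a x) - Real.log (b x)) - a x + b x) μ) :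
    klDiv (μ.withDensity fun x => ENNReal.ofReal (a x))
      (μ.withDensity fun x => ENNReal.ofReal (b x)) =
      ENNReal.ofReal (∫ x, (a x * (Real.log (a x) - Real.log (b x)) - a x + b x) ∂μ) := by
  have hab : Measurable fun x => a x / b x := ha.div hb
  have h0 : ∀ x, 0 ≤ a x / b x := fun x => (div_pos (ha0 x) (hb0 x)).le
  have e : (μ.withDensity fun x => ENNReal.ofReal (a x)) =
      (μ.withDensity fun x => ENNReal.ofReal (b x)).withDensity
        fun x => ENNReal.ofReal (a x / b x) := by
    rw [← withDensity_mul _ (by fun_prop) (by fun_prop)]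
    congr 1
    ext x
    rw [Pi.mul_apply, ← ENNReal.ofReal_mul (hb0 x).le, mul_div_cancel₀ _ (hb0 x).ne']
  have hk : ∀ x, klFun (a x / b x) * b x =
      a x * (Real.log (a x) - Real.log (b x)) - a x + b x := by
    intro x
    have := (hb0 x).ne'
    rw [klFun, Real.log_div (ha0 x).ne' this]
    field_simp
    ring
  have hP : IsProbabilityMeasure ((μ.withDensity fun x => ENNReal.ofReal (b x)).withDensity
      fun x => ENNReal.ofReal (a x / b x)) := by rw [← e]; infer_instance
  rw [e, klDiv_withDensity_ofReal hab h0, integral_withDensity_ofReal hb fun x => (hb0 x).le]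
  · simp_rw [hk]
  · rw [integrable_withDensity_ofReal_iff hb fun x => (hb0 x).le]
    simpa only [hk] using hint

variable {n : ℕ}

theorem lintegral_heat {φ : 𝓢(Eucl n, ℝ)} (h0 : ∀ x, 0 ≤ φ x) {t : ℝ} (ht : 0 ≤ t) :
    ∫⁻ x, ENNReal.ofReal (heat n t φ x) = ∫⁻ x, ENNReal.ofReal (φ x) := by
  obtain ⟨M, -, hM⟩ := φ.exists_abs_le
  have h := congrArg (fun μ : Measure (Eucl n) => μ univ)
    (map_add_smul_gaussS φ.continuous.measurable h0 (fun x => (le_abs_self _).trans (hM x)) ht)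
  beta_reduce at h
  rw [Measure.map_apply (by fun_prop) MeasurableSet.univ, preimage_univ, ← univ_prod_univ,
    Measure.prod_prod, measure_univ (μ := densMeas n (gaussS n)), mul_one, densMeas, densMeas,
    withDensity_apply _ MeasurableSet.univ, withDensity_apply _ MeasurableSet.univ] at h
  simpa using h.symm

theorem heat_one_eq_integral (φ : Eucl n → ℝ) (x : Eucl n) :
    heat n 1 φ x = ∫ y, gaussS n (x - y) * φ y := by
  rw [heat_eq zero_le_one, ← integral_sub_left_eq_self _ volume x]
  simp [mul_comm]

theorem lintegral_gaussS_sub_mul {φ : 𝓢(Eucl n, ℝ)} (h0 : ∀ x, 0 ≤ φ x) (x : Eucl n) :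
    ∫⁻ y, ENNReal.ofReal (gaussS n (x - y) * φ y) = ENNReal.ofReal (heat n 1 φ x) := by
  rw [heat_one_eq_integral, ofReal_integral_eq_lintegral_ofReal]
  · simp_rw [← kernelMulS_apply]
    exact (kernelMulS φ x).integrable
  · exact Eventually.of_forall fun y => mul_nonneg (gaussS_pos n _).le (h0 y)

/-- The coupling with density `flowDensity f g t`. -/
noncomputable def flowMeas (f g : 𝓢(Eucl n, ℝ)) (t : ℝ) : Measure (Eucl n × Eucl n) :=
  volume.withDensity fun p => ENNReal.ofReal (flowDensity f g t p)

variable {f g : 𝓢(Eucl n, ℝ)}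

theorem kernelMulS_nonneg (hg : HasGaussianLowerBound g) (x y : Eucl n) :
    0 ≤ kernelMulS g x y := by
  rw [kernelMulS_apply]
  exact mul_nonneg (gaussS_pos n _).le (hg.pos y).le

theorem map_fst_flowMeas (hf : HasGaussianLowerBound f) (hg : HasGaussianLowerBound g) {t : ℝ}
    (ht : 0 ≤ t) : (flowMeas f g t).map Prod.fst = densMeas n (mulS f (heatS g)) := by
  rw [flowMeas, Measure.volume_eq_prod,
    map_fst_withDensity_prod (measurable_flowDensity f g ht).ennreal_ofReal, densMeas]
  congr 1
  ext x
  simp only [flowDensity, ENNReal.ofReal_mul (hf.pos x).le]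
  rw [lintegral_const_mul' _ _ ENNReal.ofReal_ne_top, lintegral_heat (kernelMulS_nonneg hg x) ht]
  simp only [kernelMulS_apply]
  rw [lintegral_gaussS_sub_mul fun x => (hg.pos x).le, ← ENNReal.ofReal_mul (hf.pos x).le,
    mulS_apply, heatS_apply]

theorem map_snd_flowMeas (hf : HasGaussianLowerBound f) (hg : HasGaussianLowerBound g) {t : ℝ}
    (ht : 0 ≤ t) :
    (flowMeas f g t).map Prod.snd = densMeas n (heat n t (mulS g (heatS f))) := by
  have h1 := (gaussS n).continuous
  have h2 := g.continuous
  have h3 := f.continuous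
  rw [flowMeas, Measure.volume_eq_prod,
    map_snd_withDensity_prod (measurable_flowDensity f g ht).ennreal_ofReal, densMeas]
  congr 1
  ext y
  have e1 : ∀ x, ENNReal.ofReal (flowDensity f g t (x, y)) =
      ∫⁻ z, ENNReal.ofReal (f x * (kernelMulS g x (y - √t • z) * gaussS n z)) := by
    intro x
    rw [flowDensity, heat_eq ht, ← integral_const_mul, ofReal_integral_eq_lintegral_ofReal]
    · exact (integrable_schwartz_comp_mul_gaussS _ _ _).const_mul _
    · exact Eventually.of_forall fun z => mul_nonneg (hf.pos x).le
        (mul_nonneg (kernelMulS_nonneg hg _ _) (gaussS_pos n z).le)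
  simp_rw [e1, kernelMulS_apply]
  rw [lintegral_lintegral_swap (by fun_prop), heat_eq ht, ofReal_integral_eq_lintegral_ofReal]
  · refine lintegral_congr fun z => ?_
    have e2 : ∀ x, ENNReal.ofReal (f x * (gaussS n (x - (y - √t • z)) * g (y - √t • z)
        * gaussS n z)) = ENNReal.ofReal (gaussS n (y - √t • z - x) * f x) *
          ENNReal.ofReal (g (y - √t • z) * gaussS n z) := by
      intro x
      rw [← ENNReal.ofReal_mul (mul_nonneg (gaussS_pos n _).le (hf.pos x).le),
        gaussS_sub_comm n x]
      congr 1
      ring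
    simp_rw [e2]
    rw [lintegral_mul_const' _ _ ENNReal.ofReal_ne_top,
      lintegral_gaussS_sub_mul fun x => (hf.pos x).le, mulS_apply, heatS_apply,
      ← ENNReal.ofReal_mul (hf.heat zero_le_one |>.pos _).le]
    congr 1
    ring
  · exact integrable_schwartz_comp_mul_gaussS _ _ _
  · exact Eventually.of_forall fun z =>
      mul_nonneg ((hg.mulS hf.heatS).pos _).le (gaussS_pos n z).le

theorem flowMeas_zero :
    flowMeas f g 0 = (R01 n).withDensity fun p => ENNReal.ofReal (f p.1 * g p.2) := by
  have h1 := (gaussS n).continuous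
  have h2 := g.continuous
  have h3 := f.continuous
  rw [R01_eq, ← withDensity_mul _ (by fun_prop) (by fun_prop), flowMeas]
  congr 1
  ext p
  rw [flowDensity_zero, Pi.mul_apply, ← ENNReal.ofReal_mul (gaussS_pos n _).le]
  congr 1
  ring

theorem coupling_flowMeas (hf : HasGaussianLowerBound f) (hg : HasGaussianLowerBound g)
    [IsProbabilityMeasure (densMeas n (mulS f (heatS g)))] {t : ℝ} (ht : 0 ≤ t) :
    Coupling (flowMeas f g t) (densMeas n (mulS f (heatS g)))
      (densMeas n (heat n t (mulS g (heatS f)))) :=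
  ⟨isProbabilityMeasure_of_map measurable_fst (map_fst_flowMeas hf hg ht),
    map_fst_flowMeas hf hg ht, map_snd_flowMeas hf hg ht⟩

variable (hf : HasGaussianLowerBound f) (hg : HasGaussianLowerBound g)
  [IsProbabilityMeasure (densMeas n (mulS f (heatS g)))]
include hf hg

theorem relEnt_R01_eq_klDiv_flowMeas {t : ℝ} (ht : 0 ≤ t) {π : Measure (Eucl n × Eucl n)}
    (hπ : Coupling π (densMeas n (mulS f (heatS g)))
      (densMeas n (heat n t (mulS g (heatS f))))) :
    (klDiv π (flowMeas f g 0) = ⊤ → relEnt π (R01 n) = ⊤) ∧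
    (klDiv π (flowMeas f g 0) ≠ ⊤ → relEnt π (R01 n) = (((klDiv π (flowMeas f g 0)).toReal +
      ((∫ x, Real.log (f x) ∂(densMeas n (mulS f (heatS g)))) +
        ∫ y, Real.log (g y) ∂(densMeas n (heat n t (mulS g (heatS f))))) : ℝ) : EReal)) := by
  have h2 := g.continuous.measurable
  have h3 := f.continuous.measurable
  have := hπ.1
  have := (coupling_flowMeas hf hg le_rfl).1
  obtain ⟨C, -, hC⟩ := exists_abs_log_le_of_hasGaussianLowerBound hf
  obtain ⟨B, -, hB⟩ := exists_abs_log_le_of_hasGaussianLowerBound hg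
  have i1 := (hf.mulS hg.heatS).tameDensity.integrable_densMeas h3.log hC
  have i2 := ((hg.mulS hf.heatS).tameDensity_heat ht).integrable_densMeas h2.log hB
  have j1 := integrable_comp_fst hπ.2.1 i1
  have j2 := integrable_comp_snd hπ.2.2 i2
  have e : (fun p : Eucl n × Eucl n => Real.log (f p.1 * g p.2)) =
      fun p => Real.log (f p.1) + Real.log (g p.2) :=
    funext fun p => Real.log_mul (hf.pos _).ne' (hg.pos _).ne'
  have h := relEnt_eq (π := π) (R := R01 n) (k := fun p => f p.1 * g p.2) (by fun_prop)
    (fun p => mul_pos (hf.pos _) (hg.pos _)) flowMeas_zero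
    (by rw [e]; exact j1.add j2)
  rwa [e, integral_add j1 j2, integral_comp_fst hπ.2.1 i1, integral_comp_snd hπ.2.2 i2] at h

/-- Two-sided bound on the value of the entropic problem along the heat flow. -/
theorem iInf_relEnt_heat_bounds {t : ℝ} (ht : t ∈ Icc (0 : ℝ) 1)
    (hint : Integrable fun p => flowDensity f g t p *
      (Real.log (flowDensity f g t p) - Real.log (flowDensity f g 0 p))
        - flowDensity f g t p + flowDensity f g 0 p) {I : ℝ}
    (hI : (⨅ π : {π : Measure (Eucl n × Eucl n) // Coupling π (densMeas n (mulS f (heatS g)))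
      (densMeas n (heat n t (mulS g (heatS f))))}, relEnt π.1 (R01 n)) = (I : EReal)) :
    (∫ x, Real.log (f x) ∂(densMeas n (mulS f (heatS g)))) +
        (∫ y, Real.log (g y) ∂(densMeas n (heat n t (mulS g (heatS f))))) ≤ I ∧
    I ≤ (∫ p, (flowDensity f g t p *
      (Real.log (flowDensity f g t p) - Real.log (flowDensity f g 0 p))
        - flowDensity f g t p + flowDensity f g 0 p)) +
      ((∫ x, Real.log (f x) ∂(densMeas n (mulS f (heatS g)))) +
        ∫ y, Real.log (g y) ∂(densMeas n (heat n t (mulS g (heatS f))))) := by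
  constructor
  · rw [← EReal.coe_le_coe_iff, ← hI]
    refine le_iInf fun ⟨π, hπ⟩ => ?_
    by_cases hk : klDiv π (flowMeas f g 0) = ⊤
    · rw [(relEnt_R01_eq_klDiv_flowMeas hf hg ht.1 hπ).1 hk]; exact le_top
    · rw [(relEnt_R01_eq_klDiv_flowMeas hf hg ht.1 hπ).2 hk, EReal.coe_le_coe_iff]
      exact le_add_of_nonneg_left ENNReal.toReal_nonneg
  · have hc := coupling_flowMeas hf hg ht.1
    have h1 : IsProbabilityMeasure
      (volume.withDensity fun p => ENNReal.ofReal (flowDensity f g t p)) := hc.1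
    have h2 : IsProbabilityMeasure
      (volume.withDensity fun p => ENNReal.ofReal (flowDensity f g 0 p)) :=
      (coupling_flowMeas hf hg le_rfl).1
    obtain ⟨α, c, hα, hc0, hlow⟩ := exists_flowDensity_lower_bound hf hg
    have hpos : ∀ s ∈ Icc (0 : ℝ) 1, ∀ p, 0 < flowDensity f g s p := fun s hs p =>
      (by positivity : 0 < c * _).trans_le (hlow s hs p)
    have hkl : klDiv (flowMeas f g t) (flowMeas f g 0) = _ := klDiv_withDensity_withDensity
      (measurable_flowDensity f g ht.1) (measurable_flowDensity f g le_rfl)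
      (hpos t ht) (hpos 0 ⟨le_rfl, zero_le_one⟩) hint
    rw [← EReal.coe_le_coe_iff, ← hI]
    refine (iInf_le _ ⟨_, hc⟩).trans ?_
    rw [(relEnt_R01_eq_klDiv_flowMeas hf hg ht.1 hc).2 (by rw [hkl]; exact ENNReal.ofReal_ne_top),
      hkl, ENNReal.toReal_ofReal]
    exact integral_nonneg fun p => (sub_mul_log_sub_log_nonneg
      (hpos 0 ⟨le_rfl, zero_le_one⟩ p) (hpos t ht p)).1

end

section
open scoped SchwartzMap LineDeriv Topology
variable {n : ℕ}

theorem integrable_schwartz_mul_log_add {b : 𝓢(Eucl n, ℝ)} (hb : HasGaussianLowerBound b)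
    (φ : 𝓢(Eucl n, ℝ)) (c : ℝ) : Integrable fun x => φ x * (Real.log (b x) + c) := by
  obtain ⟨C, -, hC⟩ := exists_abs_log_le_of_hasGaussianLowerBound hb
  obtain ⟨A, -, hA⟩ := φ.exists_weight_bound (n + 1 + 2)
  have hbm := b.continuous.measurable
  refine integrable_mul_of_bounds (C := C + |c|) (j := 2) φ.continuous.measurable
    (by fun_prop) hA fun x => (abs_add_le _ _).trans ?_
  have h : 1 ≤ (1 + ‖x‖) ^ 2 := one_le_pow₀ (by have := norm_nonneg x; linarith)
  nlinarith [hC x, mul_le_mul_of_nonneg_left h (abs_nonneg c)]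

/-- Integration by parts of `Δa` against `b (log b + c)`. -/
theorem integral_lapS_mul_mul_log_add (a : 𝓢(Eucl n, ℝ)) {b : 𝓢(Eucl n, ℝ)}
    (hb : HasGaussianLowerBound b) (c : ℝ) :
    ∫ x, mulS (lapS a) b x * (Real.log (b x) + c) =
      -∫ x, (∑ i : Fin n, mulS (∂_{stdVec i} a) (∂_{stdVec i} b)) x *
        (Real.log (b x) + (c + 1)) := by
  have hG : ∀ x, HasFDerivAt (fun x => b x * (Real.log (b x) + c))
      ((Real.log (b x) + (c + 1)) • fderiv ℝ b x) x := by
    intro x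
    have h1 := b.differentiableAt (x := x) |>.hasFDerivAt
    refine (h1.mul ((h1.log (hb.pos x).ne').add_const c)).congr_fderiv ?_
    have := (hb.pos x).ne'
    rw [smul_smul, mul_inv_cancel₀ this, ← add_smul]
    congr 1
    ring
  have key : ∀ i : Fin n, ∫ x, mulS (∂_{stdVec i} (∂_{stdVec i} a)) b x *
        (Real.log (b x) + c) =
      -∫ x, mulS (∂_{stdVec i} a) (∂_{stdVec i} b) x * (Real.log (b x) + (c + 1)) := by
    intro i
    have h := integral_mul_fderiv_eq_neg_fderiv_mul_of_integrable (μ := volume) (v := stdVec i)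
      (f := (∂_{stdVec i} a : 𝓢(Eucl n, ℝ))) (g := fun x => b x * (Real.log (b x) + c)) ?_ ?_ ?_
      (fun x _ => (∂_{stdVec i} a : 𝓢(Eucl n, ℝ)).differentiableAt) (fun x _ => (hG x).differentiableAt)
    · have e1 : ∀ x, (∂_{stdVec i} a : 𝓢(Eucl n, ℝ)) x *
          fderiv ℝ (fun x => b x * (Real.log (b x) + c)) x (stdVec i) =
          mulS (∂_{stdVec i} a) (∂_{stdVec i} b) x * (Real.log (b x) + (c + 1)) := by
        intro x
        rw [(hG x).fderiv, mulS_apply, SchwartzMap.lineDerivOp_apply_eq_fderiv (f := b),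
          smul_apply, smul_eq_mul]
        ring
      have e2 : ∀ x, fderiv ℝ (∂_{stdVec i} a : 𝓢(Eucl n, ℝ)) x (stdVec i) *
          (b x * (Real.log (b x) + c)) =
          mulS (∂_{stdVec i} (∂_{stdVec i} a)) b x * (Real.log (b x) + c) := by
        intro x
        rw [mulS_apply, ← SchwartzMap.lineDerivOp_apply_eq_fderiv]
        ring
      simp_rw [e1, e2] at h
      rw [h, neg_neg]
    · refine (integrable_schwartz_mul_log_add hb
        (mulS (∂_{stdVec i} (∂_{stdVec i} a)) b) c).congr (Eventually.of_forall fun x => ?_)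
      simp only [mulS_apply, ← SchwartzMap.lineDerivOp_apply_eq_fderiv]
      ring
    · refine (integrable_schwartz_mul_log_add hb
        (mulS (∂_{stdVec i} a) (∂_{stdVec i} b)) (c + 1)).congr (Eventually.of_forall fun x => ?_)
      simp only [(hG x).fderiv, mulS_apply, SchwartzMap.lineDerivOp_apply_eq_fderiv (f := b),
          smul_apply, smul_eq_mul]
      ring
    · refine (integrable_schwartz_mul_log_add hb
        (mulS (∂_{stdVec i} a) b) c).congr (Eventually.of_forall fun x => ?_)
      simp only [mulS_apply]
      ring
  simp_rw [mulS_apply, lapS_apply, sum_apply, Finset.sum_mul]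
  simp_rw [mulS_apply] at key
  rw [integral_finsetSum, integral_finsetSum, ← Finset.sum_neg_distrib]
  · exact Finset.sum_congr rfl fun i _ => key i
  · exact fun i _ => integrable_schwartz_mul_log_add hb
      (mulS (∂_{stdVec i} a) (∂_{stdVec i} b)) (c + 1)
  · exact fun i _ => integrable_schwartz_mul_log_add hb
      (mulS (∂_{stdVec i} (∂_{stdVec i} a)) b) c

variable {f g : 𝓢(Eucl n, ℝ)} (hf : HasGaussianLowerBound f) (hg : HasGaussianLowerBound g)
include hf hg

theorem integral_lapS_mulS_heatS_log :
    1 / 2 * (∫ x, lapS (mulS g (heatS f)) x * Real.log (g x)) -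
      1 / 4 * ∫ x, lapS (mulS g (heatS f)) x * (Real.log (mulS g (heatS f) x) + 1) =
    -(1 / 2) * ∫ x, 1 / 2 * (lapS (heatS f) x * g x - heatS f x * lapS g x) *
      (Real.log (g x * heatS f x) + 1) := by
  have hF := hf.heatS
  set F := heatS f with hFdef
  set Z : 𝓢(Eucl n, ℝ) := ∑ i : Fin n, mulS (∂_{stdVec i} F) (∂_{stdVec i} g) with hZ
  set Z' : 𝓢(Eucl n, ℝ) := ∑ i : Fin n, mulS (∂_{stdVec i} g) (∂_{stdVec i} F)
  have hZZ : Z' = Z := Finset.sum_congr rfl fun i _ => by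
    ext x; simp only [mulS_apply, mul_comm]
  have h1 := integral_lapS_mul_mul_log_add F hg 0
  have h2 := integral_lapS_mul_mul_log_add g hF 1
  change _ = -∫ x, Z x * _ at h1
  change _ = -∫ x, Z' x * _ at h2
  rw [hZZ] at h2
  have hlap : ∀ x, lapS (mulS g F) x = mulS (lapS F) g x + mulS (lapS g) F x + 2 * Z x := by
    intro x
    rw [lapS_mulS_apply, hZ, sum_apply]
    simp only [mulS_apply, mul_comm ((∂_{stdVec _} g : 𝓢(Eucl n, ℝ)) x)]
    ring
  set P := mulS (lapS F) g
  set Q := mulS (lapS g) F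
  have hlog : ∀ x, Real.log (mulS g F x) = Real.log (g x) + Real.log (F x) := fun x =>
    Real.log_mul (hg.pos x).ne' (hF.pos x).ne'
  have hlog' : ∀ x, Real.log (g x * F x) = Real.log (g x) + Real.log (F x) := hlog
  have hPQ : ∀ x, lapS F x * g x - F x * lapS g x = P x - Q x := fun x => by
    simp only [P, Q, mulS_apply]; ring
  have eG := fun φ => integrable_schwartz_mul_log_add hg φ 0
  have eF := fun φ => integrable_schwartz_mul_log_add hF φ 0
  have e1 := fun φ : 𝓢(Eucl n, ℝ) => φ.integrable (μ := volume)
  simp only [add_zero] at eG eF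
  have sG : ∀ (φ : 𝓢(Eucl n, ℝ)) (c : ℝ), ∫ x, φ x * (Real.log (g x) + c) =
      (∫ x, φ x * Real.log (g x)) + c * ∫ x, φ x := by
    intro φ c
    simp_rw [mul_add]
    rw [integral_add (eG φ) ((e1 φ).mul_const c), integral_mul_const, mul_comm c]
  have sF : ∀ (φ : 𝓢(Eucl n, ℝ)) (c : ℝ), ∫ x, φ x * (Real.log (F x) + c) =
      (∫ x, φ x * Real.log (F x)) + c * ∫ x, φ x := by
    intro φ c
    simp_rw [mul_add]
    rw [integral_add (eF φ) ((e1 φ).mul_const c), integral_mul_const, mul_comm c]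
  have s3 : ∀ (φ : 𝓢(Eucl n, ℝ)), ∫ x, φ x * (Real.log (g x) + Real.log (F x) + 1) =
      (∫ x, φ x * Real.log (g x)) + (∫ x, φ x * Real.log (F x)) + ∫ x, φ x := by
    intro φ
    simp_rw [mul_add, mul_one]
    rw [integral_add (f := fun x => φ x * Real.log (g x) + φ x * Real.log (F x))
      ((eG φ).add (eF φ)) (e1 φ), integral_add (eG φ) (eF φ)]
  have sL : ∀ w : Eucl n → ℝ, (∀ φ : 𝓢(Eucl n, ℝ), Integrable fun x => φ x * w x) →
      ∫ x, lapS (mulS g F) x * w x =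
        (∫ x, P x * w x) + (∫ x, Q x * w x) + 2 * ∫ x, Z x * w x := by
    intro w hw
    simp_rw [hlap, add_mul, mul_assoc]
    rw [integral_add (f := fun x => P x * w x + Q x * w x) ((hw P).add (hw Q)) ((hw Z).const_mul 2), integral_add (hw P) (hw Q),
      integral_const_mul]
  have hw3 : ∀ φ : 𝓢(Eucl n, ℝ), Integrable fun x =>
      φ x * (Real.log (g x) + Real.log (F x) + 1) := by
    intro φ
    simp_rw [mul_add, mul_one]
    exact ((eG φ).add (eF φ)).add (e1 φ)
  simp_rw [hlog, hlog', hPQ, mul_assoc, sub_mul]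
  rw [integral_const_mul, integral_sub (hw3 P) (hw3 Q), sL _ eG, sL _ hw3]
  rw [sG, sG] at h1
  rw [sF, sF] at h2
  rw [s3, s3, s3]
  linarith

end

section
open scoped SchwartzMap Topology
variable {n : ℕ}

theorem hasDerivWithinAt_integral_log_heat {g : 𝓢(Eucl n, ℝ)} (hg : HasGaussianLowerBound g)
    {φ : 𝓢(Eucl n, ℝ)} (hφ : HasGaussianLowerBound φ) :
    HasDerivWithinAt (fun t => ∫ y, Real.log (g y) ∂(densMeas n (heat n t φ)))
      (1 / 2 * ∫ x, lapS φ x * Real.log (g x)) (Ici 0) 0 := by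
  obtain ⟨C, -, hC⟩ := exists_abs_log_le_of_hasGaussianLowerBound hg
  obtain ⟨A, -, hA⟩ := exists_heat_weight_bound φ (n + 1 + 2) 1
  obtain ⟨B, -, hB⟩ := exists_heat_sub_weight_bound φ (n + 1 + 2) 1
  have hnhd : Icc (0 : ℝ) 1 ∈ 𝓝[Ici 0] (0 : ℝ) := by simpa using mem_nhdsWithin_Icc_add_one 0
  have hgm := g.continuous.measurable.log
  have key : HasDerivWithinAt (fun t => ∫ x, heat n t φ x * Real.log (g x))
      (∫ x, 1 / 2 * heat n 0 (lapS φ) x * Real.log (g x)) (Ici 0) 0 := by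
    refine hasDerivWithinAt_integral_of_abs_sub_le
      (D := fun x => B * ((1 + ‖x‖) ^ (n + 1 + 2))⁻¹ * |Real.log (g x)|) self_mem_Ici ?_ ?_ ?_ ?_
    · filter_upwards [hnhd] with t ht
      exact integrable_mul_of_bounds (continuous_heat φ ht.1).measurable hgm (hA t ht) hC
    · filter_upwards [hnhd] with t ht x
      rw [← sub_mul, abs_mul, ← mul_assoc]
      refine mul_le_mul_of_nonneg_right ?_ (abs_nonneg _)
      refine (abs_le_mul_inv_of_mul_le (by positivity)
        (hB t ht 0 (left_mem_Icc.2 zero_le_one) x)).trans (le_of_eq (by ring))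
    · exact integrable_inv_weight_mul (by fun_prop) (fun x => by rw [abs_abs]; exact hC x) B
    · exact fun x => (hasDerivWithinAt_heat φ x le_rfl).mul_const _
  have h0 : heat n 0 (lapS φ) = lapS φ := by ext x; simp [heat]
  simp_rw [h0, mul_assoc, integral_const_mul] at key
  refine key.congr_of_mem (fun t ht => ?_) self_mem_Ici
  exact integral_densMeas (continuous_heat φ ht).measurable fun x => ((hφ.heat ht).pos x).le

/-- A function squeezed between two functions with a common value and derivative is
differentiable. -/
theorem HasDerivWithinAt.of_le_of_le {a b c : ℝ → ℝ} {d t₀ : ℝ} {S : Set ℝ} (ht₀ : t₀ ∈ S)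
    (ha : HasDerivWithinAt a d S t₀) (hc : HasDerivWithinAt c d S t₀) (h₀ : a t₀ = c t₀)
    (hab : ∀ᶠ t in 𝓝[S] t₀, a t ≤ b t) (hbc : ∀ᶠ t in 𝓝[S] t₀, b t ≤ c t) :
    HasDerivWithinAt b d S t₀ := by
  have hb₀ : b t₀ = a t₀ :=
    le_antisymm (h₀ ▸ hbc.self_of_nhdsWithin ht₀) (hab.self_of_nhdsWithin ht₀)
  rw [hasDerivWithinAt_iff_isLittleO] at *
  refine (Asymptotics.IsBigO.of_bound 1 ?_).trans_isLittleO (ha.norm_left.add hc.norm_left)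
  filter_upwards [hab, hbc] with t h1 h2
  simp only [Real.norm_eq_abs, one_mul]
  refine le_trans (abs_le.2 ⟨?_, ?_⟩) (le_abs_self _)
  · linarith [neg_abs_le (a t - a t₀ - (t - t₀) • d), abs_nonneg (c t - c t₀ - (t - t₀) • d)]
  · linarith [le_abs_self (c t - c t₀ - (t - t₀) • d), abs_nonneg (a t - a t₀ - (t - t₀) • d)]

variable {f g : 𝓢(Eucl n, ℝ)} (hf : HasGaussianLowerBound f) (hg : HasGaussianLowerBound g)
  [IsProbabilityMeasure (densMeas n (mulS f (heatS g)))]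
  [IsProbabilityMeasure (densMeas n (mulS g (heatS f)))]
include hf hg

theorem hasDerivWithinAt_entCost_heat_zero :
    HasDerivWithinAt (fun t => entCost n (densMeas n (mulS f (heatS g)))
        (densMeas n (heat n t (mulS g (heatS f)))))
      (-(1 / 2) * ∫ x, 1 / 2 * (lapS (heatS f) x * g x - heatS f x * lapS g x) *
        (Real.log (g x * heatS f x) + 1)) (Ici 0) 0 := by
  have hu := hf.mulS hg.heatS
  have hv := hg.mulS hf.heatS
  have hex : ∀ t : ℝ, ∃ I : ℝ, 0 ≤ t → (⨅ π : {π : Measure (Eucl n × Eucl n) //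
      Coupling π (densMeas n (mulS f (heatS g))) (densMeas n (heat n t (mulS g (heatS f))))},
      relEnt π.1 (R01 n)) = (I : EReal) := by
    intro t
    by_cases ht : 0 ≤ t
    · obtain ⟨I, hI⟩ := exists_iInf_relEnt_heat hu.tameDensity hv ht
      exact ⟨I, fun _ => hI⟩
    · exact ⟨0, fun h => absurd h ht⟩
  choose I hI using hex
  have hnhd : Icc (0 : ℝ) 1 ∈ 𝓝[Ici 0] (0 : ℝ) := by simpa using mem_nhdsWithin_Icc_add_one 0
  obtain ⟨hint, hr⟩ := hasDerivWithinAt_integral_flowDensity hf hg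
  have hl := (hasDerivWithinAt_integral_log_heat hg hv).const_add
    (∫ x, Real.log (f x) ∂(densMeas n (mulS f (heatS g))))
  have hrl := hr.add hl
  rw [zero_add] at hrl
  have hd : HasDerivWithinAt I (1 / 2 * ∫ x, lapS (mulS g (heatS f)) x * Real.log (g x))
      (Ici 0) 0 := by
    refine hl.of_le_of_le self_mem_Ici hrl ?_ ?_ ?_
    · simp
    · filter_upwards [hnhd, hint] with t ht hi
      exact (iInf_relEnt_heat_bounds hf hg ht hi (hI t ht.1)).1
    · filter_upwards [hnhd, hint] with t ht hi
      exact (iInf_relEnt_heat_bounds hf hg ht hi (hI t ht.1)).2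
  have hE := hasDerivWithinAt_entDens_heat hv le_rfl
  have h0 : ∀ φ : 𝓢(Eucl n, ℝ), heat n 0 φ = φ := fun φ => by ext x; simp [heat]
  rw [h0, h0] at hE
  rw [← integral_lapS_mulS_heatS_log hf hg]
  refine ((hd.sub ((hE.const_add (entDens n (mulS f (heatS g)))).div_const 2)).congr_of_mem
    (fun t ht => ?_) self_mem_Ici).congr_deriv ?_
  · exact entCost_densMeas hu.tameDensity (hv.tameDensity_heat ht) (hI t ht)
  · simp_rw [mul_assoc, integral_const_mul]
    ring

end

theorem entropic_cost_differentiable_along_heat_flow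
    (n : ℕ) (hn : 1 ≤ n) (u v f g : Eucl n → ℝ)
    (hu : IsProbabilityMeasure (densMeas n u)) (hv : IsProbabilityMeasure (densMeas n v))
    (hf : IsSchwartz n f) (hg : IsSchwartz n g)
    (hfpos : ∀ x, 0 < f x) (hgpos : ∀ x, 0 < g x)
    (hlb : ∃ α c : ℝ, 0 < α ∧ 0 < c ∧ (∀ x, c * Real.exp (-α * ‖x‖ ^ 2) ≤ f x) ∧ (∀ x, c * Real.exp (-α * ‖x‖ ^ 2) ≤ g x))
    (hdecu : ∀ x, u x = f x * heat n 1 g x) (hdecv : ∀ x, v x = g x * heat n 1 f x) :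
    (∀ t ∈ Set.Ici (0 : ℝ), DifferentiableWithinAt ℝ (fun t => entCost n (densMeas n u) (densMeas n (heat n t v))) (Set.Ici 0) t) ∧
      derivWithin (fun t => entCost n (densMeas n u) (densMeas n (heat n t v))) (Set.Ici 0) 0
        = -(1 / 2) * derivWithin (fun s => entDens n (entInterp n f g s)) (Set.Icc 0 1) 1 := by
  obtain ⟨f, rfl⟩ := hf
  obtain ⟨g, rfl⟩ := hg
  obtain ⟨α, c, hα, hc, hf, hg⟩ := hlb
  have hf : HasGaussianLowerBound f := ⟨α, c, hα, hc, hf⟩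
  have hg : HasGaussianLowerBound g := ⟨α, c, hα, hc, hg⟩
  obtain rfl : u = mulS f (heatS g) := funext fun x => by rw [hdecu, mulS_apply, heatS_apply]
  obtain rfl : v = mulS g (heatS f) := funext fun x => by rw [hdecv, mulS_apply, heatS_apply]
  have h0 := hasDerivWithinAt_entCost_heat_zero hf hg
  refine ⟨fun t ht => ?_, ?_⟩
  · rcases eq_or_lt_of_le (mem_Ici.1 ht) with rfl | ht
    · exact h0.differentiableWithinAt
    · exact differentiableWithinAt_entCost_heat (hf.mulS hg.heatS).tameDensity
        (hg.mulS hf.heatS) ht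
  · rw [h0.derivWithin (uniqueDiffOn_Ici 0 0 self_mem_Ici),
      (hasDerivWithinAt_entDens_entInterp hf hg).derivWithin
        (uniqueDiffOn_Icc_zero_one 1 (right_mem_Icc.2 zero_le_one))]
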